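/- For every integer t ≥ 1, every finite simple graph G that does not admit a totally odd immersion of the complete graph K_t has chromatic number at most 700000·t + 32000000. -/

import Mathlib

open SimpleGraph

/-- An immersion of `H` in `G`: an injection `φ` of the vertices of `H` into `G`
(the branch vertices), together with, for each edge `uv` of `H`, a trail in `G`
from `φ u` to `φ v` (the branch trails), such that the branch trails are
pairwise edge-disjoint.  The trail assigned to the reversed adjacency is the
reversed trail, so there is one branch trail per edge of `H`. -/
structure Immersion {V : Type*} {W : Type*} (G : SimpleGraph V) (H : SimpleGraph W) where
  φ : W ↪ V
  trail : ∀ ⦃u v : W⦄, H.Adj u v → G.Walk (φ u) (φ v)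
  isTrail : ∀ ⦃u v : W⦄ (h : H.Adj u v), (trail h).IsTrail
  symm : ∀ ⦃u v : W⦄ (h : H.Adj u v), trail h.symm = (trail h).reverse
  disjoint : ∀ ⦃u v a b : W⦄ (h₁ : H.Adj u v) (h₂ : H.Adj a b),
      s(u, v) ≠ s(a, b) → List.Disjoint (trail h₁).edges (trail h₂).edges

/-- `G` admits an immersion of `H`. -/
def HasImmersion {V W : Type*} (G : SimpleGraph V) (H : SimpleGraph W) : Prop :=
  Nonempty (Immersion G H)

/-- `G` admits a totally odd immersion of `H`: every branch trail has odd length. -/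
def HasTotallyOddImmersion {V W : Type*} (G : SimpleGraph V) (H : SimpleGraph W) : Prop :=
  ∃ I : Immersion G H, ∀ ⦃u v : W⦄ (h : H.Adj u v), Odd (I.trail h).length

/-- `G` admits a totally even immersion of `H`: every branch trail has even length. -/
def HasTotallyEvenImmersion {V W : Type*} (G : SimpleGraph V) (H : SimpleGraph W) : Prop :=
  ∃ I : Immersion G H, ∀ ⦃u v : W⦄ (h : H.Adj u v), Even (I.trail h).length

namespace TOI
set_option linter.unusedVariables false
set_option linter.unusedSectionVars false
open SimpleGraph
section P1
open scoped Classical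
variable {V : Type*}

def Imm (G' G : SimpleGraph V) : Prop :=
  ∃ S : Sym2 V → Set (Sym2 V),
    (∀ e ∈ G'.edgeSet, S e ⊆ G.edgeSet) ∧
    (∀ e ∈ G'.edgeSet, ∀ e' ∈ G'.edgeSet, e ≠ e' → Disjoint (S e) (S e')) ∧
    (∀ a b, G'.Adj a b → (fromEdgeSet (S s(a,b))).Reachable a b)

def KOn (B : Finset V) : SimpleGraph V where
  Adj a b := a ∈ B ∧ b ∈ B ∧ a ≠ b
  symm := ⟨fun a b h => ⟨h.2.1, h.1, h.2.2.symm⟩⟩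
  loopless := ⟨fun a h => h.2.2 rfl⟩

def HasK (s : ℕ) (G : SimpleGraph V) : Prop :=
  ∃ B : Finset V, B.card = s ∧ Imm (KOn B) G

lemma reach_mono {A C : Set (Sym2 V)} (h : A ⊆ C) {a b : V}
    (hr : (fromEdgeSet A).Reachable a b) : (fromEdgeSet C).Reachable a b :=
  hr.mono (fromEdgeSet_mono h)

lemma reach_edge {A : Set (Sym2 V)} {a b : V} (h : s(a, b) ∈ A) :
    (fromEdgeSet A).Reachable a b := by
  by_cases hab : a = b
  · subst hab; exact Reachable.refl _
  · exact (show (fromEdgeSet A).Adj a b by rw [fromEdgeSet_adj]; exact ⟨h, hab⟩).reachable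

lemma reach_lift {G H : SimpleGraph V} (h : ∀ x y, G.Adj x y → H.Reachable x y) {a b : V}
    (hr : G.Reachable a b) : H.Reachable a b := by
  obtain ⟨w⟩ := hr
  induction w with
  | nil => exact Reachable.refl _
  | cons hadj _ ih => exact (h _ _ hadj).trans ih

lemma Imm.trans {G₁ G₂ G₃ : SimpleGraph V} (h : Imm G₁ G₂) (h' : Imm G₂ G₃) : Imm G₁ G₃ := by
  obtain ⟨S, hS1, hS2, hS3⟩ := h
  obtain ⟨R, hR1, hR2, hR3⟩ := h'
  refine ⟨fun e => ⋃ f ∈ S e, R f, ?_, ?_, ?_⟩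
  · intro e he
    exact Set.iUnion₂_subset fun f hf => hR1 f (hS1 e he hf)
  · intro e he e' he' hne
    rw [Set.disjoint_left]
    intro x hx hx'
    simp only [Set.mem_iUnion] at hx hx'
    obtain ⟨f, hf, hxf⟩ := hx
    obtain ⟨f', hf', hxf'⟩ := hx'
    by_cases hff : f = f'
    · subst hff
      exact Set.disjoint_left.1 (hS2 e he e' he' hne) hf hf'
    · exact Set.disjoint_left.1 (hR2 f (hS1 e he hf) f' (hS1 e' he' hf') hff) hxf hxf'
  · intro a b hab
    refine reach_lift ?_ (hS3 a b hab)
    intro x y hxy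
    rw [fromEdgeSet_adj] at hxy
    refine reach_mono ?_ (hR3 x y ?_)
    · exact Set.subset_biUnion_of_mem (u := fun f => R f) hxy.1
    · exact hS1 _ ((mem_edgeSet _).2 hab) hxy.1

lemma HasK.trans {s : ℕ} {G' G : SimpleGraph V} (h : HasK s G') (h' : Imm G' G) : HasK s G := by
  obtain ⟨B, hB, hi⟩ := h
  exact ⟨B, hB, hi.trans h'⟩

lemma greedy {I α : Type*} [Nonempty α] (rank : I → ℕ) (conf : I → I → Prop)
    (hs : ∀ i j, conf i j → conf j i) (Opt : I → Finset α) (s : Finset I)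
    (h : ∀ i ∈ s, ∃ C : Finset I, (∀ j ∈ s, j ≠ i → conf i j → rank j ≤ rank i → j ∈ C) ∧
      C.card < (Opt i).card) :
    ∃ c : I → α, (∀ i ∈ s, c i ∈ Opt i) ∧
      ∀ i ∈ s, ∀ j ∈ s, i ≠ j → conf i j → c i ≠ c j := by
  induction s using Finset.strongInduction with
  | H s ih =>
  rcases s.eq_empty_or_nonempty with rfl | hne
  · exact ⟨fun _ => Classical.arbitrary α, by simp, by simp⟩
  obtain ⟨i0, hi0, hmax⟩ := s.exists_max_image rank hne
  obtain ⟨c, hc1, hc2⟩ := ih (s.erase i0) (Finset.erase_ssubset hi0) (by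
    intro i hi
    obtain ⟨C, hC1, hC2⟩ := h i (Finset.mem_of_mem_erase hi)
    exact ⟨C, fun j hj => hC1 j (Finset.mem_of_mem_erase hj), hC2⟩)
  obtain ⟨C, hC1, hC2⟩ := h i0 hi0
  have : ∃ x ∈ Opt i0, x ∉ C.image c :=
    Finset.exists_mem_notMem_of_card_lt_card (lt_of_le_of_lt Finset.card_image_le hC2)
  obtain ⟨x, hx, hx'⟩ := this
  have key : ∀ j ∈ s, j ≠ i0 → conf i0 j → c j ≠ x := by
    intro j hj hji hconf heq
    exact hx' (Finset.mem_image.2 ⟨j, hC1 j hj hji hconf (hmax j hj), heq⟩)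
  refine ⟨Function.update c i0 x, ?_, ?_⟩
  · intro i hi
    by_cases hii : i = i0
    · subst hii; simpa using hx
    · simpa [hii] using hc1 i (Finset.mem_erase.2 ⟨hii, hi⟩)
  · intro i hi j hj hij hconf
    by_cases hii : i = i0
    · subst hii
      have hji : j ≠ i := fun h => hij h.symm
      simpa [hji] using (key j hj hji hconf).symm
    · by_cases hjj : j = i0
      · subst hjj
        simpa [hii] using (key i hi hii (hs _ _ hconf))
      · simpa [hii, hjj] using
          hc2 i (Finset.mem_erase.2 ⟨hii, hi⟩) j (Finset.mem_erase.2 ⟨hjj, hj⟩) hij hconf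

lemma cn_lemma (G : SimpleGraph V) (s : ℕ) (B X : Finset V) (hB : B.card = s)
    (hBX : Disjoint B X)
    (h : ∀ b ∈ B, ∀ b' ∈ B, b ≠ b' →
      2 * s ≤ (X.filter (fun x => G.Adj b x ∧ G.Adj b' x)).card) : HasK s G := by
  rcases isEmpty_or_nonempty V with hV | hV
  · exact ⟨B, hB, fun _ => ∅, by simp, by simp, fun a => hV.elim a⟩
  set E : Finset (Sym2 V) := (B.sym2).filter (fun e => ¬ e.IsDiag) with hE
  have hEm : ∀ e, e ∈ E ↔ e ∈ (KOn B).edgeSet := by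
    intro e
    induction e using Sym2.ind with
    | _ a b =>
    simp [hE, KOn, and_assoc]
  obtain ⟨c, hc1, hc2⟩ := greedy (I := Sym2 V) (α := V) (fun _ => 0)
    (fun e e' => ∃ v, v ∈ e ∧ v ∈ e') (fun i j ⟨v, h1, h2⟩ => ⟨v, h2, h1⟩)
    (fun e => X.filter (fun x => ∀ v ∈ e, G.Adj v x)) E (by
      intro e he
      induction e using Sym2.ind with
      | _ a b =>
      have hab := (mem_edgeSet _).1 ((hEm _).1 he)
      obtain ⟨ha, hb, hne⟩ := hab
      have h1 := h a ha b hb hne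
      have h2 : (X.filter (fun x => ∀ v ∈ s(a,b), G.Adj v x)) =
          (X.filter (fun x => G.Adj a x ∧ G.Adj b x)) := by
        ext x; simp
      rw [h2]
      refine ⟨(B.erase a).image (fun w => s(a, w)) ∪
          (B.erase b).image (fun w => s(b, w)), ?_, lt_of_lt_of_le ?_ h1⟩
      · rintro j hjE - ⟨v, hv, hvj⟩ -
        obtain ⟨w, rfl⟩ := hvj
        have hvw := (mem_edgeSet _).1 ((hEm _).1 hjE)
        obtain ⟨hvB, hwB, hvw⟩ := hvw
        rw [Finset.mem_union, Finset.mem_image, Finset.mem_image]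
        rcases Sym2.mem_iff.1 hv with rfl | rfl
        · exact Or.inl ⟨w, Finset.mem_erase.2 ⟨hvw.symm, hwB⟩, rfl⟩
        · exact Or.inr ⟨w, Finset.mem_erase.2 ⟨hvw.symm, hwB⟩, rfl⟩
      refine lt_of_le_of_lt (Finset.card_union_le _ _) ?_
      have h5 : ((B.erase a).image (fun w => s(a, w))).card ≤ _ := Finset.card_image_le
      have h6 : ((B.erase b).image (fun w => s(b, w))).card ≤ _ := Finset.card_image_le
      rw [Finset.card_erase_of_mem ha] at h5
      rw [Finset.card_erase_of_mem hb] at h6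
      have : 0 < B.card := Finset.card_pos.2 ⟨a, ha⟩
      omega)
  refine ⟨B, hB, fun e => {f | ∃ v ∈ e, f = s(v, c e)}, ?_, ?_, ?_⟩
  · rintro e he f ⟨v, hv, rfl⟩
    have := hc1 e ((hEm e).2 he)
    exact (mem_edgeSet _).2 ((Finset.mem_filter.1 this).2 v hv)
  · intro e he e' he' hne
    rw [Set.disjoint_left]
    rintro f ⟨v, hv, rfl⟩ ⟨v', hv', heq⟩
    have h1 := (Finset.mem_filter.1 (hc1 e ((hEm e).2 he))).1
    have h2 := (Finset.mem_filter.1 (hc1 e' ((hEm e').2 he'))).1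
    have hvB : ∀ e ∈ (KOn B).edgeSet, ∀ v ∈ e, v ∈ B := by
      intro e he v hv
      obtain ⟨w, rfl⟩ := hv
      exact ((mem_edgeSet _).1 he).1
    have h3 := hvB e he v hv
    have h4 := hvB e' he' v' hv'
    rw [Sym2.eq_iff] at heq
    rcases heq with ⟨h5, h6⟩ | ⟨h5, h6⟩
    · subst h5
      exact hc2 e ((hEm e).2 he) e' ((hEm e').2 he') hne ⟨v, hv, hv'⟩ h6
    · rw [h5] at h3
      exact Finset.disjoint_left.1 hBX h3 h2
  · intro a b hab
    refine Reachable.trans (v := c s(a,b)) (reach_edge ⟨a, by simp, rfl⟩) ?_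
    exact (reach_edge (A := {f | ∃ v ∈ s(a,b), f = s(v, c s(a,b))}) ⟨b, by simp, rfl⟩).symm
end P1
end TOI

namespace TOI
set_option linter.unusedVariables false
set_option linter.unusedSectionVars false
open SimpleGraph
section P2
open scoped Classical
variable {V : Type*} [Fintype V]

lemma exists_invol (W : Finset V) (hW : Even W.card) :
    ∃ m : Equiv.Perm V, (∀ z, m (m z) = z) ∧ ∀ z, z ∈ W ↔ m z ≠ z := by
  induction W using Finset.strongInduction with
  | H W ih =>
  rcases W.eq_empty_or_nonempty with rfl | ⟨x, hx⟩
  · exact ⟨1, by simp, by simp⟩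
  have hc : 0 < (W.erase x).card := by
    rw [Finset.card_erase_of_mem hx]
    have : 0 < W.card := Finset.card_pos.2 ⟨x, hx⟩
    obtain ⟨k, hk⟩ := hW
    omega
  obtain ⟨y, hy⟩ := Finset.card_pos.1 hc
  have hyx : y ≠ x := Finset.ne_of_mem_erase hy
  have hyW : y ∈ W := Finset.mem_of_mem_erase hy
  obtain ⟨m, hm1, hm2⟩ := ih ((W.erase x).erase y)
    ((Finset.erase_ssubset hy).trans (Finset.erase_ssubset hx)) (by
      rw [Finset.card_erase_of_mem hy, Finset.card_erase_of_mem hx]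
      rw [Finset.card_erase_of_mem hx] at hc
      obtain ⟨k, hk⟩ := hW
      exact ⟨k - 1, by omega⟩)
  have hmx : m x = x := by
    by_contra h; have := (hm2 x).2 h; simp at this
  have hmy : m y = y := by
    by_contra h; have := (hm2 y).2 h; simp at this
  refine ⟨m * Equiv.swap x y, ?_, ?_⟩
  · intro z
    simp only [Equiv.Perm.mul_apply]
    grind
  · intro z
    have h1 := hm2 z
    simp only [Equiv.Perm.mul_apply]
    grind

lemma matching (G : SimpleGraph V) (s : ℕ) (hs : 1 ≤ s) (W : Finset V) (hW : Even W.card)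
    (C Used : V → V → Prop) (hCs : ∀ x y, C x y → C y x) (hCi : ∀ x, ¬ C x x)
    (hC : ∀ x ∈ W, ∀ y ∈ W, x ≠ y → ¬ C x y → G.Adj x y ∨ Used x y)
    (hU : ∀ x ∈ W, (W.filter (Used x)).card ≤ s + 1)
    (hdeg : ∀ x ∈ W, 10 * s ≤ (W.filter (C x)).card)
    (hK : ¬ HasK s G) :
    ∃ m : V → V, ∀ x ∈ W, m x ∈ W ∧ m (m x) = x ∧ m x ≠ x ∧ C x (m x) := by
  set P : Finset (Equiv.Perm V) := Finset.univ.filter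
    (fun m => (∀ z, m (m z) = z) ∧ ∀ z, z ∈ W ↔ m z ≠ z) with hP
  have hPne : P.Nonempty := by
    obtain ⟨m, hm⟩ := exists_invol W hW
    exact ⟨m, by simpa [hP] using hm⟩
  obtain ⟨m, hmP, hmin⟩ := P.exists_min_image (fun m => (W.filter (fun z => ¬ C z (m z))).card) hPne
  obtain ⟨hm1, hm2⟩ : (∀ z, m (m z) = z) ∧ ∀ z, z ∈ W ↔ m z ≠ z := by simpa [hP] using hmP
  have hmW : ∀ z ∈ W, m z ∈ W := fun z hz => (hm2 _).2 (by
    rw [hm1]; exact ((hm2 z).1 hz).symm)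
  by_cases hbad : ∀ x ∈ W, C x (m x)
  · exact ⟨m, fun x hx => ⟨hmW x hx, hm1 x, (hm2 x).1 hx, hbad x hx⟩⟩
  exfalso
  push Not at hbad
  obtain ⟨x, hx, hxbad⟩ := hbad
  -- no improvement
  have noimp : ∀ m' ∈ P, C x (m' x) → (∀ z ∈ W, C z (m' z) ∨ m' z = m z) → False := by
    intro m' hm' hgood hz
    have h1 := hmin m' hm'
    refine absurd h1 (not_le.2 (Finset.card_lt_card ?_))
    rw [Finset.ssubset_iff_of_subset]
    · exact ⟨x, by simp [hx, hxbad], by simp [hgood]⟩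
    · intro z hzz
      rw [Finset.mem_filter] at hzz ⊢
      refine ⟨hzz.1, ?_⟩
      rcases hz z hzz.1 with h | h
      · exact absurd h hzz.2
      · rw [← h]; exact hzz.2
  have conj : ∀ τ : Equiv.Perm V, (∀ z, z ∈ W ↔ τ z ∈ W) → τ * m * τ⁻¹ ∈ P := by
    intro τ hτ
    simp only [hP, Finset.mem_filter, Finset.mem_univ, true_and, Equiv.Perm.mul_apply]
    refine ⟨fun z => by simp [hm1], fun z => ?_⟩
    have h1 := hτ (τ⁻¹ z)
    rw [show τ (τ⁻¹ z) = z by simp] at h1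
    rw [← h1, hm2, ne_eq, ne_eq, not_iff_not]
    constructor
    · intro h; rw [h]; simp
    · intro h; apply τ.injective; rw [h]; simp
  set y := m x with hy
  have hyW : y ∈ W := hmW x hx
  have hxy : x ≠ y := fun h => (hm2 x).1 hx h.symm
  have hmy : m y = x := hm1 x
  -- single swap
  have single : ∀ p ∈ W, C x p → C y (m p) → False := by
    intro p hp hxp hyp
    have hpx : p ≠ x := by rintro rfl; exact hCi _ hxp
    have hpy : p ≠ y := by rintro rfl; exact hxbad hxp
    have hpp : m p ≠ p := (hm2 p).1 hp
    have hppx : m p ≠ x := fun h => hpy (by rw [hy, ← h, hm1])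
    have hppy : m p ≠ y := fun h => hpx (m.injective (h.trans hy))
    have hppW := hmW p hp
    refine noimp (Equiv.swap y p * m * (Equiv.swap y p)⁻¹) (conj _ ?_) ?_ ?_
    · intro z; grind
    · simp only [Equiv.Perm.mul_apply, Equiv.swap_inv]
      grind
    · intro z hz
      have hzz := hm1 z
      simp only [Equiv.Perm.mul_apply, Equiv.swap_inv]
      grind
  have double : ∀ p ∈ W, ∀ q ∈ W, C x p → C y q → m p ≠ m q → ¬ C (m p) (m q) := by
    intro p hp q hq hxp hyq hpq hpq'
    have hqne : q ≠ m p := fun h => single p hp hxp (h ▸ hyq)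
    have hpq0 : p ≠ q := fun h => hpq (by rw [h])
    have hpx : p ≠ x := by rintro rfl; exact hCi _ hxp
    have hpy : p ≠ y := by rintro rfl; exact hxbad hxp
    have hpp : m p ≠ p := (hm2 p).1 hp
    have hppx : m p ≠ x := fun h => hpy (by rw [hy, ← h, hm1])
    have hppy : m p ≠ y := fun h => hpx (m.injective (h.trans hy))
    have hppW := hmW p hp
    have hqy : q ≠ y := by rintro rfl; exact hCi _ hyq
    have hqx : q ≠ x := by rintro rfl; exact hxbad (hCs _ _ hyq)
    have hqq : m q ≠ q := (hm2 q).1 hq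
    have hqqx : m q ≠ x := fun h => hqy (by rw [hy, ← h, hm1])
    have hqqy : m q ≠ y := fun h => hqx (m.injective (h.trans hy))
    have hqqW := hmW q hq
    have hpq2 : m q ≠ p := fun h => hqne (by rw [← h, hm1])
    have hs1 := hCs _ _ hxp
    have hs2 := hCs _ _ hyq
    have hs3 := hCs _ _ hpq'
    have hmp := hm1 p
    have hmq := hm1 q
    refine noimp ((Equiv.swap y p * Equiv.swap p (m q)) * m *
      (Equiv.swap y p * Equiv.swap p (m q))⁻¹) (conj _ ?_) ?_ ?_
    · intro z; simp only [Equiv.Perm.mul_apply]; grind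
    · simp only [Equiv.Perm.mul_apply, Equiv.swap_inv, mul_inv_rev]
      grind
    · intro z hz
      have hzz := hm1 z
      simp only [Equiv.Perm.mul_apply, Equiv.swap_inv, mul_inv_rev]
      grind
  set X' := (W.filter (C x)).image m with hX'
  set Y' := (W.filter (C y)).image m with hY'
  have hX'c : 10 * s ≤ X'.card := by
    rw [hX', Finset.card_image_of_injective _ m.injective]; exact hdeg x hx
  have hY'c : 10 * s ≤ Y'.card := by
    rw [hY', Finset.card_image_of_injective _ m.injective]; exact hdeg y hyW
  have hX'W : X' ⊆ W := by
    intro z hz; rw [hX', Finset.mem_image] at hz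
    obtain ⟨p, hp, rfl⟩ := hz; exact hmW p (Finset.mem_filter.1 hp).1
  have hY'W : Y' ⊆ W := by
    intro z hz; rw [hY', Finset.mem_image] at hz
    obtain ⟨p, hp, rfl⟩ := hz; exact hmW p (Finset.mem_filter.1 hp).1
  have hXY : ∀ a ∈ X', ∀ b ∈ Y', a ≠ b → G.Adj a b ∨ Used a b := by
    intro a ha b hb hab
    refine hC a (hX'W ha) b (hY'W hb) hab ?_
    rw [hX', Finset.mem_image] at ha
    rw [hY', Finset.mem_image] at hb
    obtain ⟨p, hp, rfl⟩ := ha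
    obtain ⟨q, hq, rfl⟩ := hb
    rw [Finset.mem_filter] at hp hq
    exact double p hp.1 q hq.1 hp.2 hq.2 hab
  obtain ⟨B, hBX, hB⟩ := Finset.exists_subset_card_eq (show s ≤ X'.card by omega)
  apply hK
  refine cn_lemma G s B (Y' \ B) hB Finset.disjoint_sdiff ?_
  intro b hb b' hb' hbb
  have hsub : Y' ⊆ ((Y' \ B).filter (fun x => G.Adj b x ∧ G.Adj b' x)) ∪
      (B ∪ (W.filter (Used b) ∪ W.filter (Used b'))) := by
    intro z hz
    by_cases hzB : z ∈ B
    · simp [hzB]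
    have h1 := hXY b (hBX hb) z hz (fun h => hzB (h ▸ hb))
    have h2 := hXY b' (hBX hb') z hz (fun h => hzB (h ▸ hb'))
    have hzW := hY'W hz
    simp only [Finset.mem_union, Finset.mem_filter, Finset.mem_sdiff]
    tauto
  have h1 := Finset.card_le_card hsub
  have h2 := Finset.card_union_le ((Y' \ B).filter (fun x => G.Adj b x ∧ G.Adj b' x))
      (B ∪ (W.filter (Used b) ∪ W.filter (Used b')))
  have h3 := Finset.card_union_le B (W.filter (Used b) ∪ W.filter (Used b'))
  have h4 := Finset.card_union_le (W.filter (Used b)) (W.filter (Used b'))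
  have h5 := hU b (hX'W (hBX hb))
  have h6 := hU b' (hX'W (hBX hb'))
  omega
end P2
end TOI

namespace TOI
set_option linter.unusedVariables false
set_option linter.unusedSectionVars false
open SimpleGraph
section P3
open scoped Classical
variable {V : Type*}

/-- Overflow recursion. -/
def ovf (c : ℕ → ℕ) : ℕ → ℕ
  | 0 => 0
  | n + 1 => ovf c n + c n - 1

lemma ovf_ge (c : ℕ → ℕ) (y k : ℕ) : ∑ x ∈ Finset.Ico y (y + k), c x ≤ ovf c (y + k) + k := by
  induction k with
  | zero => simp
  | succ k ih =>
    rw [← add_assoc, Finset.sum_Ico_succ_top (by omega), ovf]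
    omega

lemma ovf_count (c : ℕ → ℕ) (n : ℕ) :
    ((Finset.range n).filter (fun x => 1 ≤ ovf c x)).card + ovf c n ≤
      ∑ x ∈ Finset.range n, c x := by
  induction n with
  | zero => simp [ovf]
  | succ n ih =>
    rw [Finset.sum_range_succ, Finset.range_add_one, Finset.filter_insert, ovf]
    split_ifs with h
    · rw [Finset.card_insert_of_notMem (by simp)]
      omega
    · omega

lemma left_bad_count (Big : Finset V) (a : V → ℕ) (n : ℕ) :
    ((Finset.range n).filter (fun θ => ∃ y < θ,
      θ - y < (Big.filter (fun z => y ≤ a z ∧ a z < θ)).card)).card ≤ Big.card := by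
  set c : ℕ → ℕ := fun x => (Big.filter (fun z => a z = x)).card with hc
  have hsum : ∀ y θ, ∑ x ∈ Finset.Ico y θ, c x =
      (Big.filter (fun z => y ≤ a z ∧ a z < θ)).card := by
    intro y θ
    rw [hc]
    rw [Finset.card_eq_sum_card_fiberwise (f := a) (t := Finset.Ico y θ)]
    · refine Finset.sum_congr rfl fun x hx => ?_
      refine congrArg Finset.card ?_
      ext z
      simp only [Finset.mem_filter, Finset.mem_Ico] at hx ⊢
      constructor
      · rintro ⟨h1, rfl⟩; exact ⟨⟨h1, hx⟩, rfl⟩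
      · rintro ⟨⟨h1, _⟩, h2⟩; exact ⟨h1, h2⟩
    · intro z hz
      simp only [Finset.coe_filter, Set.mem_ofPred_eq] at hz
      simpa using hz.2
  have h1 := ovf_count c n
  have h2 : ∑ x ∈ Finset.range n, c x ≤ Big.card := by
    rw [Finset.range_eq_Ico, hsum]; exact Finset.card_filter_le _ _
  refine le_trans (Finset.card_le_card ?_) (le_trans (Nat.le_add_right _ _) (h1.trans h2))
  intro θ hθ
  simp only [Finset.mem_filter] at hθ ⊢
  refine ⟨hθ.1, ?_⟩
  obtain ⟨y, hy, hlt⟩ := hθ.2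
  have h3 := ovf_ge c y (θ - y)
  rw [show y + (θ - y) = θ by omega, hsum] at h3
  omega

lemma right_bad_count (Big : Finset V) (a : V → ℕ) (n : ℕ) :
    ((Finset.range n).filter (fun θ => ∃ x, θ < x ∧
      x - θ < (Big.filter (fun z => θ ≤ a z ∧ a z < x)).card)).card ≤ Big.card := by
  set M := n + Big.card + Big.sup a with hM
  have h1 := left_bad_count Big (fun z => M - a z) (M + 2)
  refine le_trans ?_ h1
  refine Finset.card_le_card_of_injOn (fun θ => M - θ + 1) ?_ ?_
  · intro θ hθ
    simp only [Finset.coe_filter, Finset.mem_range, Set.mem_ofPred_eq] at hθ ⊢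
    obtain ⟨hn, x, hx, hlt⟩ := hθ
    have hle := hlt.trans_le (Finset.card_filter_le _ _)
    refine ⟨by omega, M - x + 1, by omega, ?_⟩
    refine lt_of_lt_of_le (lt_of_le_of_lt ?_ hlt) (Finset.card_le_card ?_)
    · omega
    · intro z hz
      simp only [Finset.mem_filter] at hz ⊢
      have hz2 : a z ≤ Big.sup a := Finset.le_sup hz.1
      refine ⟨hz.1, ?_, ?_⟩ <;> omega
  · intro θ hθ θ' hθ' heq
    simp only [Finset.coe_filter, Finset.mem_range, Set.mem_ofPred_eq] at hθ hθ' heq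
    omega

lemma window (Big : Finset V) (a : V → ℕ) (lo hi : ℕ) (h : lo + 2 * Big.card < hi) :
    ∃ θ, lo ≤ θ ∧ θ < hi ∧
      (∀ y < θ, (Big.filter (fun z => y ≤ a z ∧ a z < θ)).card ≤ θ - y) ∧
      (∀ x, θ < x → (Big.filter (fun z => θ ≤ a z ∧ a z < x)).card ≤ x - θ) := by
  set L := (Finset.range hi).filter (fun θ => ∃ y < θ,
      θ - y < (Big.filter (fun z => y ≤ a z ∧ a z < θ)).card) with hL
  set R := (Finset.range hi).filter (fun θ => ∃ x, θ < x ∧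
      x - θ < (Big.filter (fun z => θ ≤ a z ∧ a z < x)).card) with hR
  have h1 : L.card ≤ Big.card := left_bad_count Big a hi
  have h2 : R.card ≤ Big.card := right_bad_count Big a hi
  have h3 : ∃ θ ∈ Finset.Ico lo hi, θ ∉ L ∪ R := by
    apply Finset.exists_mem_notMem_of_card_lt_card
    have := Finset.card_union_le L R
    rw [Nat.card_Ico]
    omega
  obtain ⟨θ, hθ, hn⟩ := h3
  rw [Finset.mem_Ico] at hθ
  rw [Finset.mem_union, not_or] at hn
  refine ⟨θ, hθ.1, hθ.2, ?_, ?_⟩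
  · intro y hy
    by_contra hc
    exact hn.1 (Finset.mem_filter.2 ⟨Finset.mem_range.2 hθ.2, y, hy, not_le.1 hc⟩)
  · intro x hx
    by_contra hc
    exact hn.2 (Finset.mem_filter.2 ⟨Finset.mem_range.2 hθ.2, x, hx, not_le.1 hc⟩)

inductive Build (G : SimpleGraph V) : Finset V → Prop
  | single (v : V) : Build G {v}
  | ins (l p : V) (K : Finset V) : Build G K → p ∈ K → l ∉ K → G.Adj l p → Build G (insert l K)

set_option maxHeartbeats 1000000 in
lemma tpair (G : SimpleGraph V) (K : Finset V) (hK : Build G K) :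
    ∀ T ⊆ K, ∃ (ψ : V → V) (S : V → Set (Sym2 V)),
      (∀ u ∈ T, ψ u ∈ T) ∧ (∀ u ∈ T, ψ (ψ u) = u) ∧
      (∀ u ∈ T, ∀ u' ∈ T, ψ u = u → ψ u' = u' → u = u') ∧
      (∀ u ∈ T, S (ψ u) = S u) ∧
      (∀ u ∈ T, ∀ e ∈ S u, e ∈ G.edgeSet ∧ ∀ v ∈ e, v ∈ K) ∧
      (∀ u ∈ T, ∀ u' ∈ T, u' ≠ u → u' ≠ ψ u → Disjoint (S u) (S u')) ∧
      (∀ u ∈ T, (fromEdgeSet (S u)).Reachable u (ψ u)) := by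
  induction hK with
  | single v =>
    intro T hT
    refine ⟨id, fun _ => ∅, by simp, by simp, ?_, by simp, by simp, by simp, ?_⟩
    · intro u hu u' hu' _ _
      have := hT hu; have := hT hu'; simp_all
    · intro u _; exact Reachable.refl _
  | ins l p K hB hp hl hlp ih =>
    intro T hT
    have hlp' : l ≠ p := hlp.ne
    by_cases hlT : l ∈ T
    · by_cases hpT : p ∈ T
      · obtain ⟨ψ, S, h1, h2, h3, h4, h5, h6, h7⟩ := ih ((T.erase l).erase p) (by
          intro u hu
          have := hT (Finset.mem_of_mem_erase (Finset.mem_of_mem_erase hu))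
          grind)
        refine ⟨fun u => if u = l then p else if u = p then l else ψ u,
          fun u => if u = l ∨ u = p then {s(l, p)} else S u, ?_, ?_, ?_, ?_, ?_, ?_, ?_⟩
        · intro u hu
          have := h1 u
          grind
        · intro u hu
          have := h1 u
          have := h2 u
          grind
        · intro u hu u' hu'
          have := h1 u
          have := h1 u'
          have := h3 u
          grind
        · intro u hu
          have := h1 u
          have := h4 u
          grind
        · intro u hu e he
          by_cases hc : u = l ∨ u = p
          · simp only [hc, if_true, Set.mem_singleton_iff] at he
            subst he
            refine ⟨(mem_edgeSet _).2 hlp, ?_⟩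
            intro v hv
            rcases Sym2.mem_iff.1 hv with rfl | rfl <;> simp [hp]
          · simp only [hc, if_false] at he
            have := h5 u (by grind) e he
            exact ⟨this.1, fun v hv => Finset.mem_insert_of_mem (this.2 v hv)⟩
        · have key : ∀ u ∈ (T.erase l).erase p, s(l, p) ∉ S u := by
            intro u hu he
            exact hl ((h5 u hu _ he).2 l (by simp))
          intro u hu u' hu' hne hne'
          have k1 := key u
          have k2 := key u'
          have k3 := h6 u
          by_cases hc : u = l ∨ u = p <;> by_cases hc' : u' = l ∨ u' = p
          · exfalso; grind
          · simp only [hc, hc', if_true, if_false, Set.disjoint_singleton_left]; grind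
          · simp only [hc, hc', if_true, if_false, Set.disjoint_singleton_right]; grind
          · simp only [hc, hc', if_false]; grind
        · intro u hu
          by_cases hc : u = l
          · subst hc
            simp only [true_or, if_true]
            exact reach_edge rfl
          · by_cases hc' : u = p
            · subst hc'
              simp only [hc, or_true, if_true, if_false]
              exact (reach_edge (A := {s(l, u)}) rfl).symm
            · simp only [hc, hc', or_false, if_false]
              exact h7 u (by grind)
      · obtain ⟨ψ, S, h1, h2, h3, h4, h5, h6, h7⟩ := ih (insert p (T.erase l)) (by
          intro u hu
          rw [Finset.mem_insert, Finset.mem_erase] at hu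
          rcases hu with rfl | hu
          · exact hp
          · have := hT hu.2; grind)
        set τ := Equiv.swap l p with hτ
        have hττ : ∀ u, τ (τ u) = u := by intro u; simp [hτ]
        have hmem : ∀ u, u ∈ T → τ u ∈ insert p (T.erase l) := by intro u hu; grind
        have hmem' : ∀ u ∈ insert p (T.erase l), τ u ∈ T := by intro u hu; grind
        have key : ∀ u ∈ insert p (T.erase l), s(l, p) ∉ S u := by
          intro u hu he
          exact hl ((h5 u hu _ he).2 l (by simp))
        refine ⟨fun u => τ (ψ (τ u)), fun u => S (τ u) ∪
          (if τ u = p ∨ ψ (τ u) = p then {s(l, p)} else ∅), ?_, ?_, ?_, ?_, ?_, ?_, ?_⟩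
        · intro u hu
          exact hmem' _ (h1 _ (hmem _ hu))
        · intro u hu
          simp only [hττ]
          rw [h2 _ (hmem _ hu), hττ]
        · intro u hu u' hu' he he'
          apply τ.injective
          refine h3 _ (hmem _ hu) _ (hmem _ hu') ?_ ?_
          · apply τ.injective; simp only [he, hττ]
          · apply τ.injective; simp only [he', hττ]
        · intro u hu
          simp only [hττ]
          rw [h2 _ (hmem _ hu), h4 _ (hmem _ hu)]
          simp only [or_comm]
        · intro u hu e he
          rcases he with he | he
          · have := h5 _ (hmem u hu) e he
            exact ⟨this.1, fun v hv => Finset.mem_insert_of_mem (this.2 v hv)⟩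
          · split_ifs at he
            · rw [Set.mem_singleton_iff] at he
              subst he
              refine ⟨(mem_edgeSet _).2 hlp, ?_⟩
              intro v hv
              rcases Sym2.mem_iff.1 hv with rfl | rfl <;> simp [hp]
            · simp at he
        · intro u hu u' hu' hne hne'
          have e1 : τ u' ≠ τ u := fun h => hne (τ.injective h)
          have e2 : τ u' ≠ ψ (τ u) := by
            intro h; apply hne'; simp only [← h, hττ]
          have e3 : ψ (τ u') ≠ τ u := by
            intro h; apply e2; rw [← h, h2 _ (hmem _ hu')]
          have e4 : ψ (τ u') ≠ ψ (τ u) := by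
            intro h; apply e1; rw [← h2 _ (hmem _ hu'), h, h2 _ (hmem _ hu)]
          have d := h6 _ (hmem _ hu) _ (hmem _ hu') e1 e2
          have k1 := key _ (hmem _ hu)
          have k2 := key _ (hmem _ hu')
          rw [Set.disjoint_union_left, Set.disjoint_union_right, Set.disjoint_union_right]
          refine ⟨⟨d, ?_⟩, ?_, ?_⟩
          · split_ifs <;> simp [k1]
          · split_ifs <;> simp [k2]
          · split_ifs with c1 c2
            · exfalso
              rcases c1 with c1 | c1 <;> rcases c2 with c2 | c2
              · exact e1 (c2.trans c1.symm)
              · exact e3 (c2.trans c1.symm)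
              · exact e2 (c2.trans c1.symm)
              · exact e4 (c2.trans c1.symm)
            all_goals simp
        · intro u hu
          have base : (fromEdgeSet (S (τ u) ∪
            (if τ u = p ∨ ψ (τ u) = p then {s(l, p)} else ∅))).Reachable (τ u) (ψ (τ u)) :=
            reach_mono Set.subset_union_left (h7 _ (hmem _ hu))
          have step : ∀ w ∈ insert p (T.erase l), (w = p → τ u = p ∨ ψ (τ u) = p) →
              (fromEdgeSet (S (τ u) ∪
            (if τ u = p ∨ ψ (τ u) = p then {s(l, p)} else ∅))).Reachable (τ w) w := by
            intro w hw hwp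
            by_cases hc : w = p
            · subst hc
              have : τ w = l := by simp [hτ]
              rw [this, if_pos (hwp rfl)]
              exact reach_edge (Or.inr rfl)
            · have : τ w = w := by
                have : w ≠ l := by
                  rintro rfl
                  simp [hc] at hw
                exact Equiv.swap_apply_of_ne_of_ne this hc
              rw [this]
          have s1 := step (τ u) (hmem _ hu) (fun h => Or.inl h)
          have s2 := step (ψ (τ u)) (h1 _ (hmem _ hu)) (fun h => Or.inr h)
          rw [hττ] at s1
          exact (s1.trans base).trans s2.symm
    · obtain ⟨ψ, S, h1, h2, h3, h4, h5, h6, h7⟩ := ih T (by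
        intro u hu; have := hT hu; grind)
      refine ⟨ψ, S, h1, h2, h3, h4, ?_, h6, h7⟩
      intro u hu e he
      exact ⟨(h5 u hu e he).1, fun v hv => Finset.mem_insert_of_mem ((h5 u hu e he).2 v hv)⟩
end P3
end TOI

namespace TOI
set_option linter.unusedVariables false
set_option linter.unusedSectionVars false
open SimpleGraph
section P4
open scoped Classical
variable {V : Type*} [Fintype V]

noncomputable def nb (G : SimpleGraph V) (x : V) : Finset V := Finset.univ.filter (G.Adj x)

lemma mem_nb {G : SimpleGraph V} {x y : V} : y ∈ nb G x ↔ G.Adj x y := by simp [nb]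

/-- sequential choice -/
lemma seqchoice {I α : Type*} [Nonempty α] (Opt : I → α → Prop) (Cf : I → α → I → α → Prop)
    (s : Finset I)
    (hsymm : ∀ i ∈ s, ∀ j ∈ s, ∀ x y, Cf i x j y → Cf j y i x)
    (h : ∀ i ∈ s, ∀ A ⊆ s, i ∉ A → ∀ c : I → α, (∀ j ∈ A, Opt j (c j)) →
      ∃ x, Opt i x ∧ ∀ j ∈ A, ¬ Cf i x j (c j)) :
    ∃ c : I → α, (∀ i ∈ s, Opt i (c i)) ∧ ∀ i ∈ s, ∀ j ∈ s, i ≠ j → ¬ Cf i (c i) j (c j) := by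
  suffices H : ∀ A ⊆ s, ∃ c : I → α, (∀ i ∈ A, Opt i (c i)) ∧
      ∀ i ∈ A, ∀ j ∈ A, i ≠ j → ¬ Cf i (c i) j (c j) from H s subset_rfl
  intro A
  induction A using Finset.induction_on with
  | empty => intro _; exact ⟨fun _ => Classical.arbitrary α, by simp, by simp⟩
  | insert i A hi ih =>
    intro hA
    have hAs : A ⊆ s := fun j hj => hA (Finset.mem_insert_of_mem hj)
    have his : i ∈ s := hA (Finset.mem_insert_self _ _)
    obtain ⟨c, hc1, hc2⟩ := ih hAs
    obtain ⟨x, hx1, hx2⟩ := h i his A hAs hi c hc1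
    have hne : ∀ j ∈ A, j ≠ i := fun j hj h => hi (h ▸ hj)
    refine ⟨Function.update c i x, ?_, ?_⟩
    · intro j hj
      rcases Finset.mem_insert.1 hj with rfl | hj
      · simpa using hx1
      · simpa [hne j hj] using hc1 j hj
    · intro j hj k hk hjk
      rcases Finset.mem_insert.1 hj with hji | hjA
      · subst hji
        rcases Finset.mem_insert.1 hk with hkj | hkA
        · exact absurd hkj.symm hjk
        · simpa [hne k hkA] using hx2 k hkA
      · rcases Finset.mem_insert.1 hk with hki | hkA
        · subst hki
          intro hcf
          have := hsymm _ (hAs hjA) _ his _ _ hcf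
          rw [Function.update_self, Function.update_of_ne (hne j hjA)] at this
          exact hx2 j hjA this
        · simpa [hne j hjA, hne k hkA] using hc2 j hjA k hkA hjk

lemma eliminate (G : SimpleGraph V) (K : Finset V) (H : Set (V × V))
    (hH : ∀ x u, (x, u) ∈ H ↔ x ∉ K ∧ u ∈ K ∧ G.Adj x u)
    (ψ : V × V → V × V) (Q : V × V → Set (Sym2 V))
    (h1 : ∀ h ∈ H, ψ h ∈ H) (h2 : ∀ h ∈ H, ψ (ψ h) = h)
    (h3 : ∀ h ∈ H, ∀ h' ∈ H, ψ h = h → ψ h' = h' → h = h')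
    (h4 : ∀ h ∈ H, ψ h ≠ h → h.1 ≠ (ψ h).1 ∧ ¬ G.Adj h.1 (ψ h).1)
    (h5 : ∀ x u u', (x, u) ∈ H → (x, u') ∈ H → ψ (x, u) ≠ (x, u) → ψ (x, u') ≠ (x, u') →
      (ψ (x, u)).1 = (ψ (x, u')).1 → u = u')
    (q1 : ∀ h ∈ H, ∀ e ∈ Q h, e ∈ G.edgeSet ∧ ∀ v ∈ e, v ∈ K)
    (q2 : ∀ h ∈ H, Q (ψ h) = Q h)
    (q3 : ∀ h ∈ H, ∀ h' ∈ H, h' ≠ h → h' ≠ ψ h → Disjoint (Q h) (Q h'))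
    (q4 : ∀ h ∈ H, (fromEdgeSet (Q h)).Reachable h.2 (ψ h).2) :
    ∃ G' : SimpleGraph V, Imm G' G ∧
      (∀ a b, G'.Adj a b → a ∉ K ∧ ∃ y, G.Adj a y) ∧
      (∀ x, x ∉ K → (nb G x).card ≤ (nb G' x).card + 1) ∧
      (∀ x, x ∉ K → (∀ u, (x, u) ∈ H → ψ (x, u) ≠ (x, u)) →
        (nb G x).card ≤ (nb G' x).card) := by
  have hH1 : ∀ h ∈ H, h.1 ∉ K ∧ h.2 ∈ K ∧ G.Adj h.1 h.2 := fun h hh => (hH h.1 h.2).1 hh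
  have hψne : ∀ h ∈ H, ψ h ≠ h → ψ (ψ h) ≠ ψ h := by
    intro h hh hne heq; rw [h2 h hh] at heq; exact hne heq.symm
  let G' : SimpleGraph V :=
    { Adj := fun a b => a ∉ K ∧ b ∉ K ∧ (G.Adj a b ∨ ∃ h ∈ H, ψ h ≠ h ∧ h.1 = a ∧ (ψ h).1 = b)
      symm := ⟨by
        rintro a b ⟨ha, hb, hab⟩
        refine ⟨hb, ha, ?_⟩
        rcases hab with hab | ⟨h, hh, hne, rfl, rfl⟩
        · exact Or.inl hab.symm
        · exact Or.inr ⟨ψ h, h1 h hh, hψne h hh hne, rfl, by rw [h2 h hh]⟩⟩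
      loopless := ⟨by
        rintro a ⟨ha, hb, hab⟩
        rcases hab with hab | ⟨h, hh, hne, rfl, heq⟩
        · exact hab.ne rfl
        · exact (h4 h hh hne).1 heq.symm⟩ }
  have hG' : ∀ a b, G'.Adj a b ↔ a ∉ K ∧ b ∉ K ∧
      (G.Adj a b ∨ ∃ h ∈ H, ψ h ≠ h ∧ h.1 = a ∧ (ψ h).1 = b) := fun a b => Iff.rfl
  have hedge : ∀ h ∈ H, ∀ h' ∈ H, s(h.1, h.2) = s(h'.1, h'.2) → h = h' := by
    intro h hh h' hh' heq
    rw [Sym2.eq_iff] at heq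
    rcases heq with ⟨e1, e2⟩ | ⟨e1, e2⟩
    · exact Prod.ext e1 e2
    · exact absurd ((hH1 h' hh').2.1) (e1 ▸ (hH1 h hh).1)
  let S : V × V → Set (Sym2 V) := fun h => {s(h.1, h.2), s((ψ h).1, (ψ h).2)} ∪ Q h
  have hSG : ∀ h ∈ H, ∀ e ∈ S h, e ∈ G.edgeSet ∧ ∃ v ∈ e, v ∈ K := by
    rintro h hh e ((rfl | rfl) | he)
    · exact ⟨(hH1 h hh).2.2, h.2, by simp, (hH1 h hh).2.1⟩
    · have := hH1 _ (h1 h hh)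
      exact ⟨this.2.2, (ψ h).2, by simp, this.2.1⟩
    · have := q1 h hh e he
      refine ⟨this.1, ?_⟩
      induction e using Sym2.ind with
      | _ a b => exact ⟨a, by simp, this.2 a (by simp)⟩
  have hEQ : ∀ h ∈ H, ∀ h' ∈ H, s(h.1, h.2) ∉ Q h' := by
    intro h hh h' hh' hm
    exact (hH1 h hh).1 ((q1 h' hh' _ hm).2 h.1 (by simp))
  have hSdisj : ∀ h ∈ H, ∀ h' ∈ H, ∀ e, e ∈ S h → e ∈ S h' → h' = h ∨ h' = ψ h := by
    rintro h hh h' hh' e ((rfl | rfl) | he) ((he' | he') | he')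
    · exact Or.inl (hedge _ hh' _ hh he'.symm)
    · right
      have := hedge _ hh _ (h1 _ hh') he'
      rw [this, h2 _ hh']
    · exact absurd he' (hEQ _ hh _ hh')
    · right; exact (hedge _ (h1 _ hh) _ hh' he').symm
    · left
      have := hedge _ (h1 _ hh) _ (h1 _ hh') he'
      rw [← h2 _ hh', ← this, h2 _ hh]
    · exact absurd he' (hEQ _ (h1 _ hh) _ hh')
    · exact absurd (he' ▸ he) (hEQ _ hh' _ hh)
    · exact absurd (he' ▸ he) (hEQ _ (h1 _ hh') _ hh)
    · by_contra hc
      push Not at hc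
      exact Set.disjoint_left.1 (q3 h hh h' hh' hc.1 hc.2) he he'
  refine ⟨G', ?_, ?_, ?_⟩
  · refine ⟨fun e => {f | (e ∈ G.edgeSet ∧ f = e) ∨ (e ∉ G.edgeSet ∧
      ∃ h ∈ H, ψ h ≠ h ∧ s(h.1, (ψ h).1) = e ∧ f ∈ S h)}, ?_, ?_, ?_⟩
    · rintro e he f (⟨h1, rfl⟩ | ⟨-, h, hh, -, -, hf⟩)
      · exact h1
      · exact (hSG h hh f hf).1
    · have hout : ∀ e ∈ G'.edgeSet, ∀ v ∈ e, v ∉ K := by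
        rintro e he v ⟨w, rfl⟩
        exact ((hG' _ _).1 ((mem_edgeSet _).1 he)).1
      intro e he e' he' hne
      rw [Set.disjoint_left]
      rintro f (⟨g1, rfl⟩ | ⟨g1, h, hh, hne1, rfl, hf⟩) (⟨g2, hfe⟩ | ⟨g2, h', hh', hne2, rfl, hf'⟩)
      · exact hne hfe
      · obtain ⟨v, hv, hvK⟩ := (hSG h' hh' _ hf').2
        exact hout _ he v hv hvK
      · subst hfe
        obtain ⟨v, hv, hvK⟩ := (hSG h hh _ hf).2
        exact hout _ he' v hv hvK
      · rcases hSdisj h hh h' hh' f hf hf' with rfl | rfl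
        · exact hne rfl
        · apply hne; rw [h2 _ hh]; exact Sym2.eq_swap
    · intro a b hab
      by_cases hadj : G.Adj a b
      · exact reach_edge (Or.inl ⟨(mem_edgeSet _).2 hadj, rfl⟩)
      · obtain ⟨ha, hb, h' | ⟨h, hh, hne, rfl, rfl⟩⟩ := (hG' _ _).1 hab
        · exact absurd h' hadj
        · have hr : (fromEdgeSet (S h)).Reachable h.1 (ψ h).1 := by
            refine ((reach_edge (A := S h) (Or.inl (Or.inl rfl))).trans
              (reach_mono (A := Q h) ?_ (q4 h hh))).trans
              (reach_edge (A := S h) (a := (ψ h).1) (b := (ψ h).2) (Or.inl (Or.inr rfl))).symm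
            exact Set.subset_union_right
          refine reach_mono ?_ hr
          intro f hf
          exact Or.inr ⟨hadj, h, hh, hne, rfl, hf⟩
  · intro a b hab
    obtain ⟨ha, hb, h' | ⟨h, hh, hne, rfl, rfl⟩⟩ := (hG' _ _).1 hab
    · exact ⟨ha, b, h'⟩
    · exact ⟨ha, h.2, (hH1 h hh).2.2⟩
  · have key : ∀ x, x ∉ K → ∀ A ⊆ nb G x, (∀ u ∈ A, (x, u) ∈ H → ψ (x, u) ≠ (x, u)) →
        A.card ≤ (nb G' x).card := by
      intro x hx A hA hfix
      refine Finset.card_le_card_of_injOn (fun y => if y ∈ K then (ψ (x, y)).1 else y) ?_ ?_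
      · intro y hy
        have hadj := mem_nb.1 (hA hy)
        simp only [Finset.mem_coe, mem_nb, hG']
        by_cases hyK : y ∈ K
        · have hh : (x, y) ∈ H := (hH _ _).2 ⟨hx, hyK, hadj⟩
          simp only [hyK, if_true]
          exact ⟨hx, (hH1 _ (h1 _ hh)).1, Or.inr ⟨_, hh, hfix y hy hh, rfl, rfl⟩⟩
        · rw [if_neg hyK]
          exact ⟨hx, hyK, Or.inl hadj⟩
      · intro y hy y' hy' heq
        have hadj := mem_nb.1 (hA hy)
        have hadj' := mem_nb.1 (hA hy')
        by_cases hyK : y ∈ K <;> by_cases hyK' : y' ∈ K <;>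
          simp only [hyK, hyK', if_true, if_false] at heq
        · have hh : (x, y) ∈ H := (hH _ _).2 ⟨hx, hyK, hadj⟩
          have hh' : (x, y') ∈ H := (hH _ _).2 ⟨hx, hyK', hadj'⟩
          exact h5 x y y' hh hh' (hfix y hy hh) (hfix y' hy' hh') heq
        · have hh : (x, y) ∈ H := (hH _ _).2 ⟨hx, hyK, hadj⟩
          exact absurd (heq ▸ hadj') (h4 _ hh (hfix y hy hh)).2
        · have hh : (x, y') ∈ H := (hH _ _).2 ⟨hx, hyK', hadj'⟩
          exact absurd (heq ▸ hadj) (h4 _ hh (hfix y' hy' hh)).2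
        · exact heq
    refine ⟨?_, fun x hx hf => key x hx _ subset_rfl (fun u _ => hf u)⟩
    intro x hx
    by_cases hex : ∃ u, (x, u) ∈ H ∧ ψ (x, u) = (x, u)
    · obtain ⟨u, hu, hfu⟩ := hex
      have := key x hx ((nb G x).erase u) (Finset.erase_subset _ _) (by
        intro u' hu' hh' hfix
        have := h3 _ hu _ hh' hfu hfix
        exact (Finset.ne_of_mem_erase hu') (Prod.ext_iff.1 this).2.symm)
      have h6 := Finset.pred_card_le_card_erase (s := nb G x) (a := u)
      omega
    · push Not at hex
      have := key x hx _ subset_rfl (fun u _ => hex u)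
      omega
end P4
end TOI

namespace TOI
set_option linter.unusedVariables false
set_option linter.unusedSectionVars false
open SimpleGraph
section P5
open scoped Classical
variable {V : Type*} [Fintype V]

lemma choose_p [Nonempty V] (G : SimpleGraph V) (Big Om K : Finset V) (θ : ℕ) (hKB : K ⊆ Big)
    (a : V → ℕ) (ha : ∀ z, a z = (nb G z ∩ Om).card)
    (w1 : ∀ y < θ, (Big.filter (fun z => y ≤ a z ∧ a z < θ)).card ≤ θ - y)
    (w2 : ∀ x, θ < x → (Big.filter (fun z => θ ≤ a z ∧ a z < x)).card ≤ x - θ)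
    (hKθ : ∀ u ∈ K, θ ≤ a u)
    (hBθ : ∀ z ∈ Big, z ∉ K → ∀ u ∈ K, G.Adj u z → a z < θ) :
    ∃ p : V → V → V,
      (∀ z ∈ Big, z ∉ K → ∀ u ∈ K, G.Adj u z →
        p z u ∈ Om ∧ G.Adj u (p z u) ∧ ¬ G.Adj z (p z u)) ∧
      (∀ z ∈ Big, z ∉ K → ∀ z' ∈ Big, z' ∉ K → ∀ u ∈ K, G.Adj u z → G.Adj u z' →
        p z u = p z' u → z = z') ∧
      (∀ z ∈ Big, z ∉ K → ∀ u ∈ K, ∀ u' ∈ K, G.Adj u z → G.Adj u' z →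
        p z u = p z u' → u = u') := by
  set I : Finset (V × V) := Finset.univ.filter
    (fun i => i.1 ∈ Big ∧ i.1 ∉ K ∧ i.2 ∈ K ∧ G.Adj i.2 i.1) with hI
  have hIm : ∀ z u, (z, u) ∈ I ↔ z ∈ Big ∧ z ∉ K ∧ u ∈ K ∧ G.Adj u z := by
    intro z u; simp [hI]
  obtain ⟨c, hc1, hc2⟩ := greedy (I := V × V) (α := V) (fun i => a i.2 - a i.1)
    (fun i j => i.1 = j.1 ∨ i.2 = j.2) (fun i j h => h.imp Eq.symm Eq.symm)
    (fun i => (nb G i.2 ∩ Om) \ nb G i.1) I (by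
      rintro ⟨z, u⟩ hzu
      obtain ⟨hz, hzK, hu, hadj⟩ := (hIm z u).1 hzu
      have haz := hBθ z hz hzK u hu hadj
      have hau := hKθ u hu
      refine ⟨((Big.filter (fun z' => a z ≤ a z' ∧ a z' < θ)).erase z).image (fun z' => (z', u)) ∪
        ((Big.filter (fun u' => θ ≤ a u' ∧ a u' < a u + 1)).erase u).image (fun u' => (z, u')),
        ?_, ?_⟩
      · rintro ⟨z', u'⟩ hj hne hconf hrank
        obtain ⟨hz', hzK', hu', hadj'⟩ := (hIm z' u').1 hj
        have haz' := hBθ z' hz' hzK' u' hu' hadj'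
        have hau' := hKθ u' hu'
        simp only at hconf hrank
        rw [Finset.mem_union, Finset.mem_image, Finset.mem_image]
        rcases hconf with rfl | rfl
        · right
          refine ⟨u', ?_, rfl⟩
          rw [Finset.mem_erase, Finset.mem_filter]
          refine ⟨fun h => hne (by rw [h]), hKB hu', hau', by omega⟩
        · left
          refine ⟨z', ?_, rfl⟩
          rw [Finset.mem_erase, Finset.mem_filter]
          refine ⟨fun h => hne (by rw [h]), hz', by omega, haz'⟩
      · refine lt_of_le_of_lt (Finset.card_union_le _ _) ?_
        refine lt_of_le_of_lt (Nat.add_le_add Finset.card_image_le Finset.card_image_le) ?_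
        rw [Finset.card_erase_of_mem (by simp [hz, haz]),
          Finset.card_erase_of_mem (by simp [hKB hu, hau])]
        have e1 := w1 (a z) haz
        have e2 := w2 (a u + 1) (by omega)
        have e3 : (nb G u ∩ Om).card ≤ ((nb G u ∩ Om) \ nb G z).card + (nb G z ∩ Om).card := by
          rw [← Finset.card_sdiff_add_card_inter (nb G u ∩ Om) (nb G z)]
          refine Nat.add_le_add_left (Finset.card_le_card ?_) _
          intro x hx
          simp only [Finset.mem_inter] at hx ⊢
          exact ⟨hx.2, hx.1.2⟩
        rw [← ha, ← ha] at e3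
        have e4 : 0 < (Big.filter (fun z' => a z ≤ a z' ∧ a z' < θ)).card :=
          Finset.card_pos.2 ⟨z, by simp [hz, haz]⟩
        have e5 : 0 < (Big.filter (fun u' => θ ≤ a u' ∧ a u' < a u + 1)).card :=
          Finset.card_pos.2 ⟨u, by simp [hKB hu, hau]⟩
        simp only
        omega)
  refine ⟨fun z u => c (z, u), ?_, ?_, ?_⟩
  · intro z hz hzK u hu hadj
    have := hc1 (z, u) ((hIm z u).2 ⟨hz, hzK, hu, hadj⟩)
    simp only [Finset.mem_sdiff, Finset.mem_inter, mem_nb] at this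
    exact ⟨this.1.2, this.1.1, this.2⟩
  · intro z hz hzK z' hz' hzK' u hu hadj hadj' heq
    by_contra hne
    exact hc2 (z, u) ((hIm z u).2 ⟨hz, hzK, hu, hadj⟩) (z', u) ((hIm z' u).2 ⟨hz', hzK', hu, hadj'⟩)
      (fun h => hne (Prod.ext_iff.1 h).1) (Or.inr rfl) heq
  · intro z hz hzK u hu u' hu' hadj hadj' heq
    by_contra hne
    exact hc2 (z, u) ((hIm z u).2 ⟨hz, hzK, hu, hadj⟩) (z, u') ((hIm z u').2 ⟨hz, hzK, hu', hadj'⟩)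
      (fun h => hne (Prod.ext_iff.1 h).2) (Or.inl rfl) heq

lemma choose_r [Nonempty V] (G : SimpleGraph V) (s : ℕ) (T : Finset V) (hT : T.card ≤ s)
    (ψ : V → V) (hψ : ∀ u ∈ T, ψ u ∈ T) (hψ2 : ∀ u ∈ T, ψ (ψ u) = u)
    (A : V → Finset V) (hA : ∀ u ∈ T, ∀ u' ∈ T, ∀ x ∈ A u', 2 * s + 1 ≤ (A u \ nb G x).card)
    (hA0 : ∀ u ∈ T, 2 * s + 1 ≤ (A u).card) :
    ∃ r : V → V, (∀ u ∈ T, r u ∈ A u) ∧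
      (∀ u ∈ T, ∀ u' ∈ T, r u = r u' → u = u') ∧
      (∀ u ∈ T, ¬ G.Adj (r u) (r (ψ u))) := by
  obtain ⟨r, hr1, hr2⟩ := seqchoice (I := V) (α := V) (fun u x => x ∈ A u)
    (fun u x u' x' => x = x' ∨ (u' = ψ u ∧ G.Adj x x')) T (by
      rintro u hu u' hu' x y (rfl | ⟨rfl, h⟩)
      · exact Or.inl rfl
      · exact Or.inr ⟨(hψ2 u hu).symm, h.symm⟩) (by
      intro u hu B hB huB c hc
      have hBc : (B.image c).card ≤ s :=
        Finset.card_image_le.trans ((Finset.card_le_card hB).trans hT)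
      by_cases hψB : ψ u ∈ B
      · obtain ⟨x, hx, hx'⟩ := Finset.exists_mem_notMem_of_card_lt_card
          (s := B.image c) (t := A u \ nb G (c (ψ u))) (by
            have := hA u hu (ψ u) (hψ u hu) (c (ψ u)) (hc _ hψB)
            omega)
        rw [Finset.mem_sdiff, mem_nb] at hx
        refine ⟨x, hx.1, ?_⟩
        rintro j hj (h | ⟨rfl, h⟩)
        · exact hx' (Finset.mem_image.2 ⟨j, hj, h.symm⟩)
        · exact hx.2 h.symm
      · obtain ⟨x, hx, hx'⟩ := Finset.exists_mem_notMem_of_card_lt_card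
          (s := B.image c) (t := A u) (by
            have := hA0 u hu
            omega)
        refine ⟨x, hx, ?_⟩
        rintro j hj (h | ⟨rfl, h⟩)
        · exact hx' (Finset.mem_image.2 ⟨j, hj, h.symm⟩)
        · exact hψB hj)
  refine ⟨r, hr1, ?_, ?_⟩
  · intro u hu u' hu' heq
    by_contra hne
    exact hr2 u hu u' hu' hne (Or.inl heq)
  · intro u hu hadj
    by_cases h : u = ψ u
    · rw [← h] at hadj; exact hadj.ne rfl
    · exact hr2 u hu (ψ u) (hψ u hu) h (Or.inr ⟨rfl, hadj⟩)

lemma choose_m (G : SimpleGraph V) (s : ℕ) (hs : 1 ≤ s) (hK : ¬ HasK s G) (K : Finset V)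
    (hKs : K.card ≤ s) (Wu : V → Finset V) (hev : ∀ u ∈ K, Even (Wu u).card)
    (Rr : V → V → Prop) (hRs : ∀ x y, Rr x y → Rr y x)
    (hR : ∀ x y y', Rr x y → Rr x y' → y = y')
    (hdeg : ∀ u ∈ K, ∀ x ∈ Wu u, 12 * s + 2 ≤ (Wu u \ nb G x).card) :
    ∃ m : V → V → V,
      (∀ u ∈ K, ∀ x ∈ Wu u, m u x ∈ Wu u ∧ m u (m u x) = x ∧ m u x ≠ x ∧ ¬ G.Adj x (m u x) ∧
        ¬ Rr x (m u x)) ∧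
      (∀ u ∈ K, ∀ u' ∈ K, u ≠ u' → ∀ x ∈ Wu u, x ∈ Wu u' → m u x ≠ m u' x) := by
  have : Nonempty (V → V) := ⟨id⟩
  obtain ⟨m, hm1, hm2⟩ := seqchoice (I := V) (α := V → V)
    (fun u f => ∀ x ∈ Wu u, f x ∈ Wu u ∧ f (f x) = x ∧ f x ≠ x ∧ ¬ G.Adj x (f x) ∧
        ¬ Rr x (f x))
    (fun u f u' f' => ∃ x, x ∈ Wu u ∧ x ∈ Wu u' ∧ f x = f' x) K (by
      rintro u hu u' hu' f f' ⟨x, h1, h2, h3⟩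
      exact ⟨x, h2, h1, h3.symm⟩) (by
      intro u hu A hA huA c hc
      obtain ⟨Used, hUsed⟩ : ∃ U : V → V → Prop, ∀ x y, U x y ↔
        (Rr x y ∨ ∃ j ∈ A, x ∈ Wu j ∧ c j x = y) := ⟨_, fun _ _ => Iff.rfl⟩
      obtain ⟨C, hC⟩ : ∃ C : V → V → Prop, ∀ x y, C x y ↔
        (x ≠ y ∧ ¬ G.Adj x y ∧ ¬ Used x y) := ⟨_, fun _ _ => Iff.rfl⟩
      have hUs : ∀ x y, Used x y → Used y x := by
        intro x y hxy
        rw [hUsed] at hxy ⊢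
        rcases hxy with (h | ⟨j, hj, hx, rfl⟩)
        · exact Or.inl (hRs _ _ h)
        · exact Or.inr ⟨j, hj, (hc j hj x hx).1, (hc j hj x hx).2.1⟩
      have hUd : ∀ x, ((Wu u).filter (Used x)).card ≤ s + 1 := by
        intro x
        have hsub : (Wu u).filter (Used x) ⊆ (Finset.univ.filter (Rr x)) ∪
            A.image (fun j => c j x) := by
          intro y hy
          rw [Finset.mem_filter] at hy
          rw [Finset.mem_union, Finset.mem_filter, Finset.mem_image]
          rcases (hUsed _ _).1 hy.2 with h | ⟨j, hj, hx, h⟩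
          · exact Or.inl ⟨Finset.mem_univ _, h⟩
          · exact Or.inr ⟨j, hj, h⟩
        have h1 : (Finset.univ.filter (Rr x)).card ≤ 1 := by
          rw [Finset.card_le_one]
          intro y hy y' hy'
          rw [Finset.mem_filter] at hy hy'
          exact hR x y y' hy.2 hy'.2
        have h2 : (A.image (fun j => c j x)).card ≤ s :=
          Finset.card_image_le.trans ((Finset.card_le_card hA).trans hKs)
        have h3 := (Finset.card_le_card hsub).trans (Finset.card_union_le _ _)
        omega
      obtain ⟨f, hf⟩ := matching G s hs (Wu u) (hev u hu)
        C Used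
        (by
          intro x y h
          rw [hC] at h ⊢
          exact ⟨h.1.symm, fun h' => h.2.1 h'.symm, fun h' => h.2.2 (hUs _ _ h')⟩)
        (fun x h => ((hC _ _).1 h).1 rfl) (by
          intro x hx y hy hne hn
          by_contra hcon
          rw [not_or] at hcon
          exact hn ((hC _ _).2 ⟨hne, hcon.1, hcon.2⟩)) (fun x hx => hUd x) (by
          intro x hx
          have h1 := hdeg u hu x hx
          have h2 := hUd x
          have hsub : Wu u \ nb G x ⊆
              (Wu u).filter (C x) ∪
              ({x} ∪ (Wu u).filter (Used x)) := by
            intro y hy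
            rw [Finset.mem_sdiff, mem_nb] at hy
            simp only [Finset.mem_union, Finset.mem_filter, Finset.mem_singleton, hC]
            by_cases hyx : y = x
            · exact Or.inr (Or.inl hyx)
            · have : x ≠ y := fun h => hyx h.symm
              tauto
          have h3 := (Finset.card_le_card hsub).trans (Finset.card_union_le _ _)
          have h4 := Finset.card_union_le {x} ((Wu u).filter (Used x))
          rw [Finset.card_singleton] at h4
          omega) hK
      refine ⟨f, ?_, ?_⟩
      · intro x hx
        obtain ⟨g1, g2, g3, g4⟩ := hf x hx
        rw [hC] at g4
        exact ⟨g1, g2, g3, g4.2.1, fun h => g4.2.2 ((hUsed _ _).2 (Or.inl h))⟩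
      · rintro j hj ⟨x, hx, hxj, heq⟩
        exact ((hC _ _).1 (hf x hx).2.2.2).2.2 ((hUsed _ _).2 (Or.inr ⟨j, hj, hxj, heq.symm⟩)))
  refine ⟨m, hm1, ?_⟩
  intro u hu u' hu' hne x hx hx' heq
  exact hm2 u hu u' hu' hne ⟨x, hx, hx', heq⟩
end P5
end TOI

namespace TOI
set_option linter.unusedVariables false
set_option linter.unusedSectionVars false
open SimpleGraph
section P6
open scoped Classical
variable {V : Type*} [Fintype V]

noncomputable def Pset (G : SimpleGraph V) (Big K : Finset V) (p : V → V → V) (u : V) : Finset V :=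
  ((nb G u ∩ Big) \ K).image (fun z => p z u)

lemma step_M (G : SimpleGraph V) (s : ℕ) (hs : 1 ≤ s) (hK : ¬ HasK s G)
    (Big Om K T : Finset V) (θ : ℕ) (hKB : K ⊆ Big) (hOB : Disjoint Om Big) (hBs : Big.card ≤ s)
    (hKθ : ∀ u ∈ K, θ ≤ (nb G u ∩ Om).card)
    (hxθ : ∀ x, x ∉ Big → (nb G x ∩ Om).card + 16 * s ≤ θ)
    (p : V → V → V)
    (p1 : ∀ z ∈ Big, z ∉ K → ∀ u ∈ K, G.Adj u z →
        p z u ∈ Om ∧ G.Adj u (p z u) ∧ ¬ G.Adj z (p z u))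
    (p2 : ∀ z ∈ Big, z ∉ K → ∀ z' ∈ Big, z' ∉ K → ∀ u ∈ K, G.Adj u z → G.Adj u z' →
        p z u = p z' u → z = z')
    (p3 : ∀ z ∈ Big, z ∉ K → ∀ u ∈ K, ∀ u' ∈ K, G.Adj u z → G.Adj u' z →
        p z u = p z u' → u = u')
    (hTK : T ⊆ K) (hT : ∀ u ∈ K, (u ∈ T ↔ Odd (nb G u \ K).card))
    (r : V → V) (hr : ∀ u ∈ T, r u ∈ (nb G u ∩ Om) \ Pset G Big K p u)
    (Rr : V → V → Prop) (hRs : ∀ x y, Rr x y → Rr y x)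
    (hR : ∀ x y y', Rr x y → Rr x y' → y = y') (hRO : ∀ x y, Rr x y → x ∈ Om) :
    ∃ M : V → V → V,
      (∀ u ∈ K, ∀ x, G.Adj u x → x ∉ K → ¬ (u ∈ T ∧ x = r u) →
        (G.Adj u (M u x) ∧ M u x ∉ K ∧ ¬ (u ∈ T ∧ M u x = r u)) ∧ M u (M u x) = x ∧ M u x ≠ x ∧
          ¬ G.Adj x (M u x) ∧ ¬ Rr x (M u x)) ∧
      (∀ u ∈ K, ∀ u' ∈ K, ∀ x, G.Adj u x → G.Adj u' x → x ∉ K → ¬ (u ∈ T ∧ x = r u) →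
        ¬ (u' ∈ T ∧ x = r u') → M u x = M u' x → u = u') := by
  have hOB' : ∀ x ∈ Om, x ∉ Big := fun x hx hx' => Finset.disjoint_left.1 hOB hx hx'
  have hOK : ∀ x ∈ Om, x ∉ K := fun x hx hx' => hOB' x hx (hKB hx')
  set P := Pset G Big K p with hP
  have hPm : ∀ u x, x ∈ P u ↔ ∃ z, (z ∈ Big ∧ z ∉ K ∧ G.Adj u z) ∧ p z u = x := by
    intro u x
    simp only [hP, Pset, Finset.mem_image, Finset.mem_sdiff, Finset.mem_inter, mem_nb]
    constructor
    · rintro ⟨z, ⟨⟨h1, h2⟩, h3⟩, h4⟩; exact ⟨z, ⟨h2, h3, h1⟩, h4⟩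
    · rintro ⟨z, ⟨h1, h2, h3⟩, h4⟩; exact ⟨z, ⟨⟨h3, h1⟩, h2⟩, h4⟩
  set R : V → Finset V := fun u => if u ∈ T then {r u} else ∅ with hRd
  have hRm : ∀ u x, x ∈ R u ↔ u ∈ T ∧ x = r u := by
    intro u x
    by_cases h : u ∈ T <;> simp [hRd, h]
  set Wu : V → Finset V := fun u => (((nb G u \ K) \ ((nb G u ∩ Big) \ K)) \ P u) \ R u with hWu
  have hWm : ∀ u x, x ∈ Wu u ↔ G.Adj u x ∧ x ∉ Big ∧ x ∉ P u ∧ x ∉ R u := by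
    intro u x
    have := @hKB x
    simp only [hWu, Finset.mem_sdiff, Finset.mem_inter, mem_nb]
    tauto
  have hPsub : ∀ u ∈ K, P u ⊆ (nb G u \ K) \ ((nb G u ∩ Big) \ K) := by
    intro u hu x hx
    obtain ⟨z, ⟨h1, h2, h3⟩, rfl⟩ := (hPm u x).1 hx
    obtain ⟨g1, g2, g3⟩ := p1 z h1 h2 u hu h3
    have := hOB' _ g1
    have := hOK _ g1
    simp only [Finset.mem_sdiff, Finset.mem_inter, mem_nb]
    tauto
  have hRsub : ∀ u ∈ K, R u ⊆ ((nb G u \ K) \ ((nb G u ∩ Big) \ K)) \ P u := by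
    intro u hu x hx
    obtain ⟨h1, rfl⟩ := (hRm u x).1 hx
    have := hr u h1
    simp only [Finset.mem_sdiff, Finset.mem_inter, mem_nb] at this
    have := hOB' _ this.1.2
    have := hOK (r u) (by tauto)
    simp only [Finset.mem_sdiff, Finset.mem_inter, mem_nb]
    tauto
  have hPc : ∀ u ∈ K, (P u).card = ((nb G u ∩ Big) \ K).card := by
    intro u hu
    refine Finset.card_image_of_injOn ?_
    intro z hz z' hz' heq
    simp only [Finset.mem_coe, Finset.mem_sdiff, Finset.mem_inter, mem_nb] at hz hz'
    exact p2 z hz.1.2 hz.2 z' hz'.1.2 hz'.2 u hu hz.1.1 hz'.1.1 heq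
  have hev : ∀ u ∈ K, Even (Wu u).card := by
    intro u hu
    have c1 : ((nb G u \ K) \ ((nb G u ∩ Big) \ K)).card + ((nb G u ∩ Big) \ K).card =
        (nb G u \ K).card := Finset.card_sdiff_add_card_eq_card (by
          intro x hx; simp only [Finset.mem_sdiff, Finset.mem_inter] at hx ⊢; tauto)
    have c2 := Finset.card_sdiff_add_card_eq_card (hPsub u hu)
    have c3 := Finset.card_sdiff_add_card_eq_card (hRsub u hu)
    have c4 := hPc u hu
    have c5 := hT u hu
    by_cases hu' : u ∈ T
    · have c6 : (R u).card = 1 := by simp [hRd, hu']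
      obtain ⟨k, hk⟩ := c5.1 hu'
      rw [Nat.even_iff]
      simp only [hWu]
      omega
    · have c6 : (R u).card = 0 := by simp [hRd, hu']
      obtain ⟨k, hk⟩ := Nat.not_odd_iff_even.1 (fun h => hu' (c5.2 h))
      rw [Nat.even_iff]
      simp only [hWu]
      omega
  obtain ⟨m, hm1, hm2⟩ := choose_m G s hs hK K ((Finset.card_le_card hKB).trans hBs) Wu hev Rr hRs hR
    (by
      intro u hu x hx
      have h1 := hxθ x ((hWm u x).1 hx).2.1
      have h2 := hKθ u hu
      have hsub : nb G u ∩ Om ⊆ (Wu u \ nb G x) ∪ ((nb G x ∩ Om) ∪ (P u ∪ R u)) := by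
        intro y hy
        rw [Finset.mem_inter, mem_nb] at hy
        have := hOB' y hy.2
        simp only [Finset.mem_union, Finset.mem_sdiff, Finset.mem_inter, hWm, mem_nb]
        tauto
      have h3 := (Finset.card_le_card hsub).trans (Finset.card_union_le _ _)
      have h4 := Finset.card_union_le (nb G x ∩ Om) (P u ∪ R u)
      have h5 := Finset.card_union_le (P u) (R u)
      have h6 : (P u).card ≤ s := by
        rw [hPc u hu]
        refine le_trans (Finset.card_le_card ?_) hBs
        intro z hz; simp only [Finset.mem_sdiff, Finset.mem_inter] at hz; exact hz.1.2
      have h7 : (R u).card ≤ 1 := by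
        by_cases h : u ∈ T <;> simp [hRd, h]
      omega)
  set M : V → V → V := fun u x => if x ∈ Big then p x u else
    if h : ∃ z, (z ∈ Big ∧ z ∉ K ∧ G.Adj u z) ∧ p z u = x then h.choose else m u x with hM
  have E1 : ∀ u z, z ∈ Big → M u z = p z u := by
    intro u z hz; simp [hM, hz]
  have E2 : ∀ u ∈ K, ∀ z ∈ Big, z ∉ K → G.Adj u z → M u (p z u) = z := by
    intro u hu z hz hzK hadj
    have hnb := hOB' _ (p1 z hz hzK u hu hadj).1
    have hex : ∃ z', (z' ∈ Big ∧ z' ∉ K ∧ G.Adj u z') ∧ p z' u = p z u := ⟨z, ⟨hz, hzK, hadj⟩, rfl⟩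
    have : M u (p z u) = hex.choose := by
      simp only [hM]; rw [if_neg hnb, dif_pos hex]
    rw [this]
    obtain ⟨⟨g1, g2, g3⟩, g4⟩ := hex.choose_spec
    exact p2 _ g1 g2 _ hz hzK u hu g3 hadj g4
  have E3 : ∀ u x, x ∈ Wu u → M u x = m u x := by
    intro u x hx
    obtain ⟨g1, g2, g3, g4⟩ := (hWm u x).1 hx
    simp only [hM]
    rw [if_neg g2, dif_neg (fun h => g3 ((hPm u x).2 h))]
  have tri : ∀ u ∈ K, ∀ x, G.Adj u x → x ∉ K → ¬ (u ∈ T ∧ x = r u) →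
      (x ∈ Big ∧ M u x = p x u) ∨ (∃ z, z ∈ Big ∧ z ∉ K ∧ G.Adj u z ∧ p z u = x ∧ M u x = z) ∨
      (x ∈ Wu u ∧ M u x = m u x) := by
    intro u hu x hadj hxK hnr
    by_cases hxB : x ∈ Big
    · exact Or.inl ⟨hxB, E1 u x hxB⟩
    by_cases hxP : x ∈ P u
    · obtain ⟨z, ⟨g1, g2, g3⟩, rfl⟩ := (hPm u x).1 hxP
      exact Or.inr (Or.inl ⟨z, g1, g2, g3, rfl, E2 u hu z g1 g2 g3⟩)
    · have hW : x ∈ Wu u := (hWm u x).2 ⟨hadj, hxB, hxP, fun h => hnr ((hRm u x).1 h)⟩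
      exact Or.inr (Or.inr ⟨hW, E3 u x hW⟩)
  refine ⟨M, ?_, ?_⟩
  · intro u hu x hadj hxK hnr
    rcases tri u hu x hadj hxK hnr with ⟨hxB, he⟩ | ⟨z, hz, hzK, hzu, rfl, he⟩ | ⟨hW, he⟩
    · rw [he]
      obtain ⟨g1, g2, g3⟩ := p1 x hxB hxK u hu hadj
      refine ⟨⟨g2, hOK _ g1, ?_⟩, E2 u hu x hxB hxK hadj, ?_, g3, ?_⟩
      · rintro ⟨hu', heq⟩
        have := (Finset.mem_sdiff.1 (hr u hu')).2
        exact this ((hPm u _).2 ⟨x, ⟨hxB, hxK, hadj⟩, heq⟩)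
      · intro h; exact hOB' _ g1 (by rw [h]; exact hxB)
      · intro h; exact hOB' _ (hRO _ _ h) hxB
    · rw [he]
      obtain ⟨g1, g2, g3⟩ := p1 z hz hzK u hu hzu
      refine ⟨⟨hzu, hzK, ?_⟩, E1 u z hz, ?_, fun h => g3 h.symm, ?_⟩
      · rintro ⟨hu', heq⟩
        have := (Finset.mem_inter.1 (Finset.mem_sdiff.1 (hr u hu')).1).2
        exact hOB' _ this (heq ▸ hz)
      · intro h; exact hOB' _ g1 (by rw [← h]; exact hz)
      · intro h; exact hOB' _ (hRO _ _ (hRs _ _ h)) hz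
    · rw [he]
      obtain ⟨g1, g2, g3, g4, g5⟩ := hm1 u hu x hW
      have g6 := (hWm u _).1 g1
      refine ⟨⟨g6.1, fun h => g6.2.1 (hKB h), fun h => g6.2.2.2 ((hRm _ _).2 h)⟩, ?_, g3, g4, g5⟩
      rw [E3 u _ g1, g2]
  · intro u hu u' hu' x hadj hadj' hxK hnr hnr' heq
    rcases tri u hu x hadj hxK hnr with ⟨hxB, he⟩ | ⟨z, hz, hzK, hzu, hpz, he⟩ | ⟨hW, he⟩ <;>
    rcases tri u' hu' x hadj' hxK hnr' with ⟨hxB', he'⟩ | ⟨z', hz', hzK', hzu', hpz', he'⟩ | ⟨hW', he'⟩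
    · rw [he, he'] at heq
      exact p3 x hxB hxK u hu u' hu' hadj hadj' heq
    · exact absurd hxB (hOB' _ (hpz' ▸ (p1 z' hz' hzK' u' hu' hzu').1))
    · exact absurd hxB ((hWm _ _).1 hW').2.1
    · exact absurd hxB' (hOB' _ (hpz ▸ (p1 z hz hzK u hu hzu).1))
    · rw [he, he'] at heq
      subst heq
      exact p3 z hz hzK u hu u' hu' hzu hzu' (hpz.trans hpz'.symm)
    · rw [he, he'] at heq
      have := ((hWm _ _).1 (hm1 u' hu' x hW').1).2.1
      exact absurd hz (heq ▸ this)
    · exact absurd hxB' ((hWm _ _).1 hW).2.1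
    · rw [he, he'] at heq
      have := ((hWm _ _).1 (hm1 u hu x hW).1).2.1
      exact absurd hz' (heq ▸ this)
    · rw [he, he'] at heq
      by_contra hne
      exact hm2 u hu u' hu' hne x hW hW' heq
end P6
end TOI

namespace TOI
set_option linter.unusedVariables false
set_option linter.unusedSectionVars false
open SimpleGraph
section P7
open scoped Classical
variable {V : Type*} [Fintype V]

lemma big_small (G : SimpleGraph V) (s : ℕ) (hs : 1 ≤ s) (hK : ¬ HasK s G) (v : V)
    (hD : 100 * s ≤ (nb G v).card) :
    (Finset.univ.filter
      (fun z => 3 * (nb G v).card ≤ 5 * (nb G z ∩ nb G v).card)).card < s := by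
  by_contra hc
  rw [not_lt] at hc
  obtain ⟨B, hBX, hB⟩ := Finset.exists_subset_card_eq hc
  apply hK
  refine cn_lemma G s B (nb G v \ B) hB Finset.disjoint_sdiff ?_
  intro b hb b' hb' hne
  have h1 := (Finset.mem_filter.1 (hBX hb)).2
  have h2 := (Finset.mem_filter.1 (hBX hb')).2
  have h3 := Finset.card_union_add_card_inter (nb G b ∩ nb G v) (nb G b' ∩ nb G v)
  have h4 : ((nb G b ∩ nb G v) ∪ (nb G b' ∩ nb G v)).card ≤ (nb G v).card :=
    Finset.card_le_card (Finset.union_subset Finset.inter_subset_right Finset.inter_subset_right)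
  have hsub : (nb G b ∩ nb G v) ∩ (nb G b' ∩ nb G v) ⊆
      ((nb G v \ B).filter (fun x => G.Adj b x ∧ G.Adj b' x)) ∪ B := by
    intro x hx
    simp only [Finset.mem_inter, Finset.mem_union, Finset.mem_filter, Finset.mem_sdiff,
      mem_nb] at hx ⊢
    tauto
  have h5 := (Finset.card_le_card hsub).trans (Finset.card_union_le _ _)
  omega

lemma step (G : SimpleGraph V) (s : ℕ) (hs : 1 ≤ s) (hK : ¬ HasK s G) (v : V)
    (hD : 100 * s ≤ (nb G v).card) :
    ∃ K : Finset V, v ∈ K ∧ ∃ G' : SimpleGraph V, Imm G' G ∧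
      (∀ a b, G'.Adj a b → a ∉ K ∧ ∃ y, G.Adj a y) ∧
      ∃ x0, x0 ∉ K ∧ (∃ y, G.Adj x0 y) ∧
        (∀ x, x ∉ K → (nb G x).card ≤ (nb G' x).card + 1) ∧
        (∀ x, x ∉ K → x ≠ x0 → (nb G x).card ≤ (nb G' x).card) := by
  have : Nonempty V := ⟨v⟩
  have hBc := big_small G s hs hK v hD
  set D := (nb G v).card with hDd
  set Big := Finset.univ.filter (fun z => 3 * D ≤ 5 * (nb G z ∩ nb G v).card) with hBig
  have hBm : ∀ z, z ∈ Big ↔ 3 * D ≤ 5 * (nb G z ∩ nb G v).card := by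
    intro z; simp [hBig]
  set Om := nb G v \ Big with hOm
  have hOB : Disjoint Om Big := Finset.sdiff_disjoint
  have hOmc : D ≤ Om.card + Big.card := by
    have : (nb G v).card ≤ Om.card + Big.card := Finset.card_le_card_sdiff_add_card (t := Big) (s := nb G v)
    omega
  obtain ⟨a, ha⟩ : ∃ a : V → ℕ, ∀ z, a z = (nb G z ∩ Om).card := ⟨_, fun _ => rfl⟩
  obtain ⟨θ, hθ1, hθ2, w1, w2⟩ := window Big a ((4 * D + 4) / 5) (D - s) (by omega)
  have hav : θ ≤ a v := by
    rw [ha, Finset.inter_eq_right.2 Finset.sdiff_subset]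
    change θ ≤ Om.card
    omega
  have hvB : v ∈ Big := by
    rw [hBm, Finset.inter_self]; omega
  have hxθ : ∀ x, x ∉ Big → (nb G x ∩ Om).card + 16 * s ≤ θ := by
    intro x hx
    rw [hBm] at hx
    have : (nb G x ∩ Om).card ≤ (nb G x ∩ nb G v).card :=
      Finset.card_le_card (Finset.inter_subset_inter_left Finset.sdiff_subset)
    omega
  -- maximal Build set
  obtain ⟨K, hKm, hKmax⟩ := Finset.exists_max_image
    ((Big.filter (fun z => θ ≤ a z)).powerset.filter (fun K => Build G K ∧ v ∈ K)) Finset.card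
    ⟨{v}, by
      simp only [Finset.mem_filter, Finset.mem_powerset, Finset.singleton_subset_iff,
        Finset.mem_singleton, and_true]
      exact ⟨⟨hvB, hav⟩, Build.single v⟩⟩
  simp only [Finset.mem_filter, Finset.mem_powerset] at hKm hKmax
  obtain ⟨hKsub, hKb, hvK⟩ := hKm
  have hKB : K ⊆ Big := hKsub.trans (Finset.filter_subset _ _)
  have hKθ : ∀ u ∈ K, θ ≤ a u := fun u hu => (Finset.mem_filter.1 (hKsub hu)).2
  have hBθ : ∀ z ∈ Big, z ∉ K → ∀ u ∈ K, G.Adj u z → a z < θ := by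
    intro z hz hzK u hu hadj
    by_contra hc
    rw [not_lt] at hc
    have := hKmax (insert z K) ⟨?_, Build.ins z u K hKb hu hzK hadj.symm,
      Finset.mem_insert_of_mem hvK⟩
    · rw [Finset.card_insert_of_notMem hzK] at this; omega
    · intro y hy
      rcases Finset.mem_insert.1 hy with rfl | hy
      · exact Finset.mem_filter.2 ⟨hz, hc⟩
      · exact hKsub hy
  obtain ⟨p, p1, p2, p3⟩ := choose_p G Big Om K θ hKB a ha w1 w2 hKθ hBθ
  set T := K.filter (fun u => Odd (nb G u \ K).card) with hT
  have hTK : T ⊆ K := Finset.filter_subset _ _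
  obtain ⟨ψ, ST, t1, t2, t3, t4, t5, t6, t7⟩ := tpair G K hKb T hTK
  have hKθ' : ∀ u ∈ K, θ ≤ (nb G u ∩ Om).card := fun u hu => by rw [← ha]; exact hKθ u hu
  have hOB' : ∀ x ∈ Om, x ∉ Big := fun x hx hx' => Finset.disjoint_left.1 hOB hx hx'
  have hOK : ∀ x ∈ Om, x ∉ K := fun x hx hx' => hOB' x hx (hKB hx')
  have hPc : ∀ u, (Pset G Big K p u).card ≤ s := by
    intro u
    refine Finset.card_image_le.trans (le_trans (Finset.card_le_card ?_) hBc.le)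
    intro z hz; simp only [Finset.mem_sdiff, Finset.mem_inter] at hz; exact hz.1.2
  obtain ⟨r, r1, r2, r3⟩ := choose_r G s T
    ((Finset.card_le_card (hTK.trans hKB)).trans hBc.le) ψ t1 t2
    (fun u => (nb G u ∩ Om) \ Pset G Big K p u) (by
      intro u hu u' hu' x hx
      have hxB := hOB' x (Finset.mem_inter.1 (Finset.mem_sdiff.1 hx).1).2
      have h1 := hxθ x hxB
      have h2 := hKθ' u (hTK hu)
      have h3 := hPc u
      have hsub : nb G u ∩ Om ⊆ (((nb G u ∩ Om) \ Pset G Big K p u) \ nb G x) ∪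
          ((nb G x ∩ Om) ∪ Pset G Big K p u) := by
        intro y hy
        simp only [Finset.mem_union, Finset.mem_sdiff, Finset.mem_inter] at hy ⊢
        tauto
      have h4 := (Finset.card_le_card hsub).trans (Finset.card_union_le _ _)
      have h5 := Finset.card_union_le (nb G x ∩ Om) (Pset G Big K p u)
      omega) (by
      intro u hu
      have h2 := hKθ' u (hTK hu)
      have h3 := hPc u
      have h4 := Finset.card_le_card_sdiff_add_card (t := Pset G Big K p u) (s := nb G u ∩ Om)
      omega)
  have rO : ∀ u ∈ T, r u ∈ Om := fun u hu =>
    (Finset.mem_inter.1 (Finset.mem_sdiff.1 (r1 u hu)).1).2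
  have rA : ∀ u ∈ T, G.Adj u (r u) := fun u hu =>
    mem_nb.1 (Finset.mem_inter.1 (Finset.mem_sdiff.1 (r1 u hu)).1).1
  obtain ⟨M, M1, M2⟩ := step_M G s hs hK Big Om K T θ hKB hOB hBc.le hKθ' hxθ p p1 p2 p3 hTK
    (by intro u hu; simp [hT, hu]) r r1 (fun x y => ∃ u ∈ T, x = r u ∧ y = r (ψ u))
    (by
      rintro x y ⟨u, hu, rfl, rfl⟩
      exact ⟨ψ u, t1 u hu, rfl, by rw [t2 u hu]⟩)
    (by
      rintro x y y' ⟨u, hu, rfl, rfl⟩ ⟨u', hu', heq, rfl⟩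
      rw [r2 u hu u' hu' heq])
    (by
      rintro x y ⟨u, hu, rfl, rfl⟩
      exact rO u hu)
  -- half-edge involution
  obtain ⟨H, hH⟩ : ∃ H : Set (V × V), ∀ x u, (x, u) ∈ H ↔ x ∉ K ∧ u ∈ K ∧ G.Adj x u :=
    ⟨{h | h.1 ∉ K ∧ h.2 ∈ K ∧ G.Adj h.1 h.2}, fun x u => Iff.rfl⟩
  obtain ⟨Ψ, Ψa, Ψb⟩ : ∃ Ψ : V × V → V × V,
      (∀ u ∈ T, Ψ (r u, u) = (r (ψ u), ψ u)) ∧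
      (∀ x u, ¬ (u ∈ T ∧ x = r u) → Ψ (x, u) = (M u x, u)) := by
    refine ⟨fun h => if h.2 ∈ T ∧ h.1 = r h.2 then (r (ψ h.2), ψ h.2) else (M h.2 h.1, h.2), ?_, ?_⟩
    · intro u hu; simp [hu]
    · intro x u hn; simp only [hn, if_false]
  obtain ⟨Q, Qa, Qb⟩ : ∃ Q : V × V → Set (Sym2 V),
      (∀ u ∈ T, Q (r u, u) = ST u) ∧ (∀ x u, ¬ (u ∈ T ∧ x = r u) → Q (x, u) = ∅) := by
    refine ⟨fun h => if h.2 ∈ T ∧ h.1 = r h.2 then ST h.2 else ∅, ?_, ?_⟩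
    · intro u hu; simp [hu]
    · intro x u hn; simp only [hn, if_false]
  have cases : ∀ h ∈ H, (∃ u ∈ T, h = (r u, u)) ∨
      (∃ x u, h = (x, u) ∧ x ∉ K ∧ u ∈ K ∧ G.Adj u x ∧ ¬ (u ∈ T ∧ x = r u)) := by
    rintro ⟨x, u⟩ hh
    obtain ⟨g1, g2, g3⟩ := (hH x u).1 hh
    by_cases hc : u ∈ T ∧ x = r u
    · exact Or.inl ⟨u, hc.1, by rw [hc.2]⟩
    · exact Or.inr ⟨x, u, rfl, g1, g2, g3.symm, hc⟩
  have rH : ∀ u ∈ T, (r u, u) ∈ H := fun u hu =>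
    (hH _ _).2 ⟨hOK _ (rO u hu), hTK hu, (rA u hu).symm⟩
  have nofix : ∀ x u, x ∉ K → u ∈ K → G.Adj u x → ¬ (u ∈ T ∧ x = r u) → Ψ (x, u) ≠ (x, u) := by
    intro x u h1 h2 h3 h4 heq
    rw [Ψb x u h4] at heq
    exact (M1 u h2 x h3 h1 h4).2.2.1 (Prod.ext_iff.1 heq).1
  have hfix : ∀ h ∈ H, ∀ h' ∈ H, Ψ h = h → Ψ h' = h' → h = h' := by
    intro h hh h' hh' e e'
    rcases cases h hh with ⟨u, hu, rfl⟩ | ⟨x, u, rfl, g1, g2, g3, g4⟩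
    · rcases cases h' hh' with ⟨u', hu', rfl⟩ | ⟨x', u', rfl, g1', g2', g3', g4'⟩
      · rw [Ψa u hu] at e
        rw [Ψa u' hu'] at e'
        have := t3 u hu u' hu' (Prod.ext_iff.1 e).2 (Prod.ext_iff.1 e').2
        rw [this]
      · exact absurd e' (nofix _ _ g1' g2' g3' g4')
    · exact absurd e (nofix _ _ g1 g2 g3 g4)
  obtain ⟨G', hI, hsup, hd1, hd2⟩ := eliminate G K H hH Ψ Q
    (by
      intro h hh
      rcases cases h hh with ⟨u, hu, rfl⟩ | ⟨x, u, rfl, g1, g2, g3, g4⟩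
      · rw [Ψa u hu]; exact rH _ (t1 u hu)
      · rw [Ψb x u g4]
        obtain ⟨⟨k1, k2, k3⟩, k4⟩ := M1 u g2 x g3 g1 g4
        exact (hH _ _).2 ⟨k2, g2, k1.symm⟩)
    (by
      intro h hh
      rcases cases h hh with ⟨u, hu, rfl⟩ | ⟨x, u, rfl, g1, g2, g3, g4⟩
      · rw [Ψa u hu, Ψa _ (t1 u hu), t2 u hu]
      · obtain ⟨⟨k1, k2, k3⟩, k4, k5⟩ := M1 u g2 x g3 g1 g4
        rw [Ψb x u g4, Ψb _ _ k3, k4])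
    hfix
    (by
      intro h hh hne
      rcases cases h hh with ⟨u, hu, rfl⟩ | ⟨x, u, rfl, g1, g2, g3, g4⟩
      · rw [Ψa u hu] at hne ⊢
        refine ⟨?_, r3 u hu⟩
        intro heq
        have := r2 _ hu _ (t1 u hu) heq
        exact hne (by rw [← this])
      · obtain ⟨⟨k1, k2, k3⟩, k4, k5, k6, k7⟩ := M1 u g2 x g3 g1 g4
        rw [Ψb x u g4]
        exact ⟨fun h => k5 h.symm, k6⟩)
    (by
      intro x u u' hh hh' hne hne' heq
      rcases cases _ hh with ⟨u1, hu1, e1⟩ | ⟨x1, u1, e1, g1, g2, g3, g4⟩ <;>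
      rcases cases _ hh' with ⟨u2, hu2, e2⟩ | ⟨x2, u2, e2, k1, k2, k3, k4⟩ <;>
      rw [Prod.mk.injEq] at e1 e2 <;>
      obtain ⟨e1, rfl⟩ := e1 <;> obtain ⟨e2, rfl⟩ := e2
      · exact r2 u hu1 u' hu2 (e1.symm.trans e2)
      · subst e2
        rw [Ψb x u' k4] at heq
        subst e1
        rw [Ψa u hu1] at heq
        exact absurd ⟨u, hu1, rfl, heq.symm⟩ (M1 u' k2 _ k3 k1 k4).2.2.2.2
      · subst e1
        rw [Ψb x u g4] at heq
        subst e2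
        rw [Ψa u' hu2] at heq
        exact absurd ⟨u', hu2, rfl, heq⟩ (M1 u g2 _ g3 g1 g4).2.2.2.2
      · subst e1
        subst e2
        rw [Ψb x u g4, Ψb x u' k4] at heq
        exact M2 u g2 u' k2 x g3 k3 g1 g4 k4 heq)
    (by
      intro h hh e he
      rcases cases h hh with ⟨u, hu, rfl⟩ | ⟨x, u, rfl, g1, g2, g3, g4⟩
      · rw [Qa u hu] at he; exact t5 u hu e he
      · rw [Qb x u g4] at he; exact absurd he (Set.notMem_empty _))
    (by
      intro h hh
      rcases cases h hh with ⟨u, hu, rfl⟩ | ⟨x, u, rfl, g1, g2, g3, g4⟩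
      · rw [Ψa u hu, Qa u hu, Qa _ (t1 u hu), t4 u hu]
      · obtain ⟨⟨k1, k2, k3⟩, k4⟩ := M1 u g2 x g3 g1 g4
        rw [Ψb x u g4, Qb _ _ g4, Qb _ _ k3])
    (by
      intro h hh h' hh' hne hne'
      rcases cases h hh with ⟨u, hu, rfl⟩ | ⟨x, u, rfl, g1, g2, g3, g4⟩
      · rcases cases h' hh' with ⟨u', hu', rfl⟩ | ⟨x', u', rfl, g1', g2', g3', g4'⟩
        · rw [Qa u hu, Qa u' hu']
          rw [Ψa u hu] at hne'
          refine t6 u hu u' hu' ?_ ?_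
          · intro h; exact hne (by rw [h])
          · intro h; exact hne' (by rw [h])
        · rw [Qb _ _ g4']; exact Set.disjoint_empty _
      · rw [Qb _ _ g4]; exact Set.empty_disjoint _)
    (by
      intro h hh
      rcases cases h hh with ⟨u, hu, rfl⟩ | ⟨x, u, rfl, g1, g2, g3, g4⟩
      · rw [Ψa u hu, Qa u hu]; exact t7 u hu
      · rw [Ψb x u g4])
  refine ⟨K, hvK, G', hI, hsup, ?_⟩
  by_cases hex : ∃ h ∈ H, Ψ h = h
  · obtain ⟨⟨x0, u0⟩, hh, he⟩ := hex
    obtain ⟨g1, g2, g3⟩ := (hH _ _).1 hh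
    refine ⟨x0, g1, ⟨u0, g3⟩, hd1, ?_⟩
    intro x hx hne
    refine hd2 x hx ?_
    intro u hu he'
    exact hne (Prod.ext_iff.1 (hfix _ hu _ hh he' he)).1
  · push Not at hex
    have hOne : Om.Nonempty := by
      rw [← Finset.card_pos]; omega
    obtain ⟨x0, hx0⟩ := hOne
    refine ⟨x0, hOK _ hx0, ⟨v, ?_⟩, hd1, fun x hx _ => hd2 x hx (fun u hu => hex _ hu)⟩
    exact (mem_nb.1 (Finset.mem_sdiff.1 hx0).1).symm

theorem descent (s d : ℕ) (hs : 1 ≤ s) (hd : 100 * s + 1 ≤ d) (n : ℕ) :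
    ∀ (W : Finset V) (G : SimpleGraph V) (v : V), W.card ≤ n → v ∈ W →
      (∀ x y, G.Adj x y → x ∈ W) →
      (∀ x ∈ W, x ≠ v → d ≤ (nb G x).card) → d ≤ (nb G v).card + 1 → HasK s G := by
  induction n with
  | zero =>
    intro W G v hW hv
    rw [Nat.le_zero, Finset.card_eq_zero] at hW
    subst hW; simp at hv
  | succ n ih =>
    intro W G v hW hv hsup hdeg hdv
    by_contra hK
    obtain ⟨K, hvK, G', hI, hsup', x0, hx0K, ⟨y, hy⟩, hd1, hd2⟩ := step G s hs hK v (by omega)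
    apply hK
    refine HasK.trans (ih (W \ K) G' x0 ?_ ?_ ?_ ?_ ?_) hI
    · have : (W \ K).card < W.card := Finset.card_lt_card (by
        rw [Finset.ssubset_iff_of_subset Finset.sdiff_subset]
        exact ⟨v, hv, by simp [hvK]⟩)
      omega
    · exact Finset.mem_sdiff.2 ⟨hsup _ _ hy, hx0K⟩
    · intro a b hab
      obtain ⟨h1, z, hz⟩ := hsup' a b hab
      exact Finset.mem_sdiff.2 ⟨hsup _ _ hz, h1⟩
    · intro x hx hne
      rw [Finset.mem_sdiff] at hx
      have h1 := hd2 x hx.2 hne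
      have h2 := hdeg x hx.1 (fun h => hx.2 (h ▸ hvK))
      omega
    · have h1 := hd1 x0 hx0K
      have h2 := hdeg x0 (hsup _ _ hy) (fun h => hx0K (h ▸ hvK))
      omega
end P7
end TOI

namespace TOI
set_option linter.unusedVariables false
set_option linter.unusedSectionVars false
open SimpleGraph
section P8
open scoped Classical
variable {V : Type*} [Fintype V]

/-- injective path of length n along relation r -/
def RPath (r : V → V → Prop) (x y : V) (n : ℕ) (g : ℕ → V) : Prop :=
  g 0 = x ∧ g n = y ∧ (∀ k < n, r (g k) (g (k + 1))) ∧
    (∀ j k, j ≤ n → k ≤ n → g j = g k → j = k)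

lemma exists_rpath (r : V → V → Prop) (x y : V) (h : Relation.ReflTransGen r x y) :
    ∃ n g, RPath r x y n g := by
  have hw : ∃ n, ∃ g : ℕ → V, g 0 = x ∧ g n = y ∧ ∀ k < n, r (g k) (g (k + 1)) := by
    induction h with
    | refl => exact ⟨0, fun _ => x, rfl, rfl, by simp⟩
    | tail hxb hbc ih =>
      rename_i b c
      obtain ⟨n, g, h0, hn, hk⟩ := ih
      refine ⟨n + 1, fun k => if k ≤ n then g k else c, by simp [h0], by simp, ?_⟩
      intro k hkn
      by_cases hlt : k < n
      · have : k + 1 ≤ n := hlt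
        simp only [hlt.le, this, if_true]
        exact hk k hlt
      · have : k = n := by omega
        subst this
        simp only [le_refl, if_true, Nat.not_succ_le_self, if_false, hn]
        exact hbc
  obtain ⟨g, h0, hn, hk⟩ := Nat.find_spec hw
  set n := Nat.find hw with hnd
  refine ⟨n, g, h0, hn, hk, ?_⟩
  have key : ∀ i j, i < j → j ≤ n → g i ≠ g j := by
    intro i j hij hjn heq
    refine Nat.find_min hw (m := n - (j - i)) (by omega) ?_
    refine ⟨fun k => if k ≤ i then g k else g (k + (j - i)), by simp [h0], ?_, ?_⟩
    · by_cases hc : n - (j - i) ≤ i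
      · have : j = n := by omega
        have h2 : n - (j - i) = i := by omega
        simp only [h2, le_refl, if_true]
        rw [heq, this, hn]
      · simp only [hc, if_false]
        rw [show n - (j - i) + (j - i) = n by omega, hn]
    · intro k hkn
      by_cases h1 : k + 1 ≤ i
      · have h2 : k ≤ i := by omega
        simp only [h1, h2, if_true]
        exact hk k (by omega)
      · by_cases h2 : k ≤ i
        · have h3 : k = i := by omega
          subst h3
          simp only [h1, le_refl, if_true, if_false]
          rw [heq, show k + 1 + (j - k) = j + 1 by omega]
          exact hk j (by omega)
        · simp only [h1, h2, if_false]
          rw [show k + 1 + (j - i) = k + (j - i) + 1 by omega]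
          exact hk _ (by omega)
  intro j k hj hkn heq
  rcases lt_trichotomy j k with h | h | h
  · exact absurd heq (key j k h hkn)
  · exact h
  · exact absurd heq.symm (key k j h hj)

noncomputable def pc (g : ℕ → V) (n : ℕ) (a b : V) : ℤ :=
  ∑ k ∈ Finset.range n, (if g k = a ∧ g (k + 1) = b then 1 else 0)

lemma pc_le (g : ℕ → V) (n : ℕ) (hg : ∀ j k, j ≤ n → k ≤ n → g j = g k → j = k) (a b : V) :
    pc g n a b = if (∃ k < n, g k = a ∧ g (k + 1) = b) then 1 else 0 := by
  unfold pc
  split_ifs with h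
  · obtain ⟨k, hk, hka, hkb⟩ := h
    rw [Finset.sum_eq_single k]
    · simp [hka, hkb]
    · intro j hj hjk
      rw [if_neg]
      rintro ⟨h1, h2⟩
      rw [Finset.mem_range] at hj
      exact hjk (hg j k hj.le hk.le (h1.trans hka.symm))
    · intro hn; exact absurd (Finset.mem_range.2 hk) hn
  · refine Finset.sum_eq_zero fun k hk => ?_
    rw [if_neg]
    intro h'
    exact h ⟨k, Finset.mem_range.1 hk, h'⟩

lemma pc_net (g : ℕ → V) (n : ℕ) (a : V) :
    ∑ b, (pc g n a b - pc g n b a) =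
      (if g 0 = a then 1 else 0) - (if g n = a then 1 else 0) := by
  have h1 : ∑ b, pc g n a b = ∑ k ∈ Finset.range n, (if g k = a then (1:ℤ) else 0) := by
    unfold pc
    rw [Finset.sum_comm]
    refine Finset.sum_congr rfl fun k _ => ?_
    by_cases h : g k = a <;> simp [h]
  have h2 : ∑ b, pc g n b a = ∑ k ∈ Finset.range n, (if g (k + 1) = a then (1:ℤ) else 0) := by
    unfold pc
    rw [Finset.sum_comm]
    refine Finset.sum_congr rfl fun k _ => ?_
    by_cases h : g (k + 1) = a <;> simp [h]
  rw [Finset.sum_sub_distrib, h1, h2, ← Finset.sum_sub_distrib]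
  exact Finset.sum_range_sub' (fun k => if g k = a then (1:ℤ) else 0) n

def IsFlow (H : SimpleGraph V) (κ : ℕ) (T : Finset V) (sup : V → ℕ) (f : V → V → ℤ)
    (ab : V → ℕ) : Prop :=
  (∀ a b, f a b = - f b a) ∧ (∀ a b, f a b ≤ 1) ∧ (∀ a b, ¬ H.Adj a b → f a b = 0) ∧
  (∀ x, ab x ≤ if x ∈ T then κ else 0) ∧ (∀ a, ∑ b, f a b = (sup a : ℤ) - ab a)

lemma cut_sum (f : V → V → ℤ) (hf : ∀ a b, f a b = - f b a) (Y : Finset V) :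
    ∑ a ∈ Y, ∑ b, f a b = ∑ a ∈ Y, ∑ b ∈ Yᶜ, f a b := by
  have h1 : ∑ a ∈ Y, ∑ b ∈ Y, f a b = 0 := by
    have : ∑ a ∈ Y, ∑ b ∈ Y, f a b = - ∑ a ∈ Y, ∑ b ∈ Y, f a b := by
      conv_lhs => rw [Finset.sum_comm]
      rw [← Finset.sum_neg_distrib]
      refine Finset.sum_congr rfl fun b _ => ?_
      rw [← Finset.sum_neg_distrib]
      exact Finset.sum_congr rfl fun a _ => hf a b
    omega
  have h2 : ∀ a, ∑ b, f a b = ∑ b ∈ Y, f a b + ∑ b ∈ Yᶜ, f a b := fun a =>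
    (Finset.sum_add_sum_compl Y _).symm
  simp_rw [h2]
  rw [Finset.sum_add_distrib, h1, zero_add]

noncomputable def cutc (H : SimpleGraph V) (Y : Finset V) : ℕ :=
  (Finset.univ.filter (fun e : V × V => e.1 ∈ Y ∧ e.2 ∉ Y ∧ H.Adj e.1 e.2)).card

lemma cutc_eq (H : SimpleGraph V) (Y : Finset V) :
    (cutc H Y : ℤ) = ∑ a ∈ Y, ∑ b ∈ Yᶜ, (if H.Adj a b then (1:ℤ) else 0) := by
  rw [← Finset.sum_product', Finset.sum_boole, cutc]
  congr 2
  ext ⟨a, b⟩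
  simp [and_assoc]

noncomputable def supOf {ι : Type*} (src : ι → V) (I : Finset ι) (a : V) : ℕ :=
  (I.filter (fun i => src i = a)).card

lemma sum_supOf {ι : Type*} (src : ι → V) (I : Finset ι) (Y : Finset V) :
    ∑ a ∈ Y, supOf src I a = (I.filter (fun i => src i ∈ Y)).card := by
  unfold supOf
  rw [Finset.card_eq_sum_card_fiberwise (f := src) (t := Y)]
  · refine Finset.sum_congr rfl fun a ha => ?_
    refine congrArg Finset.card ?_
    ext i
    simp only [Finset.mem_filter]
    constructor
    · rintro ⟨h1, rfl⟩; exact ⟨⟨h1, ha⟩, rfl⟩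
    · rintro ⟨⟨h1, _⟩, h2⟩; exact ⟨h1, h2⟩
  · intro i hi
    simpa using (Finset.mem_filter.1 hi).2

lemma supOf_insert {ι : Type*} (src : ι → V) (I : Finset ι) (i : ι) (hi : i ∉ I) (a : V) :
    supOf src (insert i I) a = supOf src I a + (if src i = a then 1 else 0) := by
  unfold supOf
  rw [Finset.filter_insert]
  split_ifs with h
  · rw [Finset.card_insert_of_notMem (by simp [hi])]
  · rfl

lemma flow_exists {ι : Type*} (H : SimpleGraph V) (κ : ℕ) (T : Finset V) (src : ι → V)
    (I : Finset ι)
    (hcut : ∀ Y : Finset V, (I.filter (fun i => src i ∈ Y)).card ≤ cutc H Y + κ * (T ∩ Y).card) :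
    ∃ f ab, IsFlow H κ T (supOf src I) f ab := by
  induction I using Finset.induction_on with
  | empty =>
    exact ⟨fun _ _ => 0, fun _ => 0, by simp, by simp, by simp, by simp, by simp [supOf]⟩
  | insert i I hi ih =>
    obtain ⟨f, ab, f1, f2, f3, f4, f5⟩ := ih (fun Y => le_trans (Finset.card_le_card
      (Finset.filter_subset_filter _ (Finset.subset_insert _ _))) (hcut Y))
    set r : V → V → Prop := fun a b => H.Adj a b ∧ f a b < 1 with hr
    by_cases hex : ∃ x, Relation.ReflTransGen r (src i) x ∧ x ∈ T ∧ ab x < κ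
    · obtain ⟨x, hx, hxT, hxκ⟩ := hex
      obtain ⟨n, g, g0, gn, gr, ginj⟩ := exists_rpath r _ _ hx
      have hpc := pc_le g n ginj
      refine ⟨fun a b => f a b + (pc g n a b - pc g n b a),
        fun y => ab y + if x = y then 1 else 0, ?_, ?_, ?_, ?_, ?_⟩
      · intro a b; have := f1 a b; simp only; omega
      · intro a b
        have h1 := f2 a b
        simp only [hpc]
        by_cases hc : ∃ k < n, g k = a ∧ g (k + 1) = b
        · obtain ⟨k, hk, ha, hb⟩ := hc
          have := (gr k hk).2
          rw [ha, hb] at this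
          split_ifs <;> omega
        · split_ifs <;> omega
      · intro a b hab
        have h1 := f3 a b hab
        simp only [hpc]
        rw [if_neg, if_neg, h1]; · simp
        · rintro ⟨k, hk, ha, hb⟩
          have := (gr k hk).1
          rw [ha, hb] at this
          exact hab this.symm
        · rintro ⟨k, hk, ha, hb⟩
          have := (gr k hk).1
          rw [ha, hb] at this
          exact hab this
      · intro y
        have := f4 y
        simp only
        by_cases hxy : x = y
        · subst hxy; simp only [hxT, if_true] at this ⊢; omega
        · simpa [hxy] using this
      · intro a
        rw [Finset.sum_add_distrib, f5, pc_net, g0, gn, supOf_insert _ _ _ hi]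
        push_cast
        ring
    · exfalso
      push Not at hex
      set Y : Finset V := Finset.univ.filter (fun y => Relation.ReflTransGen r (src i) y) with hY
      have hYm : ∀ y, y ∈ Y ↔ Relation.ReflTransGen r (src i) y := by intro y; simp [hY]
      have hc := hcut Y
      have hiY : src i ∈ Y := (hYm _).2 Relation.ReflTransGen.refl
      rw [Finset.filter_insert, if_pos hiY, Finset.card_insert_of_notMem (by simp [hi]),
        ← sum_supOf] at hc
      have e1 := cut_sum f f1 Y
      have e2 : ∑ a ∈ Y, ∑ b ∈ Yᶜ, f a b = (cutc H Y : ℤ) := by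
        rw [cutc_eq]
        refine Finset.sum_congr rfl fun a ha => Finset.sum_congr rfl fun b hb => ?_
        split_ifs with hab
        · by_contra hne
          have hlt : f a b < 1 := lt_of_le_of_ne (f2 a b) hne
          rw [Finset.mem_compl, hYm] at hb
          exact hb (((hYm a).1 ha).tail ⟨hab, hlt⟩)
        · exact f3 a b hab
      have e3 : ∑ a ∈ Y, (ab a : ℤ) = κ * (T ∩ Y).card := by
        have : ∀ a ∈ Y, (ab a : ℤ) = if a ∈ T then (κ : ℤ) else 0 := by
          intro a ha
          have h4 := f4 a
          split_ifs at h4 ⊢ with h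
          · have := hex a ((hYm a).1 ha) h; omega
          · omega
        rw [Finset.sum_congr rfl this, ← Finset.sum_filter, Finset.sum_const, nsmul_eq_mul,
          Finset.filter_mem_eq_inter, Finset.inter_comm, mul_comm]
      rw [e2] at e1
      simp_rw [f5] at e1
      rw [Finset.sum_sub_distrib, e3] at e1
      zify at hc
      linarith

lemma flow_decomp {ι : Type*} (H : SimpleGraph V) (κ : ℕ) (T : Finset V) (src : ι → V)
    (I : Finset ι) : ∀ f ab, IsFlow H κ T (supOf src I) f ab →
    ∃ (n : ι → ℕ) (g : ι → ℕ → V),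
      (∀ i ∈ I, g i 0 = src i ∧ (∀ k < n i, f (g i k) (g i (k + 1)) = 1) ∧
        (∀ j k, j ≤ n i → k ≤ n i → g i j = g i k → j = k)) ∧
      (∀ i ∈ I, ∀ i' ∈ I, i ≠ i' → ∀ k < n i, ∀ k' < n i',
        s(g i k, g i (k + 1)) ≠ s(g i' k', g i' (k' + 1))) ∧
      (∀ x, (I.filter (fun i => g i (n i) = x)).card ≤ ab x) := by
  induction I using Finset.induction_on with
  | empty =>
    intro f ab _
    exact ⟨fun _ => 0, fun i _ => src i, by simp, by simp, by simp⟩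
  | insert i I hi ih =>
    rintro f ab ⟨f1, f2, f3, f4, f5⟩
    set r : V → V → Prop := fun a b => f a b = 1 with hr
    by_cases hex : ∃ x, Relation.ReflTransGen r (src i) x ∧ 0 < ab x
    · obtain ⟨x, hx, hx0⟩ := hex
      obtain ⟨n0, g0, g00, gn, gr, ginj⟩ := exists_rpath r _ _ hx
      have hpc := pc_le g0 n0 ginj
      have hP : ∀ a b, (∃ k < n0, g0 k = a ∧ g0 (k + 1) = b) → f a b = 1 := by
        rintro a b ⟨k, hk, rfl, rfl⟩; exact gr k hk
      have hf' : ∀ a b, f a b - (pc g0 n0 a b - pc g0 n0 b a) =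
          if (∃ k < n0, g0 k = a ∧ g0 (k + 1) = b) ∨ (∃ k < n0, g0 k = b ∧ g0 (k + 1) = a) then 0
          else f a b := by
        intro a b
        have h1 := hP a b
        have h2 := hP b a
        have h3 := f1 a b
        rw [hpc, hpc]
        by_cases c1 : ∃ k < n0, g0 k = a ∧ g0 (k + 1) = b
        · have k1 := h1 c1
          by_cases c2 : ∃ k < n0, g0 k = b ∧ g0 (k + 1) = a
          · have k2 := h2 c2
            omega
          · rw [if_pos c1, if_neg c2, if_pos (Or.inl c1)]; omega
        · by_cases c2 : ∃ k < n0, g0 k = b ∧ g0 (k + 1) = a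
          · have k2 := h2 c2
            rw [if_neg c1, if_pos c2, if_pos (Or.inr c2)]; omega
          · rw [if_neg c1, if_neg c2, if_neg (by rw [not_or]; exact ⟨c1, c2⟩)]; omega
      obtain ⟨n, g, h1, h2, h3⟩ := ih (fun a b => f a b - (pc g0 n0 a b - pc g0 n0 b a))
        (fun y => ab y - if x = y then 1 else 0) (by
          refine ⟨?_, ?_, ?_, ?_, ?_⟩
          · intro a b; have := f1 a b; simp only; omega
          · intro a b
            have := f2 a b
            simp only [hf']
            split_ifs <;> omega
          · intro a b hab
            have := f3 a b hab
            simp only [hf']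
            split_ifs <;> omega
          · intro y
            exact (Nat.sub_le _ _).trans (f4 y)
          · intro a
            rw [Finset.sum_sub_distrib, pc_net, f5, supOf_insert _ _ _ hi, g00, gn]
            by_cases hxa : x = a
            · subst hxa
              simp only [if_true]
              push_cast [Nat.cast_sub (show 1 ≤ ab x from hx0)]
              ring
            · simp only [hxa, if_false, Nat.sub_zero]
              push_cast
              ring
              )
      have hne : ∀ j ∈ I, j ≠ i := fun j hj h => hi (h ▸ hj)
      have hdisj : ∀ j ∈ I, ∀ k < n j, ∀ k' < n0,
          s(g j k, g j (k + 1)) ≠ s(g0 k', g0 (k' + 1)) := by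
        intro j hj k hk k' hk' heq
        have h4 := (h1 j hj).2.1 k hk
        simp only [hf'] at h4
        rw [if_pos] at h4
        · exact absurd h4 (by norm_num)
        · rw [Sym2.eq_iff] at heq
          rcases heq with ⟨e1, e2⟩ | ⟨e1, e2⟩
          · exact Or.inl ⟨k', hk', e1.symm, e2.symm⟩
          · exact Or.inr ⟨k', hk', e2.symm, e1.symm⟩
      refine ⟨Function.update n i n0, Function.update g i g0, ?_, ?_, ?_⟩
      · intro j hj
        rcases Finset.mem_insert.1 hj with rfl | hj
        · simp only [Function.update_self]
          exact ⟨g00, gr, ginj⟩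
        · simp only [Function.update_of_ne (hne j hj)]
          obtain ⟨k1, k2, k3⟩ := h1 j hj
          refine ⟨k1, ?_, k3⟩
          intro k hk
          have := k2 k hk
          simp only [hf'] at this
          split_ifs at this
          · omega
          · exact this
      · intro j hj j' hj' hjj
        rcases Finset.mem_insert.1 hj with hji | hjI
        · subst hji
          rcases Finset.mem_insert.1 hj' with hji' | hjI'
          · exact absurd hji'.symm hjj
          · simp only [Function.update_self, Function.update_of_ne (hne j' hjI')]
            intro k hk k' hk' heq
            exact hdisj j' hjI' k' hk' k hk heq.symm
        · rcases Finset.mem_insert.1 hj' with hji' | hjI'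
          · subst hji'
            simp only [Function.update_self, Function.update_of_ne (hne j hjI)]
            exact hdisj j hjI
          · simp only [Function.update_of_ne (hne j hjI), Function.update_of_ne (hne j' hjI')]
            exact h2 j hjI j' hjI' hjj
      · intro y
        have h4 := h3 y
        have h5 : I.filter (fun j => (Function.update g i g0 j) (Function.update n i n0 j) = y) =
            I.filter (fun j => g j (n j) = y) := by
          refine Finset.filter_congr fun j hj => ?_
          rw [Function.update_of_ne (hne j hj), Function.update_of_ne (hne j hj)]
        rw [Finset.filter_insert, h5]
        simp only [Function.update_self, gn]
        split_ifs with hxy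
        · rw [Finset.card_insert_of_notMem (by simp [hi])]
          subst hxy
          simp only [if_true] at h4
          omega
        · simpa [hxy] using h4
    · exfalso
      push Not at hex
      set Y : Finset V := Finset.univ.filter (fun y => Relation.ReflTransGen r (src i) y) with hY
      have hYm : ∀ y, y ∈ Y ↔ Relation.ReflTransGen r (src i) y := by intro y; simp [hY]
      have hiY : src i ∈ Y := (hYm _).2 Relation.ReflTransGen.refl
      have e1 := cut_sum f f1 Y
      have e2 : ∑ a ∈ Y, ∑ b ∈ Yᶜ, f a b ≤ 0 := by
        refine Finset.sum_nonpos fun a ha => Finset.sum_nonpos fun b hb => ?_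
        by_contra hne
        have : f a b = 1 := by have := f2 a b; omega
        rw [Finset.mem_compl, hYm] at hb
        exact hb (((hYm a).1 ha).tail this)
      have e3 : ∑ a ∈ Y, (ab a : ℤ) = 0 := by
        refine Finset.sum_eq_zero fun a ha => ?_
        have := hex a ((hYm a).1 ha)
        omega
      have e4 : 0 < ∑ a ∈ Y, supOf src (insert i I) a := by
        rw [sum_supOf]
        exact Finset.card_pos.2 ⟨i, by simp [hiY]⟩
      simp_rw [f5] at e1
      rw [Finset.sum_sub_distrib, e3] at e1
      zify at e4
      linarith

theorem flow_paths {ι : Type*} (H : SimpleGraph V) (κ : ℕ) (T : Finset V) (src : ι → V)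
    (I : Finset ι)
    (hcut : ∀ Y : Finset V, (I.filter (fun i => src i ∈ Y)).card ≤ cutc H Y + κ * (T ∩ Y).card) :
    ∃ (n : ι → ℕ) (g : ι → ℕ → V),
      (∀ i ∈ I, g i 0 = src i ∧ g i (n i) ∈ T ∧ (∀ k < n i, H.Adj (g i k) (g i (k + 1))) ∧
        (∀ j k, j ≤ n i → k ≤ n i → g i j = g i k → j = k)) ∧
      (∀ i ∈ I, ∀ i' ∈ I, i ≠ i' → ∀ k < n i, ∀ k' < n i',
        s(g i k, g i (k + 1)) ≠ s(g i' k', g i' (k' + 1))) ∧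
      (∀ x, (I.filter (fun i => g i (n i) = x)).card ≤ κ) := by
  obtain ⟨f, ab, hf⟩ := flow_exists H κ T src I hcut
  obtain ⟨n, g, h1, h2, h3⟩ := flow_decomp H κ T src I f ab hf
  obtain ⟨f1, f2, f3, f4, f5⟩ := hf
  refine ⟨n, g, ?_, h2, ?_⟩
  · intro i hi
    obtain ⟨k1, k2, k3⟩ := h1 i hi
    refine ⟨k1, ?_, ?_, k3⟩
    · by_contra hT
      have h4 := f4 (g i (n i))
      rw [if_neg hT] at h4
      have h5 := h3 (g i (n i))
      have h6 : 0 < (I.filter (fun j => g j (n j) = g i (n i))).card :=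
        Finset.card_pos.2 ⟨i, by simp [hi]⟩
      omega
    · intro k hk
      by_contra hn
      have := k2 k hk
      rw [f3 _ _ hn] at this
      omega
  · intro x
    have h4 := f4 x
    have h5 := h3 x
    split_ifs at h4 <;> omega
end P8
end TOI

namespace TOI
set_option linter.unusedVariables false
set_option linter.unusedSectionVars false
open SimpleGraph
section P9
open scoped Classical
variable {V : Type*} [Fintype V]

/-- states of the stable routing procedure -/
structure GS {ι ε E : Type*} [Fintype ι] (ℓ : ι → ℕ) (r : ι → ℕ → E) (EE : Finset ε)
    (S : ε → Set E) (en : ε → Bool → V) (rank : ε → Bool → E → ℕ) (κ : ℕ)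
    (n : ι → ℕ) (Act Ab : Finset ε) (hd : ε → Bool) : Prop where
  le : ∀ i, n i ≤ ℓ i
  actE : Act ⊆ EE
  abE : Ab ⊆ EE
  dis : ∀ e, e ∈ Act → e ∉ Ab
  i1 : ∀ i, ∀ m < n i, ∀ e ∈ EE, r i m ∈ S e → e ∈ Ab ∨ (e ∈ Act ∧ ∃ j, n j < ℓ j ∧
    r j (n j) ∈ S e ∧ rank e (hd e) (r j (n j)) < rank e (hd e) (r i m))
  i2 : ∀ e ∈ Act, ∃ j, n j < ℓ j ∧ r j (n j) ∈ S e
  i3 : ∀ w, (Act.filter (fun e => en e (hd e) = w)).card ≤ κ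
  i4 : ∀ e ∈ Ab, ∀ b, κ ≤ (Act.filter (fun e' => en e' (hd e') = en e b)).card

theorem gs_exists {ι ε E : Type*} [Fintype ι] (ℓ : ι → ℕ) (r : ι → ℕ → E) (EE : Finset ε)
    (S : ε → Set E) (en : ε → Bool → V) (rank : ε → Bool → E → ℕ) (κ : ℕ)
    (hr : ∀ i i' k k', k < ℓ i → k' < ℓ i' → r i k = r i' k' → i = i' ∧ k = k')
    (hS : ∀ e ∈ EE, ∀ e' ∈ EE, ∀ f, f ∈ S e → f ∈ S e' → e = e')
    (hrank : ∀ e ∈ EE, ∀ b, ∀ f ∈ S e, ∀ f' ∈ S e, rank e b f = rank e b f' → f = f') :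
    ∃ n Act Ab hd, GS ℓ r EE S en rank κ n Act Ab hd ∧
      (∀ j, n j < ℓ j → ∃ e ∈ Act, r j (n j) ∈ S e) ∧
      (∀ e ∈ Act, ∀ j j', n j < ℓ j → n j' < ℓ j' → r j (n j) ∈ S e → r j' (n j') ∈ S e →
        j = j') := by
  let P : ℕ → Prop := fun s => ∃ n Act Ab hd, GS ℓ r EE S en rank κ n Act Ab hd ∧
      s = ∑ i, n i + Act.card + Ab.card
  have hP0 : ∃ s, P s := by
    refine ⟨_, fun _ => 0, ∅, ∅, fun _ => true, ?_, rfl⟩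
    constructor <;> simp
  have hbd : ∀ s, P s → s ≤ ∑ i, ℓ i + EE.card + EE.card := by
    rintro s ⟨n, Act, Ab, hd, h, rfl⟩
    have h1 := Finset.sum_le_sum (fun i (_ : i ∈ (Finset.univ : Finset ι)) => h.le i)
    have h2 := Finset.card_le_card h.actE
    have h3 := Finset.card_le_card h.abE
    omega
  obtain ⟨s0, hs0⟩ := hP0
  have hmax := Nat.findGreatest_spec (P := P) (hbd s0 hs0) hs0
  have hmax2 : ∀ s, P s → s ≤ Nat.findGreatest P (∑ i, ℓ i + EE.card + EE.card) :=
    fun s hs => Nat.le_findGreatest (hbd s hs) hs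
  generalize Nat.findGreatest P (∑ i, ℓ i + EE.card + EE.card) = M at hmax hmax2
  obtain ⟨n, Act, Ab, hd, h, hM⟩ := hmax
  -- advancing is impossible
  have hadv : ∀ j, n j < ℓ j → ¬ GS ℓ r EE S en rank κ (Function.update n j (n j + 1)) Act Ab hd := by
    intro j hj h'
    have := hmax2 _ ⟨_, _, _, _, h', rfl⟩
    rw [Finset.sum_update_of_mem (Finset.mem_univ j)] at this
    have h2 := Finset.add_sum_erase Finset.univ n (Finset.mem_univ j)
    rw [Finset.sdiff_singleton_eq_erase] at this
    omega
  have hadv2 : ∀ j, n j < ℓ j →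
      (∀ e ∈ EE, r j (n j) ∈ S e → e ∈ Ab ∨ (e ∈ Act ∧ ∃ j', j' ≠ j ∧ n j' < ℓ j' ∧
        r j' (n j') ∈ S e ∧ rank e (hd e) (r j' (n j')) < rank e (hd e) (r j (n j)))) → False := by
    intro j hj hc
    apply hadv j hj
    have hup : ∀ e ∈ EE, ∀ j', n j' < ℓ j' → r j' (n j') ∈ S e → e ∈ Act →
        ∃ j'', j'' ≠ j ∧ n j'' < ℓ j'' ∧ r j'' (n j'') ∈ S e ∧
          rank e (hd e) (r j'' (n j'')) ≤ rank e (hd e) (r j' (n j')) := by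
      intro e he j' h1 h2 h3
      by_cases hjj : j' = j
      · subst hjj
        rcases hc e he h2 with h4 | ⟨_, j'', a, b, c, d⟩
        · exact absurd h4 (h.dis e h3)
        · exact ⟨j'', a, b, c, d.le⟩
      · exact ⟨j', hjj, h1, h2, le_rfl⟩
    refine ⟨?_, h.actE, h.abE, h.dis, ?_, ?_, h.i3, h.i4⟩
    · intro i
      by_cases hi : i = j
      · subst hi; simp; omega
      · simp [Function.update_of_ne hi, h.le i]
    · intro i m hm e he hre
      have key : e ∈ Ab ∨ (e ∈ Act ∧ ∃ j', j' ≠ j ∧ n j' < ℓ j' ∧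
        r j' (n j') ∈ S e ∧ rank e (hd e) (r j' (n j')) < rank e (hd e) (r i m)) := by
        by_cases hnew : i = j ∧ m = n j
        · obtain ⟨rfl, rfl⟩ := hnew
          exact hc e he hre
        · have hm' : m < n i := by
            by_cases hi : i = j
            · subst hi
              simp at hm hnew; omega
            · rwa [Function.update_of_ne hi] at hm
          rcases h.i1 i m hm' e he hre with h4 | ⟨h4, j', a, b, c⟩
          · exact Or.inl h4
          · obtain ⟨j'', a', b', c', d'⟩ := hup e he j' a b h4
            exact Or.inr ⟨h4, j'', a', b', c', lt_of_le_of_lt d' c⟩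
      rcases key with h4 | ⟨h4, j', a, b, c, d⟩
      · exact Or.inl h4
      · refine Or.inr ⟨h4, j', ?_⟩
        rw [Function.update_of_ne a]
        exact ⟨b, c, d⟩
    · intro e he
      obtain ⟨j', a, b⟩ := h.i2 e he
      obtain ⟨j'', a', b', c', d'⟩ := hup e (h.actE he) j' a b he
      refine ⟨j'', ?_⟩
      rw [Function.update_of_ne a']
      exact ⟨b', c'⟩
  refine ⟨n, Act, Ab, hd, h, ?_, ?_⟩
  · intro j hj
    by_contra hcon
    push Not at hcon
    have h1 : ¬ ∀ e ∈ EE, r j (n j) ∈ S e → e ∈ Ab := fun hh =>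
      hadv2 j hj (fun e he hre => Or.inl (hh e he hre))
    push Not at h1
    obtain ⟨e, he, hre, hab⟩ := h1
    have hact : e ∉ Act := fun hh => hcon e hh hre
    have hnt : ∀ i, ∀ m < n i, r i m ∉ S e := by
      intro i m hm hh
      rcases h.i1 i m hm e he hh with h4 | ⟨h4, _⟩
      · exact hab h4
      · exact hact h4
    by_cases hlow : ∃ b, (Act.filter (fun e' => en e' (hd e') = en e b)).card < κ
    · obtain ⟨b, hb⟩ := hlow
      have hfil : ∀ w, ((insert e Act).filter (fun e' => en e' (Function.update hd e b e') = w))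
          = if en e b = w then insert e (Act.filter (fun e' => en e' (hd e') = w))
            else Act.filter (fun e' => en e' (hd e') = w) := by
        intro w
        have hq : Act.filter (fun e' => en e' (Function.update hd e b e') = w)
            = Act.filter (fun e' => en e' (hd e') = w) := by
          apply Finset.filter_congr
          intro x hx
          rw [Function.update_of_ne (fun hh : x = e => hact (hh ▸ hx))]
        rw [Finset.filter_insert, hq]
        simp
      have : GS ℓ r EE S en rank κ n (insert e Act) Ab (Function.update hd e b) := by
        refine ⟨h.le, ?_, h.abE, ?_, ?_, ?_, ?_, ?_⟩
        · exact Finset.insert_subset he h.actE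
        · intro x hx
          rcases Finset.mem_insert.1 hx with hx | hx
          · rw [hx]; exact hab
          · exact h.dis x hx
        · intro i m hm e' he' hre'
          have hne : e' ≠ e := fun hh => hnt i m hm (hh ▸ hre')
          rw [Function.update_of_ne hne]
          rcases h.i1 i m hm e' he' hre' with h4 | ⟨h4, h5⟩
          · exact Or.inl h4
          · exact Or.inr ⟨Finset.mem_insert_of_mem h4, h5⟩
        · intro x hx
          rcases Finset.mem_insert.1 hx with hx | hx
          · rw [hx]; exact ⟨j, hj, hre⟩
          · exact h.i2 x hx
        · intro w
          rw [hfil]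
          split_ifs with hw
          · subst hw
            exact (Finset.card_insert_le _ _).trans hb
          · exact h.i3 w
        · intro x hx c
          refine (h.i4 x hx c).trans (Finset.card_le_card ?_)
          rw [hfil]
          split_ifs with hw
          · exact Finset.subset_insert _ _
          · exact subset_rfl
      have h3 := hmax2 _ ⟨_, _, _, _, this, rfl⟩
      rw [Finset.card_insert_of_notMem hact] at h3
      omega
    · push Not at hlow
      have : GS ℓ r EE S en rank κ n Act (insert e Ab) hd := by
        refine ⟨h.le, h.actE, Finset.insert_subset he h.abE, ?_, ?_, h.i2, h.i3, ?_⟩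
        · intro x hx hx'
          rcases Finset.mem_insert.1 hx' with hx' | hx'
          · exact hact (hx' ▸ hx)
          · exact h.dis x hx hx'
        · intro i m hm e' he' hre'
          rcases h.i1 i m hm e' he' hre' with h4 | h4
          · exact Or.inl (Finset.mem_insert_of_mem h4)
          · exact Or.inr h4
        · intro x hx c
          rcases Finset.mem_insert.1 hx with hx | hx
          · rw [hx]; exact hlow c
          · exact h.i4 x hx c
      have h3 := hmax2 _ ⟨_, _, _, _, this, rfl⟩
      rw [Finset.card_insert_of_notMem hab] at h3
      omega
  · intro e he j j' hj hj' hre hre'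
    by_contra hne
    have hE := h.actE he
    rcases lt_trichotomy (rank e (hd e) (r j (n j))) (rank e (hd e) (r j' (n j'))) with hl | hl | hl
    · apply hadv2 j' hj'
      intro e' he' hr'
      obtain rfl := hS e hE e' he' _ hre' hr'
      exact Or.inr ⟨he, j, hne, hj, hre, hl⟩
    · exact hne (hr _ _ _ _ hj hj' (hrank e hE _ _ hre _ hre' hl)).1
    · apply hadv2 j hj
      intro e' he' hr'
      obtain rfl := hS e hE e' he' _ hre hr'
      exact Or.inr ⟨he, j', fun hh => hne hh.symm, hj', hre', hl⟩

/-- turn a connecting edge set into a path with ranks from both ends -/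
lemma path_rank (S : Set (Sym2 V)) (a b : V) (h : (fromEdgeSet S).Reachable a b) :
    ∃ (S' : Set (Sym2 V)) (rank : Bool → Sym2 V → ℕ), S' ⊆ S ∧
      (fromEdgeSet S').Reachable a b ∧
      (∀ c, ∀ f ∈ S', ∀ f' ∈ S', rank c f = rank c f' → f = f') ∧
      (∀ c, ∀ f ∈ S', ∀ x ∈ f,
        (fromEdgeSet {f' | f' ∈ S' ∧ rank c f' ≤ rank c f}).Reachable x (if c then b else a)) := by
  obtain ⟨n, g, g0, gn, gs, gi⟩ := exists_rpath (fromEdgeSet S).Adj a b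
    ((reachable_iff_reflTransGen _ _).1 h)
  have hidx : ∀ f, ∃ k, (∃ k < n, f = s(g k, g (k+1))) → k < n ∧ f = s(g k, g (k+1)) := by
    intro f
    by_cases hf : ∃ k < n, f = s(g k, g (k+1))
    · obtain ⟨k, h1, h2⟩ := hf
      exact ⟨k, fun _ => ⟨h1, h2⟩⟩
    · exact ⟨0, fun h => absurd h hf⟩
  choose idx hidx using hidx
  have hidx2 : ∀ k < n, idx s(g k, g (k+1)) = k := by
    intro k hk
    obtain ⟨h1, h2⟩ := hidx _ ⟨k, hk, rfl⟩
    generalize idx s(g k, g (k+1)) = j at h1 h2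
    rcases Sym2.eq_iff.1 h2 with ⟨e1, e2⟩ | ⟨e1, e2⟩
    · exact (gi _ _ (by omega) (by omega) e1).symm
    · have := gi _ _ (by omega) (by omega) e1
      have := gi _ _ (by omega) (by omega) e2
      omega
  have hne : ∀ k < n, g k ≠ g (k+1) := fun k hk => (gs k hk).ne
  have hreach : ∀ (Q : Set (Sym2 V)) (i j : ℕ), i ≤ j → j ≤ n →
      (∀ k, i ≤ k → k < j → s(g k, g (k+1)) ∈ Q) → (fromEdgeSet Q).Reachable (g i) (g j) := by
    intro Q i j hij
    induction j, hij using Nat.le_induction with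
    | base => intro _ _; exact Reachable.refl _
    | succ j hij ih =>
      intro hj hQ
      refine (ih (by omega) (fun k h1 h2 => hQ k h1 (by omega))).trans (Adj.reachable ?_)
      rw [fromEdgeSet_adj]
      exact ⟨hQ j hij (by omega), hne j (by omega)⟩
  refine ⟨{f | ∃ k < n, f = s(g k, g (k+1))}, fun c f => if c then n - idx f else idx f,
    ?_, ?_, ?_, ?_⟩
  · rintro f ⟨k, hk, rfl⟩
    exact ((fromEdgeSet_adj _).1 (gs k hk)).1
  · have := hreach {f | ∃ k < n, f = s(g k, g (k+1))} 0 n (by omega) le_rfl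
      (fun k _ hk => ⟨k, hk, rfl⟩)
    rwa [g0, gn] at this
  · intro c f hf f' hf' hh
    obtain ⟨h1, h2⟩ := hidx f hf
    obtain ⟨h3, h4⟩ := hidx f' hf'
    have : idx f = idx f' := by
      cases c <;> simp at hh <;> omega
    rw [h2, h4, this]
  · rintro c f ⟨k, hk, rfl⟩ x hx
    beta_reduce
    rw [hidx2 k hk]
    cases c with
    | true =>
      simp only [if_true]
      have key : ∀ i, k ≤ i → i ≤ n → (fromEdgeSet {f' | (∃ k < n, f' = s(g k, g (k+1))) ∧
          n - idx f' ≤ n - k}).Reachable (g i) (g n) := by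
        intro i h1 h2
        apply hreach _ _ _ h2 le_rfl
        intro k' h3 h4
        refine ⟨⟨k', h4, rfl⟩, ?_⟩
        rw [hidx2 k' h4]; omega
      rw [gn] at key
      rcases Sym2.mem_iff.1 hx with rfl | rfl
      · exact key k le_rfl hk.le
      · exact key (k+1) (by omega) hk
    | false =>
      simp only [Bool.false_eq_true, if_false]
      have key : ∀ i, i ≤ k + 1 → (fromEdgeSet {f' | (∃ k < n, f' = s(g k, g (k+1))) ∧
          idx f' ≤ k}).Reachable (g i) (g 0) := by
        intro i h1
        refine (hreach _ _ _ (Nat.zero_le i) (by omega) ?_).symm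
        intro k' h3 h4
        refine ⟨⟨k', by omega, rfl⟩, ?_⟩
        rw [hidx2 k' (by omega)]; omega
      rw [g0] at key
      rcases Sym2.mem_iff.1 hx with rfl | rfl
      · exact key k (by omega)
      · exact key (k+1) le_rfl

end P9
end TOI

namespace TOI
set_option linter.unusedVariables false
set_option linter.unusedSectionVars false
open SimpleGraph
section P10
open scoped Classical
variable {V : Type*} [Fintype V]

theorem reroute {ι : Type*} [Fintype ι] (H : SimpleGraph V) (κ : ℕ) (hκ : 0 < κ) (T : Finset V)
    (src : ι → V) (hT : Imm (KOn T) H)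
    (hcut : ∀ Y : Finset V, (Finset.univ.filter (fun i => src i ∈ Y)).card
      ≤ cutc H Y + κ * (T ∩ Y).card) :
    ∃ (S : Sym2 V → Set (Sym2 V)) (D : ι → Set (Sym2 V)) (z : ι → V) (Tch : Finset (Sym2 V))
      (h : ℕ),
      (∀ e ∈ (KOn T).edgeSet, S e ⊆ H.edgeSet) ∧
      (∀ e ∈ (KOn T).edgeSet, ∀ e' ∈ (KOn T).edgeSet, e ≠ e' → Disjoint (S e) (S e')) ∧
      (∀ a b, (KOn T).Adj a b → (fromEdgeSet (S s(a,b))).Reachable a b) ∧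
      (∀ i, D i ⊆ H.edgeSet) ∧ (∀ i j, i ≠ j → Disjoint (D i) (D j)) ∧
      (∀ i, (fromEdgeSet (D i)).Reachable (src i) (z i)) ∧ (∀ i, z i ∈ T) ∧
      (∀ w, (Finset.univ.filter (fun i => z i = w)).card ≤ 2 * κ) ∧
      (∀ e ∈ (KOn T).edgeSet, e ∉ Tch → ∀ i, Disjoint (D i) (S e)) ∧
      Tch.card ≤ Fintype.card ι + h * h ∧ κ * h ≤ Fintype.card ι := by
  obtain ⟨ℓ, g, hg, hgd, hgk⟩ := flow_paths H κ T src Finset.univ hcut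
  obtain ⟨S0, hS0a, hS0b, hS0c⟩ := hT
  have hout : ∀ e : Sym2 V, e = s(e.out.1, e.out.2) := fun e => (Quot.out_eq e).symm
  have hpr : ∀ e : Sym2 V, ∃ (S' : Set (Sym2 V)) (rank : Bool → Sym2 V → ℕ),
      e ∈ (KOn T).edgeSet → S' ⊆ S0 e ∧
      (fromEdgeSet S').Reachable e.out.1 e.out.2 ∧
      (∀ c, ∀ f ∈ S', ∀ f' ∈ S', rank c f = rank c f' → f = f') ∧
      (∀ c, ∀ f ∈ S', ∀ x ∈ f,
        (fromEdgeSet {f' | f' ∈ S' ∧ rank c f' ≤ rank c f}).Reachable x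
          (if c then e.out.2 else e.out.1)) := by
    intro e
    by_cases he : e ∈ (KOn T).edgeSet
    · have h1 : (KOn T).Adj e.out.1 e.out.2 := by
        rw [hout e] at he
        exact he
      have h2 := hS0c _ _ h1
      rw [← hout e] at h2
      obtain ⟨S', rank, h3⟩ := path_rank _ _ _ h2
      exact ⟨S', rank, fun _ => h3⟩
    · exact ⟨∅, fun _ _ => 0, fun h => absurd h he⟩
  choose S rank hSr using hpr
  obtain ⟨EE, hEE⟩ : ∃ EE : Finset (Sym2 V), ∀ e, e ∈ EE ↔ e ∈ (KOn T).edgeSet :=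
    ⟨Finset.univ.filter (fun e => e ∈ (KOn T).edgeSet), fun e => by simp⟩
  have hSd : ∀ e ∈ (KOn T).edgeSet, ∀ e' ∈ (KOn T).edgeSet, e ≠ e' → Disjoint (S e) (S e') :=
    fun e he e' he' hne => (hS0b e he e' he' hne).mono (hSr e he).1 (hSr e' he').1
  have hSeq : ∀ e ∈ EE, ∀ e' ∈ EE, ∀ f, f ∈ S e → f ∈ S e' → e = e' := by
    intro e he e' he' f hf hf'
    by_contra hne
    exact Set.disjoint_left.1 (hSd e ((hEE e).1 he) e' ((hEE e').1 he') hne) hf hf'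
  have hr : ∀ i i' k k', k < ℓ i → k' < ℓ i' → s(g i k, g i (k+1)) = s(g i' k', g i' (k'+1)) →
      i = i' ∧ k = k' := by
    intro i i' k k' hk hk' heq
    by_cases hii : i = i'
    · subst hii
      refine ⟨rfl, ?_⟩
      have gi := (hg i (Finset.mem_univ i)).2.2.2
      rcases Sym2.eq_iff.1 heq with ⟨e1, e2⟩ | ⟨e1, e2⟩
      · exact gi _ _ (by omega) (by omega) e1
      · have := gi _ _ (by omega) (by omega) e1
        have := gi _ _ (by omega) (by omega) e2
        omega
    · exact absurd heq (hgd i (Finset.mem_univ i) i' (Finset.mem_univ i') hii k hk k' hk')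
  obtain ⟨n, Act, Ab, hd, hGS, hst, huniq⟩ := gs_exists ℓ (fun i k => s(g i k, g i (k+1))) EE S
    (fun e c => if c then e.out.2 else e.out.1) rank κ hr hSeq
    (fun e he => (hSr e ((hEE e).1 he)).2.2.1)
  -- the path of a stopped index
  have hpe : ∀ j, ∃ e, n j < ℓ j → e ∈ Act ∧ s(g j (n j), g j (n j + 1)) ∈ S e := by
    intro j
    by_cases hj : n j < ℓ j
    · obtain ⟨e, h1, h2⟩ := hst j hj
      exact ⟨e, fun _ => ⟨h1, h2⟩⟩
    · exact ⟨s(src j, src j), fun h => absurd h hj⟩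
  choose pe hpe using hpe
  have hEdge : ∀ e ∈ Act, e ∈ (KOn T).edgeSet := fun e he => (hEE e).1 (hGS.actE he)
  let U : ι → Set (Sym2 V) := fun j => {f | n j < ℓ j ∧ f ∈ S (pe j) ∧
    rank (pe j) (hd (pe j)) f ≤ rank (pe j) (hd (pe j)) s(g j (n j), g j (n j + 1))}
  let R : ι → Set (Sym2 V) := fun j => {f | ∃ m < n j, f = s(g j m, g j (m + 1))}
  let z : ι → V := fun j => if n j < ℓ j then
    (if hd (pe j) then (pe j).out.2 else (pe j).out.1) else g j (ℓ j)
  have hReach : ∀ i m, m ≤ n i → (fromEdgeSet (R i)).Reachable (g i 0) (g i m) := by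
    intro i m
    induction m with
    | zero => intro _; exact Reachable.refl _
    | succ m ih =>
      intro hm
      refine (ih (by omega)).trans (Adj.reachable ?_)
      rw [fromEdgeSet_adj]
      have := hGS.le i
      exact ⟨⟨m, by omega, rfl⟩, ((hg i (Finset.mem_univ i)).2.2.1 m (by omega)).ne⟩
  have hoT : ∀ e ∈ (KOn T).edgeSet, ∀ c : Bool, (if c then e.out.2 else e.out.1) ∈ T := by
    intro e he c
    rw [hout e] at he
    have h1 : (KOn T).Adj e.out.1 e.out.2 := he
    cases c
    · exact h1.1
    · exact h1.2.1
  have hRU : ∀ i j, Disjoint (R i) (U j) := by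
    intro i j
    rw [Set.disjoint_left]
    rintro f ⟨m, hm, rfl⟩ ⟨hj, h2, h3⟩
    obtain ⟨h4, h5⟩ := hpe j hj
    rcases hGS.i1 i m hm (pe j) (hGS.actE h4) h2 with h6 | ⟨_, j', h6, h7, h8⟩
    · exact hGS.dis _ h4 h6
    · have := huniq _ h4 j j' hj h6 h5 h7
      subst this
      exact absurd h8 (by simpa using h3)
  have hUU : ∀ i j, i ≠ j → Disjoint (U i) (U j) := by
    intro i j hij
    rw [Set.disjoint_left]
    rintro f ⟨hi, h2, h3⟩ ⟨hj, h5, h6⟩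
    have e1 := hpe i hi
    have e2 := hpe j hj
    have e3 := hSeq _ (hGS.actE e1.1) _ (hGS.actE e2.1) f h2 h5
    exact hij (huniq _ e1.1 i j hi hj e1.2 (e3 ▸ e2.2))
  have hRR : ∀ i j, i ≠ j → Disjoint (R i) (R j) := by
    intro i j hij
    rw [Set.disjoint_left]
    rintro f ⟨m, hm, rfl⟩ ⟨m', hm', h⟩
    have h1 := hGS.le i
    have h2 := hGS.le j
    exact hij (hr i j m m' (by omega) (by omega) h).1
  -- counting
  have hActcard : Act.card ≤ Fintype.card ι := by
    have hsub : Act ⊆ Finset.univ.image pe := by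
      intro e he
      obtain ⟨j, h1, h2⟩ := hGS.i2 e he
      refine Finset.mem_image.2 ⟨j, Finset.mem_univ _, ?_⟩
      exact hSeq _ (hGS.actE (hpe j h1).1) e (hGS.actE he) _ (hpe j h1).2 h2
    exact (Finset.card_le_card hsub).trans Finset.card_image_le
  let hh : V → ℕ := fun w =>
    (Act.filter (fun e => (if hd e then e.out.2 else e.out.1) = w)).card
  let W : Finset V := Finset.univ.filter (fun w => κ ≤ hh w)
  have hW : κ * W.card ≤ Fintype.card ι := by
    refine le_trans ?_ hActcard
    have h1 : Act.card = ∑ w, hh w :=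
      Finset.card_eq_sum_card_fiberwise (fun _ _ => Finset.mem_univ _)
    rw [h1]
    calc κ * W.card = ∑ w ∈ W, κ := by rw [Finset.sum_const, smul_eq_mul, mul_comm]
      _ ≤ ∑ w ∈ W, hh w := Finset.sum_le_sum (fun w hw => (Finset.mem_filter.1 hw).2)
      _ ≤ ∑ w, hh w := Finset.sum_le_sum_of_subset (Finset.subset_univ _)
  have hAb : Ab.card ≤ W.card * W.card := by
    rw [← Finset.card_product]
    apply Finset.card_le_card_of_injOn (fun e => (e.out.1, e.out.2))
    · intro e he
      have h1 := hGS.i4 e he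
      refine Finset.mem_coe.2 (Finset.mem_product.2 ⟨?_, ?_⟩)
      · exact Finset.mem_filter.2 ⟨Finset.mem_univ _, by simpa using h1 false⟩
      · exact Finset.mem_filter.2 ⟨Finset.mem_univ _, by simpa using h1 true⟩
    · intro e he e' he' heq
      simp only [Prod.mk.injEq] at heq
      rw [hout e, hout e', heq.1, heq.2]
  refine ⟨S, fun j => R j ∪ U j, z, Act ∪ Ab, W.card, ?_, hSd, ?_, ?_, ?_, ?_, ?_, ?_, ?_, ?_, hW⟩
  · intro e he
    exact (hSr e he).1.trans (hS0a e he)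
  · intro a b hab
    have h1 := (hSr s(a,b) hab).2.1
    rcases Sym2.eq_iff.1 (hout s(a,b)) with ⟨e1, e2⟩ | ⟨e1, e2⟩
    · rw [← e1, ← e2] at h1
      exact h1
    · rw [← e1, ← e2] at h1
      exact h1.symm
  · rintro i f (⟨m, hm, rfl⟩ | ⟨hi, h2, h3⟩)
    · have := hGS.le i
      exact (hg i (Finset.mem_univ i)).2.2.1 m (by omega)
    · have he := hEdge _ (hpe i hi).1
      exact hS0a _ he ((hSr _ he).1 h2)
  · intro i j hij
    simp only [Set.disjoint_union_left, Set.disjoint_union_right]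
    exact ⟨⟨hRR i j hij, (hRU j i).symm⟩, hRU i j, hUU i j hij⟩
  · intro i
    rw [← (hg i (Finset.mem_univ i)).1]
    have h1 := reach_mono (Set.subset_union_left (s := R i) (t := U i)) (hReach i (n i) le_rfl)
    refine h1.trans ?_
    by_cases hi : n i < ℓ i
    · simp only [z, hi, if_true]
      obtain ⟨h3, h4⟩ := hpe i hi
      have h5 := (hSr _ (hEdge _ h3)).2.2.2 (hd (pe i)) _ h4 (g i (n i)) (Sym2.mem_mk_left _ _)
      refine reach_mono ?_ h5
      rintro f ⟨h6, h7⟩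
      exact Or.inr ⟨hi, h6, h7⟩
    · simp only [z, hi, if_false]
      have : n i = ℓ i := le_antisymm (hGS.le i) (by omega)
      rw [this]
  · intro i
    by_cases hi : n i < ℓ i
    · simp only [z, hi, if_true]
      exact hoT _ (hEdge _ (hpe i hi).1) _
    · simp only [z, hi, if_false]
      exact (hg i (Finset.mem_univ i)).2.1
  · intro w
    have hsub : (Finset.univ.filter (fun i => z i = w)) ⊆
        (Finset.univ.filter (fun i => g i (ℓ i) = w)) ∪
        (Finset.univ.filter (fun i => n i < ℓ i ∧ z i = w)) := by
      intro i hi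
      simp only [Finset.mem_union, Finset.mem_filter, Finset.mem_univ, true_and] at hi ⊢
      by_cases hn : n i < ℓ i
      · exact Or.inr ⟨hn, hi⟩
      · simp only [z, hn, if_false] at hi
        exact Or.inl hi
    have h1 := (Finset.card_le_card hsub).trans (Finset.card_union_le _ _)
    have h2 := hgk w
    have h3 : (Finset.univ.filter (fun i => n i < ℓ i ∧ z i = w)).card ≤ κ := by
      refine le_trans ?_ (hGS.i3 w)
      apply Finset.card_le_card_of_injOn pe
      · intro i hi
        simp only [Finset.coe_filter, Finset.mem_univ, true_and, Set.mem_ofPred_eq] at hi ⊢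
        obtain ⟨hi1, hi2⟩ := hi
        simp only [z, hi1, if_true] at hi2
        exact ⟨(hpe i hi1).1, hi2⟩
      · intro i hi j hj heq
        simp only [Finset.coe_filter, Finset.mem_univ, true_and, Set.mem_ofPred_eq] at hi hj
        have e1 := hpe i hi.1
        have e2 := hpe j hj.1
        rw [← heq] at e2
        exact huniq _ e1.1 i j hi.1 hj.1 e1.2 e2.2
    omega
  · intro e he hnt i
    rw [Set.disjoint_left]
    rintro f (⟨m, hm, rfl⟩ | ⟨hi, h2, h3⟩) hfe
    · rcases hGS.i1 i m hm e ((hEE e).2 he) hfe with h4 | ⟨h4, _⟩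
      · exact hnt (Finset.mem_union_right _ h4)
      · exact hnt (Finset.mem_union_left _ h4)
    · have h4 := (hpe i hi).1
      have := hSeq _ (hGS.actE h4) e ((hEE e).2 he) f h2 hfe
      exact hnt (Finset.mem_union_left _ (this ▸ h4))
  · exact (Finset.card_union_le _ _).trans (Nat.add_le_add hActcard hAb)

end P10
end TOI

namespace TOI
set_option linter.unusedVariables false
set_option linter.unusedSectionVars false
open SimpleGraph
section P11
open scoped Classical
variable {V : Type*} [Fintype V]

theorem route {α : Type*} (T : Finset V) (A : V → V → Prop) (u v : α → V) (a Δ L M : ℕ)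
    (hL : 0 < L) (hT : 2 * a + 2 * Δ + 4 * L + M < T.card) (K : Finset α) :
    (∀ k ∈ K, (T.filter (fun w => ¬ A (u k) w)).card ≤ a ∧
      (T.filter (fun w => ¬ A (v k) w)).card ≤ a) →
    (∀ x, (K.filter (fun k => u k = x ∨ v k = x)).card ≤ Δ) →
    K.card ≤ L * M →
    ∃ w : α → V, (∀ k ∈ K, w k ∈ T ∧ A (u k) (w k) ∧ A (v k) (w k)) ∧
      (∀ k ∈ K, ∀ k' ∈ K, k ≠ k' → s(u k, w k) ≠ s(u k', w k') ∧ s(u k, w k) ≠ s(v k', w k') ∧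
        s(v k, w k) ≠ s(u k', w k') ∧ s(v k, w k) ≠ s(v k', w k')) ∧
      (∀ x, (K.filter (fun k => w k = x)).card ≤ L) := by
  induction K using Finset.induction_on with
  | empty =>
    intro _ _ _
    exact ⟨u, by simp, by simp, by simp⟩
  | insert k K hk ih =>
    intro h1 h2 h3
    obtain ⟨w0, e1, e2, e3⟩ := ih (fun j hj => h1 j (Finset.mem_insert_of_mem hj))
      (fun x => (Finset.card_le_card (Finset.filter_subset_filter _ (Finset.subset_insert _ _))).trans
        (h2 x)) ((Finset.card_le_card (Finset.subset_insert _ _)).trans h3)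
    have h2' : ∀ x, (K.filter (fun k => u k = x ∨ v k = x)).card ≤ Δ := fun x =>
      (Finset.card_le_card (Finset.filter_subset_filter _ (Finset.subset_insert _ _))).trans (h2 x)
    obtain ⟨O, hO⟩ : ∃ O : Finset V, ∀ x, x ∈ O ↔ L ≤ (K.filter (fun k => w0 k = x)).card :=
      ⟨Finset.univ.filter (fun x => L ≤ (K.filter (fun k => w0 k = x)).card), fun x => by simp⟩
    have hOc : O.card ≤ M := by
      have q1 : K.card = ∑ x, (K.filter (fun k => w0 k = x)).card :=
        Finset.card_eq_sum_card_fiberwise (fun _ _ => Finset.mem_univ _)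
      have q2 : L * O.card ≤ K.card := by
        rw [q1]
        calc L * O.card = ∑ x ∈ O, L := by rw [Finset.sum_const, smul_eq_mul, mul_comm]
          _ ≤ ∑ x ∈ O, (K.filter (fun k => w0 k = x)).card :=
            Finset.sum_le_sum (fun x hx => (hO x).1 hx)
          _ ≤ _ := Finset.sum_le_sum_of_subset (Finset.subset_univ _)
      have q3 : K.card ≤ (insert k K).card := Finset.card_le_card (Finset.subset_insert _ _)
      exact Nat.le_of_mul_le_mul_left (q2.trans (q3.trans h3)) hL
    let F1 := T.filter (fun w => ¬ A (u k) w)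
    let F2 := T.filter (fun w => ¬ A (v k) w)
    let F3 := (K.filter (fun j => u j = u k ∨ v j = u k)).image w0
    let F4 := (K.filter (fun j => u j = v k ∨ v j = v k)).image w0
    let F5 := (K.filter (fun j => w0 j = u k)).image u
    let F6 := (K.filter (fun j => w0 j = u k)).image v
    let F7 := (K.filter (fun j => w0 j = v k)).image u
    let F8 := (K.filter (fun j => w0 j = v k)).image v
    have hex : ∃ w ∈ T, w ∉ F1 ∪ F2 ∪ F3 ∪ F4 ∪ F5 ∪ F6 ∪ F7 ∪ F8 ∪ O := by
      apply Finset.exists_mem_notMem_of_card_lt_card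
      have c1 : F1.card ≤ a := (h1 k (Finset.mem_insert_self _ _)).1
      have c2 : F2.card ≤ a := (h1 k (Finset.mem_insert_self _ _)).2
      have c3 : F3.card ≤ Δ := Finset.card_image_le.trans (h2' _)
      have c4 : F4.card ≤ Δ := Finset.card_image_le.trans (h2' _)
      have c5 : F5.card ≤ L := Finset.card_image_le.trans (e3 _)
      have c6 : F6.card ≤ L := Finset.card_image_le.trans (e3 _)
      have c7 : F7.card ≤ L := Finset.card_image_le.trans (e3 _)
      have c8 : F8.card ≤ L := Finset.card_image_le.trans (e3 _)
      have d1 := Finset.card_union_le F1 F2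
      have d2 := Finset.card_union_le (F1 ∪ F2) F3
      have d3 := Finset.card_union_le (F1 ∪ F2 ∪ F3) F4
      have d4 := Finset.card_union_le (F1 ∪ F2 ∪ F3 ∪ F4) F5
      have d5 := Finset.card_union_le (F1 ∪ F2 ∪ F3 ∪ F4 ∪ F5) F6
      have d6 := Finset.card_union_le (F1 ∪ F2 ∪ F3 ∪ F4 ∪ F5 ∪ F6) F7
      have d7 := Finset.card_union_le (F1 ∪ F2 ∪ F3 ∪ F4 ∪ F5 ∪ F6 ∪ F7) F8
      have d8 := Finset.card_union_le (F1 ∪ F2 ∪ F3 ∪ F4 ∪ F5 ∪ F6 ∪ F7 ∪ F8) O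
      omega
    obtain ⟨w, hwT, hw⟩ := hex
    simp only [Finset.mem_union, not_or] at hw
    obtain ⟨⟨⟨⟨⟨⟨⟨⟨w1, w2⟩, w3⟩, w4⟩, w5⟩, w6⟩, w7⟩, w8⟩, w9⟩ := hw
    have hA1 : A (u k) w := by
      by_contra hc
      exact w1 (Finset.mem_filter.2 ⟨hwT, hc⟩)
    have hA2 : A (v k) w := by
      by_contra hc
      exact w2 (Finset.mem_filter.2 ⟨hwT, hc⟩)
    have hw9 : (K.filter (fun k => w0 k = w)).card < L := by
      by_contra hc
      exact w9 ((hO w).2 (by omega))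
    have hne : ∀ j ∈ K, j ≠ k := fun j hj h => hk (h ▸ hj)
    have key : ∀ j ∈ K, s(u k, w) ≠ s(u j, w0 j) ∧ s(u k, w) ≠ s(v j, w0 j) ∧
        s(v k, w) ≠ s(u j, w0 j) ∧ s(v k, w) ≠ s(v j, w0 j) := by
      intro j hj
      refine ⟨?_, ?_, ?_, ?_⟩ <;> intro heq <;> rcases Sym2.eq_iff.1 heq with ⟨p, q⟩ | ⟨p, q⟩
      · exact w3 (Finset.mem_image.2 ⟨j, Finset.mem_filter.2 ⟨hj, Or.inl p.symm⟩, q.symm⟩)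
      · exact w5 (Finset.mem_image.2 ⟨j, Finset.mem_filter.2 ⟨hj, p.symm⟩, q.symm⟩)
      · exact w3 (Finset.mem_image.2 ⟨j, Finset.mem_filter.2 ⟨hj, Or.inr p.symm⟩, q.symm⟩)
      · exact w6 (Finset.mem_image.2 ⟨j, Finset.mem_filter.2 ⟨hj, p.symm⟩, q.symm⟩)
      · exact w4 (Finset.mem_image.2 ⟨j, Finset.mem_filter.2 ⟨hj, Or.inl p.symm⟩, q.symm⟩)
      · exact w7 (Finset.mem_image.2 ⟨j, Finset.mem_filter.2 ⟨hj, p.symm⟩, q.symm⟩)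
      · exact w4 (Finset.mem_image.2 ⟨j, Finset.mem_filter.2 ⟨hj, Or.inr p.symm⟩, q.symm⟩)
      · exact w8 (Finset.mem_image.2 ⟨j, Finset.mem_filter.2 ⟨hj, p.symm⟩, q.symm⟩)
    have hup : ∀ j ∈ K, Function.update w0 k w j = w0 j := fun j hj =>
      Function.update_of_ne (hne j hj) _ _
    have hupk : Function.update w0 k w k = w := Function.update_self _ _ _
    refine ⟨Function.update w0 k w, ?_, ?_, ?_⟩
    · intro j hj
      rcases Finset.mem_insert.1 hj with hj | hj
      · subst hj
        rw [hupk]; exact ⟨hwT, hA1, hA2⟩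
      · rw [hup j hj]; exact e1 j hj
    · intro j hj j' hj' hjj
      rcases Finset.mem_insert.1 hj with hj | hj
      · rcases Finset.mem_insert.1 hj' with hj' | hj'
        · exact absurd (hj.trans hj'.symm) hjj
        · rw [hj, hupk, hup j' hj']
          exact key j' hj'
      · rcases Finset.mem_insert.1 hj' with hj' | hj'
        · rw [hj', hupk, hup j hj]
          obtain ⟨p, q, r, s⟩ := key j hj
          exact ⟨p.symm, r.symm, q.symm, s.symm⟩
        · rw [hup j hj, hup j' hj']
          exact e2 j hj j' hj' hjj
    · intro x
      have hq : K.filter (fun j => Function.update w0 k w j = x) = K.filter (fun j => w0 j = x) :=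
        Finset.filter_congr (fun j hj => by rw [hup j hj])
      rw [Finset.filter_insert, hq, hupk]
      split_ifs with hx
      · subst hx
        exact (Finset.card_insert_le _ _).trans hw9
      · exact e3 x

end P11
end TOI

namespace TOI
set_option linter.unusedVariables false
set_option linter.unusedSectionVars false
open SimpleGraph
section P12
open scoped Classical
variable {V : Type*} [Fintype V]

lemma walk_parity (H : SimpleGraph V) (side : V → Bool)
    (hside : ∀ x y, H.Adj x y → side x ≠ side y) {x y : V} (W : H.Walk x y) :
    Even W.length ↔ side x = side y := by
  induction W with
  | nil => simp
  | cons h W ih =>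
    rename_i a b c
    have := hside _ _ h
    rw [Walk.length_cons, Nat.even_add_one, ih]
    revert this
    cases side a <;> cases side b <;> cases side c <;> simp

lemma reach_trail (G H : SimpleGraph V) (hHG : H ≤ G) (side : V → Bool)
    (hside : ∀ x y, H.Adj x y → side x ≠ side y) (Q : Set (Sym2 V)) (hQ : Q ⊆ H.edgeSet)
    (x y : V) (h : (fromEdgeSet Q).Reachable x y) :
    ∃ W : G.Walk x y, W.IsTrail ∧ (∀ e ∈ W.edges, e ∈ Q) ∧ (Even W.length ↔ side x = side y) := by
  obtain ⟨W0⟩ := h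
  have hle : fromEdgeSet Q ≤ H := by
    intro a b hab
    exact hQ ((fromEdgeSet_adj _).1 hab).1
  let W1 := W0.toPath
  have hle2 : fromEdgeSet Q ≤ G := hle.trans hHG
  refine ⟨(W1 : (fromEdgeSet Q).Walk x y).mapLe hle2, ?_, ?_, ?_⟩
  · exact (Walk.isTrail_mapLe hle2).2 W1.2.isTrail
  · intro e he
    rw [Walk.edges_mapLe_eq_edges] at he
    have := Walk.edges_subset_edgeSet _ he
    rw [edgeSet_fromEdgeSet] at this
    exact this.1
  · rw [show ((W1 : (fromEdgeSet Q).Walk x y).mapLe hle2).length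
      = ((W1 : (fromEdgeSet Q).Walk x y).mapLe hle).length by simp [Walk.mapLe]]
    exact walk_parity H side hside _

lemma build_imm (G H : SimpleGraph V) (hHG : H ≤ G) (side : V → Bool)
    (hside : ∀ x y, H.Adj x y → side x ≠ side y) (t : ℕ) (A : Fin t ↪ V)
    (hA : ∀ a b, side (A a) = side (A b))
    (p q : Fin t × Fin t → V) (hpq : ∀ c, G.Adj (p c) (q c)) (hpqs : ∀ c, side (p c) = side (q c))
    (hinj : ∀ c c', s(p c, q c) = s(p c', q c') → c = c')
    (Q : Fin t × Fin t → Bool → Set (Sym2 V)) (hQ : ∀ c b, Q c b ⊆ H.edgeSet)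
    (hQd : ∀ c b c' b', (c, b) ≠ (c', b') → Disjoint (Q c b) (Q c' b'))
    (hQ1 : ∀ c, (fromEdgeSet (Q c false)).Reachable (A c.1) (p c))
    (hQ2 : ∀ c, (fromEdgeSet (Q c true)).Reachable (A c.2) (q c)) :
    HasTotallyOddImmersion G (⊤ : SimpleGraph (Fin t)) := by
  have hnH : ∀ c, s(p c, q c) ∉ H.edgeSet := fun c h => hside _ _ h (hpqs c)
  have hW : ∀ a b : Fin t, ∃ W : G.Walk (A a) (A b), W.IsTrail ∧ Odd W.length ∧
      ∀ e ∈ W.edges, e ∈ Q (a,b) false ∨ e = s(p (a,b), q (a,b)) ∨ e ∈ Q (a,b) true := by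
    intro a b
    obtain ⟨W1, h1, h2, h3⟩ := reach_trail G H hHG side hside _ (hQ (a,b) false) _ _ (hQ1 (a,b))
    obtain ⟨W2, k1, k2, k3⟩ := reach_trail G H hHG side hside _ (hQ (a,b) true) _ _ (hQ2 (a,b))
    have hd := Set.disjoint_left.1 (hQd (a,b) false (a,b) true (by simp))
    refine ⟨W1.append (Walk.cons (hpq (a,b)) W2.reverse), ?_, ?_, ?_⟩
    · rw [Walk.isTrail_def, Walk.edges_append, Walk.edges_cons, Walk.edges_reverse,
        List.nodup_append]
      refine ⟨h1.edges_nodup, ?_, ?_⟩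
      · rw [List.nodup_cons]
        refine ⟨?_, List.nodup_reverse.2 k1.edges_nodup⟩
        intro hh
        exact hnH (a,b) (hQ _ _ (k2 _ (List.mem_reverse.1 hh)))
      · intro e he e' he' hee
        subst hee
        rcases List.mem_cons.1 he' with h4 | h4
        · exact hnH (a,b) (h4 ▸ hQ _ _ (h2 _ he))
        · exact hd (h2 _ he) (k2 _ (List.mem_reverse.1 h4))
    · rw [Walk.length_append, Walk.length_cons, Walk.length_reverse]
      have e1 := hA a b
      have e2 := hpqs (a,b)
      simp only at h3 k3
      rw [e1, e2] at h3
      have : Even W1.length ↔ Even W2.length := h3.trans k3.symm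
      rw [← add_assoc, Nat.odd_add_one, Nat.not_odd_iff_even, Nat.even_add]
      exact this
    · intro e he
      rw [Walk.edges_append, Walk.edges_cons, Walk.edges_reverse, List.mem_append,
        List.mem_cons, List.mem_reverse] at he
      rcases he with he | he | he
      · exact Or.inl (h2 _ he)
      · exact Or.inr (Or.inl he)
      · exact Or.inr (Or.inr (k2 _ he))
  choose W hW1 hW2 hW3 using hW
  have hWd : ∀ a b a' b', (a,b) ≠ (a',b') → ∀ e ∈ (W a b).edges, e ∉ (W a' b').edges := by
    intro a b a' b' hne e he he'
    have hx : ∀ c d, ¬ (e ∈ Q (a,b) c ∧ e ∈ Q (a',b') d) := by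
      rintro c d ⟨x1, x2⟩
      exact Set.disjoint_left.1 (hQd (a,b) c (a',b') d (by
        intro hh; exact hne (Prod.mk.inj hh).1)) x1 x2
    rcases hW3 a b e he with h | h | h <;> rcases hW3 a' b' e he' with h' | h' | h'
    · exact hx _ _ ⟨h, h'⟩
    · exact hnH (a',b') (h' ▸ hQ _ _ h)
    · exact hx _ _ ⟨h, h'⟩
    · exact hnH (a,b) (h ▸ hQ _ _ h')
    · exact hne (hinj _ _ (h.symm.trans h'))
    · exact hnH (a,b) (h ▸ hQ _ _ h')
    · exact hx _ _ ⟨h, h'⟩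
    · exact hnH (a',b') (h' ▸ hQ _ _ h)
    · exact hx _ _ ⟨h, h'⟩
  let tr : ∀ u v : Fin t, G.Walk (A u) (A v) := fun u v =>
    if u < v then W u v else (W v u).reverse
  have htr : ∀ u v, (tr u v = W u v ∧ u < v) ∨ (tr u v = (W v u).reverse ∧ ¬ u < v) := by
    intro u v
    by_cases h : u < v
    · exact Or.inl ⟨by simp [tr, h], h⟩
    · exact Or.inr ⟨by simp [tr, h], h⟩
  refine ⟨⟨A, fun u v _ => tr u v, ?_, ?_, ?_⟩, ?_⟩
  · intro u v h
    rcases htr u v with ⟨h1, _⟩ | ⟨h1, _⟩ <;> rw [h1]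
    · exact hW1 u v
    · exact (hW1 v u).reverse
  · intro u v h
    have hne : u ≠ v := h.ne
    rcases htr u v with ⟨h1, h2⟩ | ⟨h1, h2⟩ <;> rcases htr v u with ⟨h3, h4⟩ | ⟨h3, h4⟩
    · exact absurd h4 h2.asymm
    · rw [h1, h3]
    · rw [h1, h3, Walk.reverse_reverse]
    · exact absurd (le_antisymm (not_lt.1 h4) (not_lt.1 h2)) hne
  · intro u v a b h1 h2 hne e he he'
    have hne' : ∀ {u v a b : Fin t}, s(u,v) ≠ s(a,b) → (u,v) ≠ (a,b) := by
      intro u v a b h h'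
      obtain ⟨rfl, rfl⟩ := Prod.mk.inj h'
      exact h rfl
    rcases htr u v with ⟨e1, _⟩ | ⟨e1, _⟩ <;> rcases htr a b with ⟨e2, _⟩ | ⟨e2, _⟩ <;>
      rw [e1] at he <;> rw [e2] at he' <;>
      try simp only [Walk.edges_reverse, List.mem_reverse] at he he'
    · exact hWd u v a b (hne' hne) e he he'
    · exact hWd u v b a (hne' (by rwa [Sym2.eq_swap (a := b)])) e he he'
    · exact hWd v u a b (hne' (by rwa [Sym2.eq_swap (a := v)])) e he he'
    · exact hWd v u b a (hne' (by rwa [Sym2.eq_swap (a := v), Sym2.eq_swap (a := b)])) e he he'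
  · intro u v h
    simp only
    rcases htr u v with ⟨h1, _⟩ | ⟨h1, _⟩ <;> rw [h1]
    · exact hW2 u v
    · rw [Walk.length_reverse]; exact hW2 v u

end P12
end TOI

namespace TOI
set_option linter.unusedVariables false
set_option linter.unusedSectionVars false
open SimpleGraph
section P13
open scoped Classical
variable {V : Type*} [Fintype V]

theorem assemble {ι : Type*} [Fintype ι] (G H : SimpleGraph V) (hHG : H ≤ G) (side : V → Bool)
    (hside : ∀ x y, H.Adj x y → side x ≠ side y) (t N : ℕ) (hN : 1 ≤ N) (htN : t ≤ N)
    (T : Finset V) (hTc : T.card = 320 * N) (hTs : ∀ x ∈ T, ∀ y ∈ T, side x = side y)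
    (hT : Imm (KOn T) H) (p q : ι → V) (hpq : ∀ i, G.Adj (p i) (q i))
    (hpqs : ∀ i, side (p i) = side (q i)) (hinj : ∀ i j, s(p i, q i) = s(p j, q j) → i = j)
    (hι : Fintype.card ι = 3 * (N * N))
    (hcut : ∀ Y : Finset V, (Finset.univ.filter
      (fun i : ι × Bool => (if i.2 then q i.1 else p i.1) ∈ Y)).card
      ≤ cutc H Y + (5 * N) * (T ∩ Y).card) :
    HasTotallyOddImmersion G (⊤ : SimpleGraph (Fin t)) := by
  obtain ⟨S, D, z, Tch, h, hS1, hS2, hS3, hD1, hD2, hD3, hzT, hzc, hDS, hTch, hh⟩ :=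
    reroute H (5 * N) (by omega) T (fun i : ι × Bool => (if i.2 then q i.1 else p i.1)) hT hcut
  have hcard : Fintype.card (ι × Bool) = 6 * (N * N) := by
    rw [Fintype.card_prod, hι, Fintype.card_bool]; ring
  rw [hcard] at hTch hh
  have hh2 : 5 * h ≤ 6 * N := by
    have : N * (5 * h) ≤ N * (6 * N) := by nlinarith
    exact Nat.le_of_mul_le_mul_left this (by omega)
  have hTch2 : 25 * Tch.card ≤ 186 * (N * N) := by nlinarith
  -- touched degree
  obtain ⟨deg, hdeg⟩ : ∃ deg : V → ℕ, ∀ x, deg x = (Tch.filter (fun e => x ∈ e)).card :=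
    ⟨_, fun _ => rfl⟩
  have hdegsum : ∑ x, deg x ≤ 2 * Tch.card := by
    have h1 : ∑ x, deg x = ∑ e ∈ Tch, (Finset.univ.filter (fun x => x ∈ e)).card := by
      simp only [hdeg]
      simp only [Finset.card_filter]
      rw [Finset.sum_comm]
    rw [h1]
    have h2 : ∀ e ∈ Tch, (Finset.univ.filter (fun x => x ∈ e)).card ≤ 2 := by
      intro e _
      induction e using Sym2.ind with
      | _ a b =>
        have : Finset.univ.filter (fun x => x ∈ s(a,b)) ⊆ {a, b} := by
          intro x hx
          simpa using hx
        exact (Finset.card_le_card this).trans Finset.card_le_two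
    calc _ ≤ ∑ e ∈ Tch, 2 := Finset.sum_le_sum h2
      _ = _ := by rw [Finset.sum_const, smul_eq_mul, mul_comm]
  obtain ⟨Bad, hBad⟩ : ∃ B : Finset V, ∀ x, x ∈ B ↔ 100 * N ≤ deg x :=
    ⟨Finset.univ.filter (fun x => 100 * N ≤ deg x), fun x => by simp⟩
  have hBc : 100 * N * Bad.card ≤ 2 * Tch.card := by
    refine le_trans ?_ hdegsum
    calc 100 * N * Bad.card = ∑ x ∈ Bad, 100 * N := by
            rw [Finset.sum_const, smul_eq_mul, mul_comm]
      _ ≤ ∑ x ∈ Bad, deg x := Finset.sum_le_sum (fun x hx => (hBad x).1 hx)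
      _ ≤ _ := Finset.sum_le_sum_of_subset (Finset.subset_univ _)
  have hBc2 : 5 * Bad.card ≤ N := by
    have : N * (2500 * Bad.card) ≤ N * (372 * N) := by nlinarith
    have := Nat.le_of_mul_le_mul_left this (by omega)
    omega
  -- branch vertices
  have hA : ∃ A : Fin t ↪ V, ∀ a, A a ∈ T \ Bad := by
    have h1 : t ≤ (T \ Bad).card := by
      have := Finset.le_card_sdiff Bad T
      omega
    obtain ⟨A0, hA0⟩ := Finset.exists_subset_card_eq h1
    let e := A0.equivFinOfCardEq hA0.2
    exact ⟨e.symm.toEmbedding.trans (Function.Embedding.subtype _), fun a =>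
      hA0.1 (e.symm a).2⟩
  obtain ⟨A, hA⟩ := hA
  -- good breakers
  obtain ⟨BB, hBB⟩ : ∃ B : Finset ι, ∀ i, i ∈ B ↔ ∃ b, z (i, b) ∈ Bad :=
    ⟨Finset.univ.filter (fun i => ∃ b, z (i, b) ∈ Bad), fun x => by simp⟩
  have hBBc : BB.card ≤ 2 * (N * N) := by
    have h1 : BB ⊆ (Finset.univ.filter (fun i : ι × Bool => z i ∈ Bad)).image Prod.fst := by
      intro i hi
      obtain ⟨b, hb⟩ := (hBB i).1 hi
      exact Finset.mem_image.2 ⟨(i, b), Finset.mem_filter.2 ⟨Finset.mem_univ _, hb⟩, rfl⟩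
    have h2 := (Finset.card_le_card h1).trans Finset.card_image_le
    have h3 : (Finset.univ.filter (fun i : ι × Bool => z i ∈ Bad)).card ≤ 2 * (5 * N) * Bad.card := by
      have h5 : Set.MapsTo z (Finset.univ.filter (fun i : ι × Bool => z i ∈ Bad)) Bad :=
        fun i hi => Finset.mem_coe.2 (Finset.mem_filter.1 (Finset.mem_coe.1 hi)).2
      rw [Finset.card_eq_sum_card_fiberwise h5]
      calc _ ≤ ∑ w ∈ Bad, 2 * (5 * N) := by
            refine Finset.sum_le_sum (fun w hw => le_trans (Finset.card_le_card ?_) (hzc w))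
            exact Finset.filter_subset_filter _ (Finset.subset_univ _)
        _ = _ := by rw [Finset.sum_const, smul_eq_mul, mul_comm]
    nlinarith
  have hβ : ∃ β : Fin t × Fin t → ι, Function.Injective β ∧ ∀ c b, z (β c, b) ∉ Bad := by
    have h1 : Fintype.card (Fin t × Fin t) ≤ Fintype.card {i // i ∉ BB} := by
      rw [Fintype.card_subtype_compl, Fintype.card_prod, Fintype.card_fin, hι,
        Fintype.card_coe]
      have : t * t ≤ N * N := Nat.mul_le_mul htN htN
      omega
    obtain ⟨f⟩ := Function.Embedding.nonempty_of_card_le h1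
    refine ⟨fun c => (f c).1, fun c c' hc => f.injective (Subtype.ext hc), ?_⟩
    intro c b hb
    exact (f c).2 ((hBB _).2 ⟨b, hb⟩)
  obtain ⟨β, hβi, hβg⟩ := hβ
  obtain ⟨AA, hAA⟩ : ∃ AA : V → V → Prop, ∀ x w, AA x w ↔ w ≠ x ∧ s(x, w) ∉ Tch :=
    ⟨_, fun _ _ => Iff.rfl⟩
  have hfew : ∀ x, x ∉ Bad → (T.filter (fun w => ¬ AA x w)).card ≤ 100 * N := by
    intro x hx
    have h1 : deg x < 100 * N := by
      by_contra hc
      exact hx ((hBad x).2 (by omega))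
    have h2 : T.filter (fun w => ¬ AA x w) ⊆ insert x
        (Finset.univ.filter (fun w => s(x,w) ∈ Tch)) := by
      intro w hw
      have := (Finset.mem_filter.1 hw).2
      rw [hAA] at this
      rw [Finset.mem_insert, Finset.mem_filter]
      by_cases hwx : w = x
      · exact Or.inl hwx
      · refine Or.inr ⟨Finset.mem_univ _, ?_⟩
        by_contra hc
        exact this ⟨hwx, hc⟩
    have h3 : (Finset.univ.filter (fun w => s(x,w) ∈ Tch)).card ≤ deg x := by
      rw [hdeg]
      apply Finset.card_le_card_of_injOn (fun w => s(x,w))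
      · intro w hw
        have := (Finset.mem_filter.1 (Finset.mem_coe.1 hw)).2
        exact Finset.mem_coe.2 (Finset.mem_filter.2 ⟨this, Sym2.mem_mk_left _ _⟩)
      · intro w _ w' _ hww
        exact Sym2.congr_right.1 hww
    have h4 := (Finset.card_le_card h2).trans (Finset.card_insert_le _ _)
    omega
  obtain ⟨u, hu⟩ : ∃ u : (Fin t × Fin t) × Bool → V, ∀ c b, u (c, b) = A (if b then c.2 else c.1) :=
    ⟨fun k => A (if k.2 then k.1.2 else k.1.1), fun _ _ => rfl⟩
  obtain ⟨v, hv⟩ : ∃ v : (Fin t × Fin t) × Bool → V, ∀ c b, v (c, b) = z (β c, b) :=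
    ⟨fun k => z (β k.1, k.2), fun _ _ => rfl⟩
  have huT : ∀ k, u k ∈ T \ Bad := by
    rintro ⟨c, b⟩
    rw [hu]; exact hA _
  have hvT : ∀ k, v k ∈ T \ Bad := by
    rintro ⟨c, b⟩
    rw [hv]; exact Finset.mem_sdiff.2 ⟨hzT _, hβg _ _⟩
  obtain ⟨w, hw1, hw2, -⟩ := route T AA u v (100 * N) (12 * N) N (2 * N) (by omega) (by omega)
    Finset.univ
    (fun k _ => ⟨hfew _ (Finset.mem_sdiff.1 (huT k)).2, hfew _ (Finset.mem_sdiff.1 (hvT k)).2⟩)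
    (by
      intro x
      rw [Finset.filter_or]
      refine (Finset.card_union_le _ _).trans ?_
      have h1 : (Finset.univ.filter (fun k => v k = x)).card ≤ 2 * (5 * N) := by
        refine le_trans ?_ (hzc x)
        apply Finset.card_le_card_of_injOn (fun k => (β k.1, k.2))
        · rintro ⟨c, b⟩ hk
          have := (Finset.mem_filter.1 (Finset.mem_coe.1 hk)).2
          rw [hv] at this
          exact Finset.mem_coe.2 (Finset.mem_filter.2 ⟨Finset.mem_univ _, this⟩)
        · rintro ⟨c, b⟩ _ ⟨c', b'⟩ _ hk
          simp only [Prod.mk.injEq] at hk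
          rw [hβi hk.1, hk.2]
      have h2 : (Finset.univ.filter (fun k => u k = x)).card ≤ 2 * t := by
        have : 2 * t = (Finset.univ : Finset (Bool × Fin t)).card := by
          rw [Finset.card_univ, Fintype.card_prod, Fintype.card_bool, Fintype.card_fin]
        rw [this]
        apply Finset.card_le_card_of_injOn (fun k => (k.2, if k.2 then k.1.1 else k.1.2))
          (fun _ _ => Finset.mem_coe.2 (Finset.mem_univ _))
        rintro ⟨⟨a, a2⟩, b⟩ hk ⟨⟨a', a2'⟩, b'⟩ hk' heq
        have e1 := (Finset.mem_filter.1 (Finset.mem_coe.1 hk)).2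
        have e2 := (Finset.mem_filter.1 (Finset.mem_coe.1 hk')).2
        rw [hu] at e1 e2
        have e3 := A.injective (e1.trans e2.symm)
        simp only [Prod.mk.injEq] at heq
        obtain ⟨rfl, e4⟩ := heq
        cases b <;> simp_all
      omega)
    (by
      rw [Finset.card_univ, Fintype.card_prod, Fintype.card_prod, Fintype.card_bool,
        Fintype.card_fin]
      have : t * t ≤ N * N := Nat.mul_le_mul htN htN
      nlinarith)
  have hKu : ∀ k, s(u k, w k) ∈ (KOn T).edgeSet ∧ s(u k, w k) ∉ Tch := by
    intro k
    obtain ⟨a, b, c⟩ := hw1 k (Finset.mem_univ k)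
    rw [hAA] at b
    exact ⟨⟨(Finset.mem_sdiff.1 (huT k)).1, a, b.1.symm⟩, b.2⟩
  have hKv : ∀ k, s(v k, w k) ∈ (KOn T).edgeSet ∧ s(v k, w k) ∉ Tch := by
    intro k
    obtain ⟨a, b, c⟩ := hw1 k (Finset.mem_univ k)
    rw [hAA] at c
    exact ⟨⟨(Finset.mem_sdiff.1 (hvT k)).1, a, c.1.symm⟩, c.2⟩
  have hreach : ∀ c b, (fromEdgeSet (D (β c, b) ∪ S s(u (c,b), w (c,b)) ∪ S s(v (c,b), w (c,b)))).Reachable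
      (u (c,b)) (if b then q (β c) else p (β c)) := by
    intro c b
    have r1 : (fromEdgeSet (S s(u (c,b), w (c,b)))).Reachable (u (c,b)) (w (c,b)) :=
      hS3 _ _ (hKu (c,b)).1
    have r2 : (fromEdgeSet (S s(v (c,b), w (c,b)))).Reachable (v (c,b)) (w (c,b)) :=
      hS3 _ _ (hKv (c,b)).1
    have r3 := hD3 (β c, b)
    rw [← hv c b] at r3
    refine (reach_mono ?_ r1).trans ((reach_mono ?_ r2.symm).trans (reach_mono ?_ r3.symm))
    · exact fun f hf => Or.inl (Or.inr hf)
    · exact fun f hf => Or.inr hf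
    · exact fun f hf => Or.inl (Or.inl hf)
  refine build_imm G H hHG side hside t A ?_ (fun c => p (β c)) (fun c => q (β c))
    (fun c => hpq _) (fun c => hpqs _) (fun c c' hc => hβi (hinj _ _ hc))
    (fun c b => D (β c, b) ∪ S s(u (c,b), w (c,b)) ∪ S s(v (c,b), w (c,b))) ?_ ?_ ?_ ?_
  · intro a b
    exact hTs _ (Finset.mem_sdiff.1 (hA a)).1 _ (Finset.mem_sdiff.1 (hA b)).1
  · rintro c b f ((hf | hf) | hf)
    · exact hD1 _ hf
    · exact hS1 _ (hKu _).1 hf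
    · exact hS1 _ (hKv _).1 hf
  · intro c b c' b' hne
    have hne2 : (β c, b) ≠ (β c', b') := by
      intro hh
      rw [Prod.mk.injEq] at hh
      exact hne (by rw [hβi hh.1, hh.2])
    obtain ⟨n1, n2, n3, n4⟩ := hw2 (c,b) (Finset.mem_univ _) (c',b') (Finset.mem_univ _) hne
    simp only [Set.disjoint_union_left, Set.disjoint_union_right]
    refine ⟨⟨⟨⟨?_, ?_⟩, ?_⟩, ⟨?_, ?_⟩, ?_⟩, ⟨?_, ?_⟩, ?_⟩
    all_goals first
      | exact hD2 _ _ hne2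
      | exact hDS _ (hKu _).1 (hKu _).2 _
      | exact hDS _ (hKv _).1 (hKv _).2 _
      | exact (hDS _ (hKu _).1 (hKu _).2 _).symm
      | exact (hDS _ (hKv _).1 (hKv _).2 _).symm
      | exact hS2 _ (hKu _).1 _ (hKu _).1 n1
      | exact hS2 _ (hKu _).1 _ (hKv _).1 n2
      | exact hS2 _ (hKv _).1 _ (hKu _).1 n3
      | exact hS2 _ (hKv _).1 _ (hKv _).1 n4
  · intro c
    have := hreach c false
    have e : u (c, false) = A c.1 := by rw [hu]; rfl
    generalize u (c, false) = uu at e this ⊢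
    subst e
    exact this
  · intro c
    have := hreach c true
    have e : u (c, true) = A c.2 := by rw [hu]; rfl
    generalize u (c, true) = uu at e this ⊢
    subst e
    exact this

end P13
end TOI

namespace TOI
set_option linter.unusedVariables false
set_option linter.unusedSectionVars false
open SimpleGraph
section P14
open scoped Classical
variable {V : Type*} [Fintype V]

/-- number of ordered edges from A to B -/
noncomputable def ec (G : SimpleGraph V) (A B : Finset V) : ℕ := ∑ a ∈ A, (B.filter (G.Adj a)).card

lemma ec_comm (G : SimpleGraph V) (A B : Finset V) : ec G A B = ec G B A := by
  unfold ec
  simp only [Finset.card_filter]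
  rw [Finset.sum_comm]
  refine Finset.sum_congr rfl (fun b _ => Finset.sum_congr rfl (fun a _ => ?_))
  simp only [G.adj_comm a b]

lemma ec_union_left (G : SimpleGraph V) (A B C : Finset V) (h : Disjoint A B) :
    ec G (A ∪ B) C = ec G A C + ec G B C := by
  unfold ec
  rw [Finset.sum_union h]

lemma ec_union_right (G : SimpleGraph V) (A B C : Finset V) (h : Disjoint A B) :
    ec G C (A ∪ B) = ec G C A + ec G C B := by
  rw [ec_comm, ec_union_left _ _ _ _ h, ec_comm G A, ec_comm G B]

lemma ec_le_cutc (G : SimpleGraph V) (A B Y : Finset V) (h1 : ∀ x ∈ A, x ∈ Y) (h2 : ∀ x ∈ B, x ∉ Y) :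
    ec G A B ≤ cutc G Y := by
  have : ec G A B = ((A ×ˢ B).filter (fun e => G.Adj e.1 e.2)).card := by
    unfold ec
    simp only [Finset.card_filter]
    rw [Finset.sum_product]
  rw [this]
  unfold cutc
  apply Finset.card_le_card
  intro e he
  simp only [Finset.mem_filter, Finset.mem_product, Finset.mem_univ, true_and] at he ⊢
  exact ⟨h1 _ he.1.1, h2 _ he.1.2, he.2⟩

/-- critical subset: no subset can be recoloured with two half palettes -/
theorem critical (G : SimpleGraph V) (h D : ℕ) (hD : 0 < D) (hDh : D ≤ h)
    (hcol : ¬ G.Colorable (2 * h)) :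
    ∃ X0 : Finset V, X0.Nonempty ∧ ∀ (U : Finset V) (side : V → Bool), U ⊆ X0 → U.Nonempty →
      ¬ ∀ u ∈ U, ((X0.filter (G.Adj u)).filter (fun v => v ∉ U ∨ side v = side u)).card < D := by
  obtain ⟨Col, hCol⟩ : ∃ Col : Finset V → Prop, ∀ Y, Col Y ↔ ∃ c : V → ℕ, (∀ x, c x < 2 * h) ∧
    ∀ x ∈ Y, ∀ y ∈ Y, G.Adj x y → c x ≠ c y := ⟨_, fun _ => Iff.rfl⟩
  have huniv : ¬ Col Finset.univ := by
    rw [hCol]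
    rintro ⟨c, h1, h2⟩
    apply hcol
    exact ⟨Coloring.mk (fun x => (⟨c x, h1 x⟩ : Fin (2*h))) (fun {a b} hab => by
      intro hh
      exact h2 a (Finset.mem_univ _) b (Finset.mem_univ _) hab (Fin.mk.inj hh))⟩
  obtain ⟨X0, hX0, hmin⟩ : ∃ X0 : Finset V, ¬ Col X0 ∧ ∀ Y, Y ⊂ X0 → Col Y := by
    obtain ⟨X0, hX⟩ := Finset.exists_minimal (s := Finset.univ.filter (fun Y => ¬ Col Y))
      ⟨Finset.univ, by simpa using huniv⟩
    refine ⟨X0, by simpa using hX.1, fun Y hY => ?_⟩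
    by_contra hc
    exact hY.2 (hX.2 (by simpa using hc) hY.1)
  have hempty : Col ∅ := by
    rw [hCol]
    exact ⟨fun _ => 0, fun _ => by show 0 < 2 * h; omega, by simp⟩
  refine ⟨X0, ?_, ?_⟩
  · by_contra hne
    rw [Finset.not_nonempty_iff_eq_empty] at hne
    exact hX0 (hne ▸ hempty)
  intro U side hU hUne hlow
  apply hX0
  have hstep : ∀ U' : Finset V, U' ⊆ U → ∃ c : V → ℕ, (∀ x, c x < 2 * h) ∧
      (∀ x ∈ (X0 \ U) ∪ U', ∀ y ∈ (X0 \ U) ∪ U', G.Adj x y → c x ≠ c y) ∧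
      (∀ x ∈ U', (c x < h ↔ side x = true)) := by
    intro U'
    induction U' using Finset.induction_on with
    | empty =>
      intro _
      have : Col (X0 \ U) := hmin _ (by
        refine ⟨Finset.sdiff_subset, fun hh => ?_⟩
        obtain ⟨u, hu⟩ := hUne
        exact (Finset.mem_sdiff.1 (hh (hU hu))).2 hu)
      rw [hCol] at this
      obtain ⟨c, h1, h2⟩ := this
      exact ⟨c, h1, by simpa using h2, by simp⟩
    | insert u U' huU ih =>
      intro hsub
      obtain ⟨c, c1, c2, c3⟩ := ih (fun x hx => hsub (Finset.mem_insert_of_mem hx))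
      have hu : u ∈ U := hsub (Finset.mem_insert_self _ _)
      let base := if side u then 0 else h
      let N := (X0.filter (G.Adj u)).filter (fun v => v ∉ U ∨ side v = side u)
      have hex : ∃ k ∈ Finset.Ico base (base + h), k ∉ N.image c := by
        apply Finset.exists_mem_notMem_of_card_lt_card
        rw [Nat.card_Ico]
        have := hlow u hu
        have h2 : (N.image c).card ≤ N.card := Finset.card_image_le
        have h3 : N.card < D := this
        omega
      obtain ⟨k, hk1, hk2⟩ := hex
      rw [Finset.mem_Ico] at hk1
      have hk3 : k < 2 * h := by
        simp only [base] at hk1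
        split_ifs at hk1 <;> omega
      have hk4 : k < h ↔ side u = true := by
        simp only [base] at hk1
        split_ifs at hk1 with hs
        · simp [hs]; omega
        · simp [hs]; omega
      have key : ∀ y ∈ (X0 \ U) ∪ U', G.Adj u y → c y ≠ k := by
        intro y hy hadj heq
        have hyX : y ∈ X0 := by
          rcases Finset.mem_union.1 hy with hy | hy
          · exact (Finset.mem_sdiff.1 hy).1
          · exact hU (hsub (Finset.mem_insert_of_mem hy))
        have hyN : y ∉ N := fun hh => hk2 (Finset.mem_image.2 ⟨y, hh, heq⟩)
        simp only [N, Finset.mem_filter, hyX, hadj, true_and, not_or, not_not] at hyN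
        have hyU' : y ∈ U' := by
          rcases Finset.mem_union.1 hy with hy | hy
          · exact absurd hyN.1 (Finset.mem_sdiff.1 hy).2
          · exact hy
        have h5 := c3 y hyU'
        rw [heq, hk4] at h5
        apply hyN.2
        cases hsy : side y <;> cases hsu : side u <;> simp_all
      have hne : ∀ y ∈ (X0 \ U) ∪ U', y ≠ u := by
        intro y hy hh
        subst hh
        rcases Finset.mem_union.1 hy with hy | hy
        · exact (Finset.mem_sdiff.1 hy).2 hu
        · exact huU hy
      have hmem : ∀ y, y ∈ (X0 \ U) ∪ insert u U' → y = u ∨ y ∈ (X0 \ U) ∪ U' := by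
        intro y hy
        simp only [Finset.mem_union, Finset.mem_insert] at hy ⊢
        tauto
      refine ⟨Function.update c u k, ?_, ?_, ?_⟩
      · intro x
        by_cases hx : x = u
        · subst hx; simpa using hk3
        · simpa [Function.update_of_ne hx] using c1 x
      · intro x hx y hy hadj
        rcases hmem x hx with hx | hx' <;> rcases hmem y hy with hy | hy'
        · subst hx; subst hy; exact absurd hadj (G.loopless.irrefl _)
        · subst hx
          rw [Function.update_self, Function.update_of_ne (hne y hy')]
          exact (key y hy' hadj).symm
        · subst hy
          rw [Function.update_self, Function.update_of_ne (hne x hx')]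
          exact key x hx' hadj.symm
        · rw [Function.update_of_ne (hne x hx'), Function.update_of_ne (hne y hy')]
          exact c2 x hx' y hy' hadj
      · intro x hx
        rcases Finset.mem_insert.1 hx with hx | hx
        · subst hx
          rw [Function.update_self]; exact hk4
        · rw [Function.update_of_ne (hne x (Finset.mem_union_right _ hx))]
          exact c3 x hx
  obtain ⟨c, c1, c2, -⟩ := hstep U subset_rfl
  rw [Finset.sdiff_union_of_subset hU] at c2
  rw [hCol]
  exact ⟨c, c1, c2⟩

/-- maximum cut -/
theorem max_cut (G : SimpleGraph V) (X : Finset V) :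
    ∃ (side : V → Bool) (H : SimpleGraph V),
      (∀ x y, H.Adj x y ↔ G.Adj x y ∧ x ∈ X ∧ y ∈ X ∧ side x ≠ side y) ∧
      ∀ Y ⊆ X, ec G Y (X \ Y) ≤ 2 * ec H Y (X \ Y) := by
  obtain ⟨Hs, hHs⟩ : ∃ Hs : (V → Bool) → SimpleGraph V, ∀ side x y, (Hs side).Adj x y ↔
      G.Adj x y ∧ x ∈ X ∧ y ∈ X ∧ side x ≠ side y :=
    ⟨fun side =>
      { Adj := fun x y => G.Adj x y ∧ x ∈ X ∧ y ∈ X ∧ side x ≠ side y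
        symm := ⟨fun x y h => ⟨h.1.symm, h.2.2.1, h.2.1, h.2.2.2.symm⟩⟩
        loopless := ⟨fun x h => h.2.2.2 rfl⟩ }, fun _ _ _ => Iff.rfl⟩
  obtain ⟨side, hmax⟩ := Finite.exists_max (fun s => ec (Hs s) X X)
  refine ⟨side, Hs side, hHs side, ?_⟩
  intro Y hY
  have hdis : Disjoint Y (X \ Y) := Finset.disjoint_sdiff
  have hX : Y ∪ (X \ Y) = X := Finset.union_sdiff_of_subset hY
  have hexp : ∀ s, ec (Hs s) X X = ec (Hs s) Y Y + ec (Hs s) (X \ Y) (X \ Y)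
      + 2 * ec (Hs s) Y (X \ Y) := by
    intro s
    have h1 : ec (Hs s) (Y ∪ (X \ Y)) (Y ∪ (X \ Y)) = ec (Hs s) Y Y + ec (Hs s) (X \ Y) (X \ Y)
      + 2 * ec (Hs s) Y (X \ Y) := by
      rw [ec_union_left _ _ _ _ hdis, ec_union_right _ _ _ _ hdis, ec_union_right _ _ _ _ hdis,
        ec_comm _ (X \ Y) Y]
      ring
    rwa [hX] at h1
  let s' : V → Bool := fun x => if x ∈ Y then !(side x) else side x
  have h1 := hmax s'
  rw [hexp, hexp] at h1
  have e1 : ec (Hs s') Y Y = ec (Hs side) Y Y := by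
    unfold ec
    refine Finset.sum_congr rfl (fun a ha => congrArg Finset.card (Finset.filter_congr (fun b hb => ?_)))
    simp only [hHs, s', ha, hb, if_true]
    cases side a <;> cases side b <;> simp
  have e2 : ec (Hs s') (X \ Y) (X \ Y) = ec (Hs side) (X \ Y) (X \ Y) := by
    unfold ec
    refine Finset.sum_congr rfl (fun a ha => congrArg Finset.card (Finset.filter_congr (fun b hb => ?_)))
    simp only [hHs, s', (Finset.mem_sdiff.1 ha).2, (Finset.mem_sdiff.1 hb).2, if_false]
  have e3 : ec G Y (X \ Y) ≤ ec (Hs s') Y (X \ Y) + ec (Hs side) Y (X \ Y) := by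
    unfold ec
    rw [← Finset.sum_add_distrib]
    refine Finset.sum_le_sum (fun a ha => ?_)
    refine le_trans (Finset.card_le_card ?_) (Finset.card_union_le _ _)
    intro b hb
    rw [Finset.mem_filter] at hb
    rw [Finset.mem_union, Finset.mem_filter, Finset.mem_filter, hHs, hHs]
    have hbX := (Finset.mem_sdiff.1 hb.1).1
    have hbY := (Finset.mem_sdiff.1 hb.1).2
    by_cases hs : side a = side b
    · refine Or.inl ⟨hb.1, hb.2, hY ha, hbX, ?_⟩
      simp only [s', ha, hbY, if_true, if_false, hs]
      cases side b <;> simp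
    · exact Or.inr ⟨hb.1, hb.2, hY ha, hbX, hs⟩
  omega

end P14
end TOI

namespace TOI
set_option linter.unusedVariables false
set_option linter.unusedSectionVars false
open SimpleGraph
section P15
open scoped Classical
variable {V : Type*} [Fintype V]

lemma ec_small (G : SimpleGraph V) (d : ℕ) (X0 A : Finset V) (hA : A ⊆ X0)
    (hdeg : ∀ u ∈ X0, d ≤ (X0.filter (G.Adj u)).card) :
    d * A.card ≤ ec G A (X0 \ A) + A.card * A.card := by
  have h1 : ec G A X0 = ec G A A + ec G A (X0 \ A) := by
    rw [← ec_union_right _ _ _ _ Finset.disjoint_sdiff, Finset.union_sdiff_of_subset hA]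
  have h2 : d * A.card ≤ ec G A X0 := by
    unfold ec
    calc d * A.card = ∑ a ∈ A, d := by rw [Finset.sum_const, smul_eq_mul, mul_comm]
      _ ≤ _ := Finset.sum_le_sum (fun a ha => hdeg a (hA ha))
  have h3 : ec G A A ≤ A.card * A.card := by
    unfold ec
    calc _ ≤ ∑ a ∈ A, A.card := Finset.sum_le_sum (fun a ha => Finset.card_filter_le _ _)
      _ = _ := by rw [Finset.sum_const, smul_eq_mul]
  omega

theorem connected_core (G : SimpleGraph V) (N : ℕ) (hN : 1 ≤ N) (X0 : Finset V)
    (hne : X0.Nonempty) (hdeg : ∀ u ∈ X0, 350000 * N ≤ (X0.filter (G.Adj u)).card) :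
    ∃ X ⊆ X0, N < X.card ∧ ec G X (X0 \ X) ≤ 24 * (N * N) ∧
      ∀ Y ⊆ X, Y.Nonempty → (X \ Y).Nonempty →
        (Y.card ≤ N → 349999 * N * Y.card ≤ 2 * ec G Y (X \ Y)) ∧
        (N < Y.card → N < (X \ Y).card → 12 * (N * N) ≤ ec G Y (X \ Y)) := by
  obtain ⟨P, hP⟩ : ∃ P : Finset V → Prop, ∀ X, P X ↔ X ⊆ X0 ∧ N < X.card ∧
    ec G X (X0 \ X) ≤ 24 * (N * N) := ⟨_, fun _ => Iff.rfl⟩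
  have hP0 : P X0 := by
    rw [hP]
    refine ⟨subset_rfl, ?_, ?_⟩
    · obtain ⟨u, hu⟩ := hne
      have := (hdeg u hu).trans (Finset.card_filter_le _ _)
      omega
    · simp [ec]
  obtain ⟨X, hX, hmin⟩ : ∃ X, P X ∧ ∀ Y, Y ⊂ X → ¬ P Y := by
    obtain ⟨X, hX⟩ := Finset.exists_minimal (s := Finset.univ.filter P) ⟨X0, by simpa using hP0⟩
    refine ⟨X, by simpa using hX.1, fun Y hY hc => ?_⟩
    exact hY.2 (hX.2 (by simpa using hc) hY.1)
  rw [hP] at hX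
  obtain ⟨hXs, hXc, hXe⟩ := hX
  have hX2 : 2 * N < X.card := by
    by_contra hc
    have h1 := ec_small G _ X0 X hXs hdeg
    have h2 : X.card * X.card ≤ 2 * N * X.card := Nat.mul_le_mul_right _ (by omega)
    have h3 : N * N < N * X.card := Nat.mul_lt_mul_of_pos_left hXc (by omega)
    nlinarith
  refine ⟨X, hXs, hXc, hXe, ?_⟩
  intro Y hY hYn hZn
  have hZ : X \ Y ⊆ X := Finset.sdiff_subset
  have hYss : Y ⊂ X := ⟨hY, fun hh => by
    obtain ⟨z, hz⟩ := hZn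
    exact (Finset.mem_sdiff.1 hz).2 (hh (Finset.mem_sdiff.1 hz).1)⟩
  have hZss : X \ Y ⊂ X := ⟨hZ, fun hh => by
    obtain ⟨z, hz⟩ := hYn
    exact (Finset.mem_sdiff.1 (hh (hY hz))).2 hz⟩
  have hcardZ : (X \ Y).card = X.card - Y.card := Finset.card_sdiff_of_subset hY
  have hYX : Y.card ≤ X.card := Finset.card_le_card hY
  -- decompositions
  have d1 : ec G X (X0 \ X) = ec G Y (X0 \ X) + ec G (X \ Y) (X0 \ X) := by
    rw [← ec_union_left _ _ _ _ Finset.disjoint_sdiff, Finset.union_sdiff_of_subset hY]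
  have d2 : ec G Y (X0 \ Y) = ec G Y (X \ Y) + ec G Y (X0 \ X) := by
    rw [← ec_union_right]
    · congr 1
      ext x
      simp only [Finset.mem_union, Finset.mem_sdiff]
      constructor
      · rintro ⟨a, b⟩
        by_cases hx : x ∈ X
        · exact Or.inl ⟨hx, b⟩
        · exact Or.inr ⟨a, hx⟩
      · rintro (⟨a, b⟩ | ⟨a, b⟩)
        · exact ⟨hXs a, b⟩
        · exact ⟨a, fun hh => b (hY hh)⟩
    · rw [Finset.disjoint_left]
      intro x hx hx'
      exact (Finset.mem_sdiff.1 hx').2 (Finset.mem_sdiff.1 hx).1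
  have d3 : ec G (X \ Y) (X0 \ (X \ Y)) = ec G Y (X \ Y) + ec G (X \ Y) (X0 \ X) := by
    rw [ec_comm G Y, ← ec_union_right]
    · congr 1
      ext x
      simp only [Finset.mem_union, Finset.mem_sdiff, not_and, not_not]
      constructor
      · rintro ⟨a, b⟩
        by_cases hx : x ∈ X
        · exact Or.inl (b hx)
        · exact Or.inr ⟨a, hx⟩
      · rintro (a | ⟨a, b⟩)
        · exact ⟨hXs (hY a), fun _ => a⟩
        · exact ⟨a, fun hh => absurd hh b⟩
    · rw [Finset.disjoint_left]
      intro x hx hx'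
      exact (Finset.mem_sdiff.1 hx').2 (hY hx)
  have mY := hmin Y hYss
  have mZ := hmin _ hZss
  rw [hP] at mY mZ
  constructor
  · intro hYN
    have h1 := ec_small G _ X0 Y (hY.trans hXs) hdeg
    have h2 : Y.card * Y.card ≤ N * Y.card := Nat.mul_le_mul_right _ hYN
    have h3 : 24 * (N * N) < ec G (X \ Y) (X0 \ (X \ Y)) := by
      by_contra hc
      exact mZ ⟨hZ.trans hXs, by omega, by omega⟩
    have h4 : 350000 * N * Y.card = 349999 * N * Y.card + N * Y.card := by ring
    omega
  · intro hYN hZN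
    have h3 : 24 * (N * N) < ec G (X \ Y) (X0 \ (X \ Y)) := by
      by_contra hc
      exact mZ ⟨hZ.trans hXs, hZN, by omega⟩
    have h4 : 24 * (N * N) < ec G Y (X0 \ Y) := by
      by_contra hc
      exact mY ⟨hY.trans hXs, hYN, by omega⟩
    omega

/-- many breakers of bounded degree -/
theorem breakers (G : SimpleGraph V) (N : ℕ) (hN : 1 ≤ N) (X0 X : Finset V)
    (hcrit : ∀ (U : Finset V) (side : V → Bool), U ⊆ X0 → U.Nonempty →
      ¬ ∀ u ∈ U, ((X0.filter (G.Adj u)).filter (fun v => v ∉ U ∨ side v = side u)).card < 350000 * N)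
    (hdeg : ∀ u ∈ X0, 350000 * N ≤ (X0.filter (G.Adj u)).card)
    (hXs : X ⊆ X0) (hXc : N < X.card) (hXe : ec G X (X0 \ X) ≤ 24 * (N * N)) (side : V → Bool) :
    ∃ F : Finset (Sym2 V), F.card = 3 * (N * N) ∧
      (∀ x y, s(x,y) ∈ F → G.Adj x y ∧ x ∈ X ∧ y ∈ X ∧ side x = side y) ∧
      ∀ x, (F.filter (fun e => x ∈ e)).card ≤ N := by
  obtain ⟨P, hP⟩ : ∃ P : Finset (Sym2 V) → Prop, ∀ F, P F ↔ F.card ≤ 3 * (N * N) ∧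
      (∀ x y, s(x,y) ∈ F → G.Adj x y ∧ x ∈ X ∧ y ∈ X ∧ side x = side y) ∧
      ∀ x, (F.filter (fun e => x ∈ e)).card ≤ N := ⟨_, fun _ => Iff.rfl⟩
  obtain ⟨F, hF, hmax⟩ : ∃ F, P F ∧ ∀ F', F ⊂ F' → ¬ P F' := by
    obtain ⟨X, hX⟩ := Finset.exists_maximal (s := Finset.univ.filter P) ⟨∅, by simp [hP]⟩
    refine ⟨X, by simpa using hX.1, fun Y hY hc => ?_⟩
    exact hY.2 (hX.2 (by simpa using hc) hY.1)
  rw [hP] at hF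
  obtain ⟨f1, f2, f3⟩ := hF
  by_contra hcon
  have hlt : F.card < 3 * (N * N) := lt_of_le_of_ne f1 (fun hh => hcon ⟨F, hh, f2, f3⟩)
  obtain ⟨deg, hdg⟩ : ∃ deg : V → ℕ, ∀ x, deg x = (F.filter (fun e => x ∈ e)).card :=
    ⟨_, fun _ => rfl⟩
  have hdegsum : ∑ x, deg x ≤ 2 * F.card := by
    have h1 : ∑ x, deg x = ∑ e ∈ F, (Finset.univ.filter (fun x => x ∈ e)).card := by
      simp only [hdg]
      simp only [Finset.card_filter]
      rw [Finset.sum_comm]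
    rw [h1]
    have h2 : ∀ e ∈ F, (Finset.univ.filter (fun x => x ∈ e)).card ≤ 2 := by
      intro e _
      induction e using Sym2.ind with
      | _ a b =>
        have : Finset.univ.filter (fun x => x ∈ s(a,b)) ⊆ {a, b} := by
          intro x hx
          simpa using hx
        exact (Finset.card_le_card this).trans Finset.card_le_two
    calc _ ≤ ∑ e ∈ F, 2 := Finset.sum_le_sum h2
      _ = _ := by rw [Finset.sum_const, smul_eq_mul, mul_comm]
  obtain ⟨S0, hS0⟩ : ∃ B : Finset V, ∀ x, x ∈ B ↔ N ≤ deg x :=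
    ⟨Finset.univ.filter (fun x => N ≤ deg x), fun x => by simp⟩
  have hS0c : S0.card ≤ 6 * N := by
    have h1 : N * S0.card ≤ 2 * F.card := by
      refine le_trans ?_ hdegsum
      calc N * S0.card = ∑ x ∈ S0, N := by
              rw [Finset.sum_const, smul_eq_mul, mul_comm]
        _ ≤ ∑ x ∈ S0, deg x := Finset.sum_le_sum (fun x hx => (hS0 x).1 hx)
        _ ≤ _ := Finset.sum_le_sum_of_subset (Finset.subset_univ _)
    have : N * S0.card ≤ N * (6 * N) := by nlinarith
    exact Nat.le_of_mul_le_mul_left this (by omega)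
  have hcover : ∀ x y, G.Adj x y → x ∈ X → y ∈ X → side x = side y → x ∉ S0 → y ∉ S0 →
      s(x,y) ∈ F := by
    intro x y hxy hx hy hs hxS hyS
    by_contra hnF
    apply hmax (insert s(x,y) F) (Finset.ssubset_insert hnF)
    rw [hS0] at hxS hyS
    rw [hP]
    refine ⟨?_, ?_, ?_⟩
    · have := Finset.card_insert_le s(x,y) F
      omega
    · intro a b hab
      rcases Finset.mem_insert.1 hab with hab | hab
      · rcases Sym2.eq_iff.1 hab with ⟨rfl, rfl⟩ | ⟨rfl, rfl⟩
        · exact ⟨hxy, hx, hy, hs⟩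
        · exact ⟨hxy.symm, hy, hx, hs.symm⟩
      · exact f2 a b hab
    · intro a
      rw [Finset.filter_insert]
      split_ifs with ha
      · refine (Finset.card_insert_le _ _).trans ?_
        rw [← hdg]
        rcases Sym2.mem_iff.1 ha with ha | ha <;> rw [ha] <;> omega
      · exact f3 a
  obtain ⟨High, hHigh⟩ : ∃ B : Finset V, ∀ x, x ∈ B ↔ x ∈ X ∧
      175000 * N ≤ ((X0 \ X).filter (G.Adj x)).card :=
    ⟨X.filter (fun x => 175000 * N ≤ ((X0 \ X).filter (G.Adj x)).card), fun x => by simp⟩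
  have hHc : High.card ≤ N := by
    have h1 : 175000 * N * High.card ≤ ec G X (X0 \ X) := by
      unfold ec
      calc 175000 * N * High.card = ∑ x ∈ High, 175000 * N := by
              rw [Finset.sum_const, smul_eq_mul, mul_comm]
        _ ≤ ∑ x ∈ High, ((X0 \ X).filter (G.Adj x)).card :=
          Finset.sum_le_sum (fun x hx => ((hHigh x).1 hx).2)
        _ ≤ _ := Finset.sum_le_sum_of_subset (fun x hx => ((hHigh x).1 hx).1)
    have : N * High.card ≤ N * N := by nlinarith
    exact Nat.le_of_mul_le_mul_left this (by omega)
  have hin : ∀ x ∈ X, (X0.filter (G.Adj x)).card =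
      (X.filter (G.Adj x)).card + ((X0 \ X).filter (G.Adj x)).card := by
    intro x hx
    rw [← Finset.card_union_of_disjoint, ← Finset.filter_union, Finset.union_sdiff_of_subset hXs]
    exact Finset.disjoint_filter_filter Finset.disjoint_sdiff
  have hXbig : 175000 * N ≤ X.card := by
    obtain ⟨x, hx, hxH⟩ := Finset.exists_mem_notMem_of_card_lt_card (lt_of_le_of_lt hHc hXc)
    rw [hHigh] at hxH
    have h1 : ((X0 \ X).filter (G.Adj x)).card < 175000 * N := by
      by_contra hc
      exact hxH ⟨hx, by omega⟩
    have h2 := hin x hx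
    have h3 := hdeg x (hXs hx)
    have h4 := Finset.card_filter_le X (G.Adj x)
    omega
  have hUne : (X \ (S0 ∪ High)).Nonempty := by
    rw [← Finset.card_pos]
    have h1 := Finset.le_card_sdiff (S0 ∪ High) X
    have h2 := Finset.card_union_le S0 High
    omega
  apply hcrit (X \ (S0 ∪ High)) side (Finset.sdiff_subset.trans hXs) hUne
  intro u hu
  rw [Finset.mem_sdiff, Finset.mem_union, not_or] at hu
  obtain ⟨huX, huS, huH⟩ := hu
  have hsub : ((X0.filter (G.Adj u)).filter
      (fun v => v ∉ X \ (S0 ∪ High) ∨ side v = side u)) ⊆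
      ((X0 \ X).filter (G.Adj u)) ∪ (S0 ∪ High) ∪ (Finset.univ.filter (fun v => s(u,v) ∈ F)) := by
    intro v hv
    simp only [Finset.mem_filter, Finset.mem_union, Finset.mem_sdiff, not_and, not_not,
      not_or, Finset.mem_univ, true_and] at hv ⊢
    obtain ⟨⟨v1, v2⟩, v3⟩ := hv
    by_cases hvX : v ∈ X
    · by_cases hvS : v ∈ S0
      · exact Or.inl (Or.inr (Or.inl hvS))
      · by_cases hvH : v ∈ High
        · exact Or.inl (Or.inr (Or.inr hvH))
        · rcases v3 with v3 | v3
          · exact absurd (v3 hvX hvS) hvH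
          · exact Or.inr (hcover u v v2 huX hvX v3.symm huS hvS)
    · exact Or.inl (Or.inl ⟨⟨v1, hvX⟩, v2⟩)
  have h1 : (Finset.univ.filter (fun v => s(u,v) ∈ F)).card ≤ N := by
    refine le_trans ?_ (f3 u)
    apply Finset.card_le_card_of_injOn (fun w => s(u,w))
    · intro w hw
      have := (Finset.mem_filter.1 (Finset.mem_coe.1 hw)).2
      exact Finset.mem_coe.2 (Finset.mem_filter.2 ⟨this, Sym2.mem_mk_left _ _⟩)
    · intro w _ w' _ hww
      exact Sym2.congr_right.1 hww
  have h2 : ((X0 \ X).filter (G.Adj u)).card < 175000 * N := by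
    by_contra hc
    exact huH ((hHigh u).2 ⟨huX, by omega⟩)
  have h3 := Finset.card_le_card hsub
  have h4 := Finset.card_union_le (((X0 \ X).filter (G.Adj u)) ∪ (S0 ∪ High))
    (Finset.univ.filter (fun v => s(u,v) ∈ F))
  have h5 := Finset.card_union_le ((X0 \ X).filter (G.Adj u)) (S0 ∪ High)
  have h6 := Finset.card_union_le S0 High
  omega

end P15
end TOI

namespace TOI
set_option linter.unusedVariables false
set_option linter.unusedSectionVars false
open SimpleGraph
section P16
open scoped Classical
variable {V : Type*} [Fintype V]

theorem main_contra (G : SimpleGraph V) (t : ℕ) (ht : 1 ≤ t)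
    (hcol : ¬ G.Colorable (2 * (350000 * t + 16000000))) :
    HasTotallyOddImmersion G (⊤ : SimpleGraph (Fin t)) := by
  obtain ⟨N, hNt⟩ : ∃ N, N = t + 45 := ⟨_, rfl⟩
  have hN : 1 ≤ N := by omega
  obtain ⟨X0, hX0, hcrit⟩ := critical G (350000 * t + 16000000) (350000 * N) (by omega) (by omega) hcol
  have hdeg : ∀ u ∈ X0, 350000 * N ≤ (X0.filter (G.Adj u)).card := by
    intro u hu
    by_contra hc
    apply hcrit {u} (fun _ => true) (by simpa using hu) (by simp)
    intro x hx
    rw [Finset.mem_singleton] at hx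
    subst hx
    exact lt_of_le_of_lt (Finset.card_filter_le _ _) (by omega)
  obtain ⟨X, hXs, hXc, hXe, hXcut⟩ := connected_core G N hN X0 hX0 hdeg
  obtain ⟨side, H, hH, hHcut⟩ := max_cut G X
  obtain ⟨F, hFc, hF, hFdeg⟩ := breakers G N hN X0 X hcrit hdeg hXs hXc hXe side
  have hHG : H ≤ G := fun x y h => ((hH x y).1 h).1
  have hside : ∀ x y, H.Adj x y → side x ≠ side y := fun x y h => ((hH x y).1 h).2.2.2
  have hcutS : ∀ Y ⊆ X, Y.Nonempty → (X \ Y).Nonempty → Y.card ≤ N →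
      87499 * N * Y.card ≤ ec H Y (X \ Y) := by
    intro Y hY h1 h2 h3
    have a1 := (hXcut Y hY h1 h2).1 h3
    have a2 := hHcut Y hY
    have a3 : 4 * (87499 * N * Y.card) ≤ 349999 * N * Y.card := by nlinarith [Nat.zero_le (N * Y.card)]
    omega
  have hXpos : X.Nonempty := Finset.card_pos.1 (by omega)
  obtain ⟨x0, hx0⟩ := hXpos
  have hmin : ∀ x ∈ X, 87499 * N ≤ (nb H x).card := by
    intro x hx
    have h1 := hcutS {x} (by simpa using hx) (by simp) (by
      rw [← Finset.card_pos]
      have := Finset.le_card_sdiff {x} X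
      rw [Finset.card_singleton] at this
      omega) (by simpa using hN)
    rw [Finset.card_singleton, mul_one] at h1
    refine h1.trans ?_
    unfold ec
    rw [Finset.sum_singleton]
    apply Finset.card_le_card
    intro y hy
    rw [mem_nb]
    exact (Finset.mem_filter.1 hy).2
  obtain ⟨B, hBc, hBi⟩ : HasK (640 * N) H := by
    apply descent (640 * N) (87499 * N) (by omega) (by omega) X.card X H x0 le_rfl hx0
    · intro x y h
      exact ((hH x y).1 h).2.1
    · intro x hx _
      exact hmin x hx
    · exact (hmin x0 hx0).trans (Nat.le_succ _)
  -- one side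
  have hT : ∃ T ⊆ B, T.card = 320 * N ∧ ∀ x ∈ T, ∀ y ∈ T, side x = side y := by
    have h1 := Finset.card_filter_add_card_filter_not (s := B) (fun x => side x = true)
    by_cases h2 : 320 * N ≤ (B.filter (fun x => side x = true)).card
    · obtain ⟨T, hT1, hT2⟩ := Finset.exists_subset_card_eq h2
      refine ⟨T, fun x hx => (Finset.mem_filter.1 (hT1 hx)).1, hT2, fun x hx y hy => ?_⟩
      rw [(Finset.mem_filter.1 (hT1 hx)).2, (Finset.mem_filter.1 (hT1 hy)).2]
    · have h3 : 320 * N ≤ (B.filter (fun x => ¬ side x = true)).card := by omega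
      obtain ⟨T, hT1, hT2⟩ := Finset.exists_subset_card_eq h3
      refine ⟨T, fun x hx => (Finset.mem_filter.1 (hT1 hx)).1, hT2, fun x hx y hy => ?_⟩
      have a := (Finset.mem_filter.1 (hT1 hx)).2
      have b := (Finset.mem_filter.1 (hT1 hy)).2
      simp only [Bool.not_eq_true] at a b
      rw [a, b]
  obtain ⟨T, hTB, hTc, hTs⟩ := hT
  have hTi : Imm (KOn T) H := by
    obtain ⟨S, s1, s2, s3⟩ := hBi
    have hle : KOn T ≤ KOn B := fun a b h => ⟨hTB h.1, hTB h.2.1, h.2.2⟩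
    have hsub : (KOn T).edgeSet ⊆ (KOn B).edgeSet := edgeSet_mono hle
    exact ⟨S, fun e he => s1 e (hsub he), fun e he e' he' => s2 e (hsub he) e' (hsub he'),
      fun a b h => s3 a b (hle h)⟩
  have hTX : T ⊆ X := by
    intro x hx
    obtain ⟨y, hy, hne⟩ := Finset.exists_mem_ne (s := T) (by omega) x
    obtain ⟨S, s1, s2, s3⟩ := hTi
    have hadj : (KOn T).Adj x y := ⟨hx, hy, hne.symm⟩
    obtain ⟨W⟩ := s3 x y hadj
    cases W with
    | nil => exact absurd rfl hne
    | cons h W' =>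
      have h2 := s1 _ (show s(x,y) ∈ (KOn T).edgeSet from hadj) ((fromEdgeSet_adj _).1 h).1
      exact ((hH _ _).1 h2).2.1
  have hout : ∀ e : Sym2 V, s(e.out.1, e.out.2) = e := fun e => Quot.out_eq e
  have hFo : ∀ e : {e // e ∈ F}, G.Adj e.1.out.1 e.1.out.2 ∧ e.1.out.1 ∈ X ∧ e.1.out.2 ∈ X ∧
      side e.1.out.1 = side e.1.out.2 := fun e => hF _ _ (by rw [hout]; exact e.2)
  have hFcard : Fintype.card {e // e ∈ F} = 3 * (N * N) := by
    rw [Fintype.card_coe, hFc]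
  refine assemble (ι := {e // e ∈ F}) G H hHG side hside t N hN (by omega) T hTc hTs hTi
    (fun e => e.1.out.1) (fun e => e.1.out.2) (fun e => (hFo e).1) (fun e => (hFo e).2.2.2) ?_ hFcard ?_
  · intro e e' h
    simp only [hout] at h
    exact Subtype.ext h
  intro Y
  obtain ⟨src, hsrc⟩ : ∃ src : {e // e ∈ F} × Bool → V, ∀ i, src i =
    (if i.2 then i.1.1.out.2 else i.1.1.out.1) := ⟨_, fun _ => rfl⟩
  have hgoal : (Finset.univ.filter (fun i : {e // e ∈ F} × Bool => src i ∈ Y)).card ≤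
      cutc H Y + 5 * N * (T ∩ Y).card := by
    have hsX : ∀ i, src i ∈ X := by
      rintro ⟨e, b⟩
      rw [hsrc]
      cases b
      · exact (hFo e).2.1
      · exact (hFo e).2.2.1
    have hfib : ∀ y, (Finset.univ.filter (fun i => src i = y)).card ≤ N := by
      intro y
      refine le_trans ?_ (hFdeg y)
      apply Finset.card_le_card_of_injOn (fun i => i.1.1)
      · rintro ⟨e, b⟩ hi
        have h1 := (Finset.mem_filter.1 (Finset.mem_coe.1 hi)).2
        rw [hsrc] at h1
        refine Finset.mem_coe.2 (Finset.mem_filter.2 ⟨e.2, ?_⟩)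
        show y ∈ e.1
        rw [← hout e.1, Sym2.mem_iff]
        cases b
        · exact Or.inl h1.symm
        · exact Or.inr h1.symm
      · rintro ⟨e, b⟩ hi ⟨e', b'⟩ hi' heq
        have h1 := (Finset.mem_filter.1 (Finset.mem_coe.1 hi)).2
        have h2 := (Finset.mem_filter.1 (Finset.mem_coe.1 hi')).2
        have h3 : e = e' := Subtype.ext heq
        subst h3
        rw [hsrc] at h1 h2
        have h4 := (hFo e).1.ne
        cases b <;> cases b'
        · rfl
        · exact absurd (h1.trans h2.symm) h4
        · exact absurd (h2.trans h1.symm) h4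
        · rfl
    have hsmall : (Finset.univ.filter (fun i => src i ∈ Y)).card ≤ N * (Y ∩ X).card := by
      have h5 : Set.MapsTo src (Finset.univ.filter (fun i => src i ∈ Y)) (Y ∩ X : Finset V) :=
        fun i hi => Finset.mem_coe.2 (Finset.mem_inter.2
          ⟨(Finset.mem_filter.1 (Finset.mem_coe.1 hi)).2, hsX i⟩)
      rw [Finset.card_eq_sum_card_fiberwise h5]
      calc _ ≤ ∑ w ∈ Y ∩ X, N := by
            refine Finset.sum_le_sum (fun w hw => le_trans (Finset.card_le_card ?_) (hfib w))
            exact Finset.filter_subset_filter _ (Finset.subset_univ _)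
        _ = _ := by rw [Finset.sum_const, smul_eq_mul, mul_comm]
    have htot : (Finset.univ.filter (fun i => src i ∈ Y)).card ≤ 6 * (N * N) := by
      refine (Finset.card_filter_le _ _).trans ?_
      rw [Finset.card_univ, Fintype.card_prod, hFcard, Fintype.card_bool]
      omega
    have hcutY : ec H (Y ∩ X) (X \ (Y ∩ X)) ≤ cutc H Y := by
      apply ec_le_cutc
      · intro x hx; exact (Finset.mem_inter.1 hx).1
      · intro x hx hxY
        rw [Finset.mem_sdiff] at hx
        exact hx.2 (Finset.mem_inter.2 ⟨hxY, hx.1⟩)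
    have hYX : Y ∩ X ⊆ X := Finset.inter_subset_right
    have hTY : T.card ≤ (T ∩ Y).card + (X \ (Y ∩ X)).card := by
      refine le_trans (Finset.card_le_card ?_) (Finset.card_union_le _ _)
      intro x hx
      rw [Finset.mem_union, Finset.mem_inter, Finset.mem_sdiff, Finset.mem_inter]
      by_cases hxY : x ∈ Y
      · exact Or.inl ⟨hx, hxY⟩
      · exact Or.inr ⟨hTX hx, fun h => hxY h.1⟩
    rcases Finset.eq_empty_or_nonempty (Y ∩ X) with hE | hE
    · rw [hE] at hsmall
      simp only [Finset.card_empty, mul_zero, Nat.le_zero] at hsmall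
      omega
    rcases Finset.eq_empty_or_nonempty (X \ (Y ∩ X)) with hZ | hZ
    · rw [hZ, Finset.card_empty, add_zero, hTc] at hTY
      have : 5 * N * (320 * N) ≤ 5 * N * (T ∩ Y).card := Nat.mul_le_mul_left _ hTY
      nlinarith
    by_cases hYN : (Y ∩ X).card ≤ N
    · have h1 := hcutS _ hYX hE hZ hYN
      have h2 : N * (Y ∩ X).card ≤ 87499 * N * (Y ∩ X).card :=
        Nat.mul_le_mul_right _ (by omega)
      omega
    by_cases hZN : (X \ (Y ∩ X)).card ≤ N
    · have h1 := hcutS (X \ (Y ∩ X)) Finset.sdiff_subset hZ (by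
        rw [Finset.sdiff_sdiff_eq_self hYX]; exact hE) hZN
      rw [Finset.sdiff_sdiff_eq_self hYX, ec_comm] at h1
      have h2 : 5 * N * (X \ (Y ∩ X)).card ≤ 87499 * N * (X \ (Y ∩ X)).card :=
        Nat.mul_le_mul_right _ (by omega)
      have h3 : 5 * N * (320 * N) ≤ 5 * N * ((T ∩ Y).card + (X \ (Y ∩ X)).card) :=
        Nat.mul_le_mul_left _ (hTc ▸ hTY)
      rw [mul_add] at h3
      have h4 : 6 * (N * N) ≤ 5 * N * (320 * N) := by nlinarith
      omega
    · have h1 := (hXcut _ hYX hE hZ).2 (by omega) (by omega)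
      have h2 := hHcut _ hYX
      omega
  simpa only [hsrc] using hgoal

end P16
end TOI

/-- For every integer t ≥ 1, every finite simple graph G that does not
admit a totally odd immersion of K_t has chromatic number at most 700000·t + 32000000. -/
theorem totally_odd_immersion_free_coloring {V : Type*} [Fintype V] (t : ℕ) (ht : 1 ≤ t)
    (G : SimpleGraph V) (h : ¬ HasTotallyOddImmersion G (⊤ : SimpleGraph (Fin t))) :
    G.chromaticNumber ≤ 700000 * t + 32000000 := by
  by_contra hc
  apply h
  apply TOI.main_contra G t ht
  intro hcol
  apply hc
  have h2 := hcol.chromaticNumber_le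
  refine h2.trans ?_
  have h3 : 2 * (350000 * t + 16000000) = 700000 * t + 32000000 := by ring
  rw [h3]
  push_cast
  exact le_rfl
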